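/- arXiv:2107.13086 — 3 statements merged into one kernel-verified Lean document; each statement's English description precedes it below -/
import Mathlib

section
/- Let η be the infinite sequence of rationals in [0,1] formed by concatenating, over the primes p = 2, 3, 5, 7, ... in increasing order, the blocks (1⁻¹ mod p)/p, (2⁻¹ mod p)/p, ..., ((p−1)⁻¹ mod p)/p. Then the star discrepancy of η satisfies D_N*(η) = O(1/√(N ln N)), i.e. there exist an absolute constant C > 0 and N₀ ∈ ℕ such that for all N ≥ N₀, D_N*(η) ≤ C/√(N ln N). -/
open Filter Finset
open scoped BigOperators Classical

/-- `starCount ξ N r` = number of indices `n` with `1 ≤ n ≤ N` and `ξ n ∈ [0, r]`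
(counted with multiplicity). -/
noncomputable def starCount (ξ : ℕ → ℝ) (N : ℕ) (r : ℝ) : ℕ :=
  ((Finset.Icc 1 N).filter (fun n => ξ n ∈ Set.Icc (0 : ℝ) r)).card

/-- Star discrepancy of the first `N` terms of the sequence `ξ` (indexed from 1):
`D_N*(ξ) = sup_{0 < r ≤ 1} |A_N(ξ, r)/N − r|`. -/
noncomputable def starDisc (ξ : ℕ → ℝ) (N : ℕ) : ℝ :=
  sSup {d : ℝ | ∃ r : ℝ, 0 < r ∧ r ≤ 1 ∧ d = |(starCount ξ N r : ℝ) / (N : ℝ) - r|}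

/-- The `m`-th prime number, 1-indexed: `nthPrime 1 = 2`, `nthPrime 2 = 3`, … -/
noncomputable def nthPrime (m : ℕ) : ℕ := Nat.nth Nat.Prime (m - 1)

/-- `Psum m = ∑_{k=1}^m (p_k − 1)`, the number of terms in the first `m` blocks of `η`. -/
noncomputable def Psum (m : ℕ) : ℕ := ∑ k ∈ Finset.Icc 1 m, (nthPrime k - 1)

/-- `invMod j p` = the representative in `{0, …, p−1}` of `j⁻¹ (mod p)`. -/
noncomputable def invMod (j p : ℕ) : ℕ := ((j : ZMod p)⁻¹).val

/-- The sequence `η` (indexed from 1), obtained by concatenating over the primes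
`p = 2, 3, 5, …` the blocks `(j⁻¹ mod p)/p` for `j = 1, …, p−1`.
For `n ≥ 1`, if `m` is minimal with `n ≤ Psum (m+1)` (so `Psum m < n ≤ Psum (m+1)`),
then `η n` is the `(n − Psum m)`-th element of the block for the prime `nthPrime (m+1)`. -/
noncomputable def eta (n : ℕ) : ℝ :=
  if h : ∃ m, n ≤ Psum (m + 1) then
    (invMod (n - Psum (Nat.find h)) (nthPrime (Nat.find h + 1)) : ℝ) /
      (nthPrime (Nat.find h + 1) : ℝ)
  else 0

section Kloo
variable {p : ℕ} [Fact p.Prime]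

noncomputable def ees (x : ZMod p) : ℂ := ZMod.stdAddChar x

lemma ees_add (x y : ZMod p) : ees (x + y) = ees x * ees y := AddChar.map_add_eq_mul _ _ _
lemma ees_zero : ees (0 : ZMod p) = 1 := AddChar.map_zero_eq_one _
lemma ees_norm (x : ZMod p) : ‖ees x‖ = 1 := AddChar.norm_apply _ _
lemma ees_conj (x : ZMod p) : (starRingEnd ℂ) (ees x) = ees (-x) :=
  (AddChar.map_neg_eq_conj _ _).symm
lemma ees_sum (b : ZMod p) : ∑ a : ZMod p, ees (a * b) = if b = 0 then (p : ℂ) else 0 := by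
  have := AddChar.sum_mulShift b (ZMod.isPrimitive_stdAddChar p)
  unfold ees
  rw [this, ZMod.card]
  split_ifs <;> simp

lemma moment {X : Type*} [Fintype X] (f g : X → ZMod p) :
    ∑ a : ZMod p, ∑ b : ZMod p, ‖∑ x : X, ees (a * f x + b * g x)‖ ^ 2 =
      (p : ℝ) ^ 2 * ((univ : Finset (X × X)).filter
        (fun z => f z.1 = f z.2 ∧ g z.1 = g z.2)).card := by
  have h1 : ∀ a b : ZMod p, ((‖∑ x : X, ees (a * f x + b * g x)‖ ^ 2 : ℝ) : ℂ) =
      ∑ z : X × X, ees (a * (f z.1 - f z.2)) * ees (b * (g z.1 - g z.2)) := by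
    intro a b
    rw [Complex.ofReal_pow, ← Complex.mul_conj', map_sum, Finset.sum_mul_sum,
      Fintype.sum_prod_type]
    refine Finset.sum_congr rfl fun x _ => Finset.sum_congr rfl fun y _ => ?_
    rw [ees_conj, ← ees_add, ← ees_add]
    congr 1; ring
  have h2 : ((∑ a : ZMod p, ∑ b : ZMod p, ‖∑ x : X, ees (a * f x + b * g x)‖ ^ 2 : ℝ) : ℂ) =
      (((p : ℝ) ^ 2 * ((univ : Finset (X × X)).filter
        (fun z => f z.1 = f z.2 ∧ g z.1 = g z.2)).card : ℝ) : ℂ) := by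
    rw [Complex.ofReal_sum]
    simp_rw [Complex.ofReal_sum, h1]
    have : ∀ a : ZMod p, ∑ b : ZMod p, ∑ z : X × X,
        ees (a * (f z.1 - f z.2)) * ees (b * (g z.1 - g z.2)) =
        ∑ z : X × X, ees (a * (f z.1 - f z.2)) * ∑ b : ZMod p, ees (b * (g z.1 - g z.2)) := by
      intro a
      rw [Finset.sum_comm]
      simp_rw [Finset.mul_sum]
    simp_rw [this]
    rw [Finset.sum_comm]
    simp_rw [← Finset.sum_mul, ees_sum, sub_eq_zero]
    push_cast
    rw [Finset.card_filter]
    push_cast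
    rw [Finset.mul_sum]
    refine Finset.sum_congr rfl fun z _ => ?_
    by_cases h : f z.1 = f z.2 <;> by_cases h' : g z.1 = g z.2 <;> simp [h, h', sq]
  exact_mod_cast h2

noncomputable def Kl (a b : ZMod p) : ℂ :=
  ∑ x : (ZMod p)ˣ, ees (a * (x : ZMod p) + b * ((x⁻¹ : (ZMod p)ˣ) : ZMod p))

lemma card_units' : Fintype.card (ZMod p)ˣ = p - 1 := ZMod.card_units p

lemma energy : ((univ : Finset (((ZMod p)ˣ × (ZMod p)ˣ) × ((ZMod p)ˣ × (ZMod p)ˣ))).filter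
    (fun z => ((z.1.1 : ZMod p) + z.1.2 = z.2.1 + z.2.2) ∧
      ((z.1.1⁻¹ : (ZMod p)ˣ) : ZMod p) + (z.1.2⁻¹ : (ZMod p)ˣ) =
        (z.2.1⁻¹ : (ZMod p)ˣ) + (z.2.2⁻¹ : (ZMod p)ˣ))).card ≤ 3 * (p - 1) ^ 2 := by
  set U := (ZMod p)ˣ
  have hc : (univ : Finset (U × U)).card = (p - 1) ^ 2 := by
    rw [Finset.card_univ, Fintype.card_prod, card_units', sq]
  have hsub : ((univ : Finset ((U × U) × (U × U))).filter
    (fun z => ((z.1.1 : ZMod p) + z.1.2 = z.2.1 + z.2.2) ∧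
      ((z.1.1⁻¹ : (ZMod p)ˣ) : ZMod p) + (z.1.2⁻¹ : (ZMod p)ˣ) =
        (z.2.1⁻¹ : (ZMod p)ˣ) + (z.2.2⁻¹ : (ZMod p)ˣ))) ⊆
      ((univ : Finset (U × U)).image (fun w => ((w.1, -w.1), (w.2, -w.2))) ∪
       (univ : Finset (U × U)).image (fun w => ((w.1, w.2), (w.1, w.2)))) ∪
       (univ : Finset (U × U)).image (fun w => ((w.1, w.2), (w.2, w.1))) := by
    rintro ⟨⟨a, b⟩, ⟨c, d⟩⟩ h
    simp only [mem_filter, mem_univ, true_and, Units.val_inv_eq_inv_val] at h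
    obtain ⟨h1, h2⟩ := h
    simp only [mem_union, mem_image, mem_univ, true_and, Prod.mk.injEq, Prod.exists]
    have ha := a.ne_zero
    have hb := b.ne_zero
    have hc := c.ne_zero
    have hd := d.ne_zero
    by_cases hs : (a : ZMod p) + b = 0
    · left; left
      refine ⟨a, c, ⟨rfl, ?_⟩, rfl, ?_⟩
      · ext; rw [Units.val_neg]; linear_combination -hs
      · ext; rw [Units.val_neg]; linear_combination h1 - hs
    · have h3 : (a : ZMod p) * b = c * d := by
        field_simp at h2
        have : ((a : ZMod p) + b) * (c * d - a * b) = 0 := by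
          linear_combination h2 - (a : ZMod p) * b * h1
        rcases mul_eq_zero.1 this with h | h
        · exact absurd h hs
        · linear_combination -h
      have h4 : ((c : ZMod p) - a) * (c - b) = 0 := by
        linear_combination h3 - (c : ZMod p) * h1
      rcases mul_eq_zero.1 h4 with h | h
      · left; right
        refine ⟨a, b, ⟨rfl, rfl⟩, ?_, ?_⟩
        · ext; linear_combination -h
        · ext; linear_combination h1 + h
      · right
        refine ⟨a, b, ⟨rfl, rfl⟩, ?_, ?_⟩
        · ext; linear_combination -h
        · ext; linear_combination h1 + h
  refine (Finset.card_le_card hsub).trans ?_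
  refine (Finset.card_union_le _ _).trans ?_
  have := Finset.card_union_le ((univ : Finset (U × U)).image (fun w => ((w.1, -w.1), (w.2, -w.2))))
       ((univ : Finset (U × U)).image (fun w => ((w.1, w.2), (w.1, w.2))))
  have i1 := Finset.card_image_le (s := (univ : Finset (U × U)))
    (f := (fun w => ((w.1, -w.1), (w.2, -w.2))))
  have i2 := Finset.card_image_le (s := (univ : Finset (U × U)))
    (f := (fun w => ((w.1, w.2), (w.1, w.2))))
  have i3 := Finset.card_image_le (s := (univ : Finset (U × U)))
    (f := (fun w => ((w.1, w.2), (w.2, w.1))))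
  rw [hc] at i1 i2 i3
  omega

lemma Kl_fourth : ∑ a : ZMod p, ∑ b : ZMod p, ‖Kl a b‖ ^ 4 ≤ (p : ℝ) ^ 2 * (3 * ((p : ℝ) - 1) ^ 2) := by
  have h := moment (p := p) (X := (ZMod p)ˣ × (ZMod p)ˣ) (fun z => (z.1 : ZMod p) + z.2)
    (fun z => ((z.1⁻¹ : (ZMod p)ˣ) : ZMod p) + ((z.2⁻¹ : (ZMod p)ˣ) : ZMod p))
  have h1 : ∀ a b : ZMod p, ‖Kl a b‖ ^ 4 = ‖∑ z : (ZMod p)ˣ × (ZMod p)ˣ,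
      ees (a * ((z.1 : ZMod p) + (z.2 : ZMod p)) +
        b * (((z.1⁻¹ : (ZMod p)ˣ) : ZMod p) + ((z.2⁻¹ : (ZMod p)ˣ) : ZMod p)))‖ ^ 2 := by
    intro a b
    have : ∑ z : (ZMod p)ˣ × (ZMod p)ˣ,
      ees (a * ((z.1 : ZMod p) + (z.2 : ZMod p)) +
        b * (((z.1⁻¹ : (ZMod p)ˣ) : ZMod p) + ((z.2⁻¹ : (ZMod p)ˣ) : ZMod p))) = Kl a b * Kl a b := by
      unfold Kl
      rw [Finset.sum_mul_sum, Fintype.sum_prod_type]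
      refine Finset.sum_congr rfl fun x _ => Finset.sum_congr rfl fun y _ => ?_
      rw [← ees_add]; congr 1; ring
    rw [this, norm_mul]; ring
  simp_rw [h1]
  rw [h]
  have hp : 1 ≤ p := (Fact.out : p.Prime).one_lt.le
  have := energy (p := p)
  have h2 : (((univ : Finset (((ZMod p)ˣ × (ZMod p)ˣ) × ((ZMod p)ˣ × (ZMod p)ˣ))).filter
    (fun z => ((z.1.1 : ZMod p) + z.1.2 = z.2.1 + z.2.2) ∧
      ((z.1.1⁻¹ : (ZMod p)ˣ) : ZMod p) + (z.1.2⁻¹ : (ZMod p)ˣ) =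
        (z.2.1⁻¹ : (ZMod p)ˣ) + (z.2.2⁻¹ : (ZMod p)ˣ))).card : ℝ) ≤ 3 * ((p : ℝ) - 1) ^ 2 := by
    have : _ ≤ ((3 * (p - 1) ^ 2 : ℕ) : ℝ) := Nat.cast_le.2 this
    refine this.trans_eq ?_
    push_cast [Nat.cast_sub hp]
    rfl
  exact mul_le_mul_of_nonneg_left h2 (by positivity)

lemma Kl_smul (a b : ZMod p) (t : (ZMod p)ˣ) :
    Kl (a * (t : ZMod p)) (b * ((t⁻¹ : (ZMod p)ˣ) : ZMod p)) = Kl a b := by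
  unfold Kl
  rw [← Equiv.sum_comp (Equiv.mulLeft t) (fun x : (ZMod p)ˣ => ees (a * (x : ZMod p) + b * ((x⁻¹ : (ZMod p)ˣ) : ZMod p)))]
  refine Finset.sum_congr rfl fun x _ => ?_
  congr 1
  simp only [Equiv.coe_mulLeft, Units.val_mul, mul_inv_rev]
  ring

lemma Kl_bound_ne {a b : ZMod p} (ha : a ≠ 0) : ‖Kl a b‖ ^ 4 ≤ 3 * (p : ℝ) ^ 3 := by
  have hp : (1 : ℝ) < p := by exact_mod_cast (Fact.out : p.Prime).one_lt
  have h1 : ∑ t : (ZMod p)ˣ, ‖Kl (a * (t : ZMod p)) (b * ((t⁻¹ : (ZMod p)ˣ) : ZMod p))‖ ^ 4 ≤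
      ∑ z : ZMod p × ZMod p, ‖Kl z.1 z.2‖ ^ 4 := by
    have hinj : Function.Injective (fun t : (ZMod p)ˣ => (a * (t : ZMod p), b * ((t⁻¹ : (ZMod p)ˣ) : ZMod p))) := by
      intro s t h
      simp only [Prod.mk.injEq] at h
      exact Units.ext (mul_left_cancel₀ ha h.1)
    rw [← Finset.sum_image (s := univ) (f := fun z : ZMod p × ZMod p => ‖Kl z.1 z.2‖ ^ 4)
      (g := (fun t : (ZMod p)ˣ => (a * (t : ZMod p), b * ((t⁻¹ : (ZMod p)ˣ) : ZMod p)))) (hinj.injOn)]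
    exact Finset.sum_le_sum_of_subset_of_nonneg (Finset.subset_univ _) (fun _ _ _ => by positivity)
  rw [Fintype.sum_prod_type] at h1
  have h2 := h1.trans Kl_fourth
  simp_rw [Kl_smul] at h2
  rw [Finset.sum_const, Finset.card_univ, card_units', nsmul_eq_mul,
    Nat.cast_sub (Fact.out : p.Prime).one_lt.le, Nat.cast_one] at h2
  have h3 : ((p : ℝ) - 1) * ‖Kl a b‖ ^ 4 ≤ (p - 1) * (3 * (p : ℝ) ^ 2 * (p - 1)) := by
    linarith
  have h4 := le_of_mul_le_mul_left h3 (by linarith)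
  nlinarith [sq_nonneg (p : ℝ)]

lemma Kl_symm (a b : ZMod p) : Kl a b = Kl b a := by
  unfold Kl
  rw [← Equiv.sum_comp (Equiv.inv (ZMod p)ˣ)]
  refine Finset.sum_congr rfl fun x _ => ?_
  rw [Equiv.inv_apply, inv_inv, add_comm]

lemma Kl_bound {a b : ZMod p} (h : ¬ (a = 0 ∧ b = 0)) : ‖Kl a b‖ ≤ 2 * (p : ℝ) ^ (3 / 4 : ℝ) := by
  have h4 : ‖Kl a b‖ ^ 4 ≤ 3 * (p : ℝ) ^ 3 := by
    by_cases ha : a = 0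
    · rw [Kl_symm]; exact Kl_bound_ne (fun hb => h ⟨ha, hb⟩)
    · exact Kl_bound_ne ha
  have h5 : ((p : ℝ) ^ (3 / 4 : ℝ)) ^ 4 = (p : ℝ) ^ 3 := by
    rw [← Real.rpow_natCast, ← Real.rpow_mul (by positivity), ← Real.rpow_natCast]
    norm_num
  refine le_of_pow_le_pow_left₀ (n := 4) (by norm_num) (by positivity) ?_
  rw [mul_pow, h5]
  have : (0 : ℝ) ≤ (p : ℝ) ^ 3 := by positivity
  linarith

lemma Kl_zero : Kl (0 : ZMod p) 0 = (p : ℂ) - 1 := by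
  unfold Kl
  simp only [zero_mul, add_zero, ees_zero, sum_const, card_univ, card_units', nsmul_eq_mul, mul_one]
  rw [Nat.cast_sub (Fact.out : p.Prime).one_lt.le, Nat.cast_one]

end Kloo
lemma sum_Icc_range {A : Type*} [AddCommMonoid A] (f : ℕ → A) (M : ℕ) :
    ∑ j ∈ Icc 1 M, f j = ∑ j ∈ range M, f (j + 1) := by
  have : Icc 1 M = Ico 1 (M + 1) := by ext; simp only [Finset.mem_Icc, Finset.mem_Ico]; omega
  rw [this, Finset.sum_Ico_eq_sum_range]
  simp [add_comm]

section Four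
variable {p : ℕ} [Fact p.Prime]

noncomputable def Fh (M : ℕ) (a : ZMod p) : ℂ := ∑ j ∈ Icc 1 M, ees (-(a * (j : ZMod p)))

lemma ees_nat_mul (n : ℕ) (a : ZMod p) : ees ((n : ZMod p) * a) = ees a ^ n := by
  induction n with
  | zero => simp [ees_zero]
  | succ n ih => rw [Nat.cast_succ, add_mul, one_mul, ees_add, ih, pow_succ]

lemma ees_sub_one (a : ZMod p) : ‖ees a - 1‖ = 2 * |Real.sin (Real.pi * a.val / p)| := by
  unfold ees
  rw [ZMod.stdAddChar_apply, ZMod.toCircle_apply]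
  have := Complex.norm_exp_I_mul_ofReal_sub_one (2 * Real.pi * a.val / p)
  rw [norm_mul, Real.norm_eq_abs, Real.norm_eq_abs, abs_two] at this
  rw [show Real.pi * a.val / p = 2 * Real.pi * a.val / p / 2 by ring, ← this]
  congr 3
  push_cast
  ring

lemma Fh_norm (M : ℕ) {a : ZMod p} (ha : a ≠ 0) :
    ‖Fh M a‖ ≤ (p : ℝ) / 2 * (1 / (a.val : ℝ) + 1 / ((p : ℝ) - a.val)) := by
  have hp0 : (0 : ℝ) < p := by exact_mod_cast (Fact.out : p.Prime).pos
  have hk0 : (0 : ℝ) < a.val := by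
    have : 0 < a.val := Nat.pos_of_ne_zero (by rwa [Ne, ZMod.val_eq_zero])
    exact_mod_cast this
  have hkp : (a.val : ℝ) < p := by exact_mod_cast ZMod.val_lt a
  set k : ℝ := (a.val : ℝ)
  have h1 : Fh M a * (ees (-a) - 1) = ees (-a) * (ees (-a) ^ M - 1) := by
    rw [← geom_sum_mul, ← mul_assoc]
    congr 1
    unfold Fh
    rw [sum_Icc_range, Finset.mul_sum]
    refine Finset.sum_congr rfl fun j _ => ?_
    rw [← pow_succ', ← ees_nat_mul]
    congr 1; push_cast; ring
  have h2 : ‖Fh M a‖ * ‖ees (-a) - 1‖ ≤ 2 := by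
    rw [← norm_mul, h1, norm_mul, ees_norm, one_mul]
    refine (norm_sub_le _ _).trans ?_
    rw [norm_pow, ees_norm]; norm_num
  have h3 : ‖ees (-a) - 1‖ = ‖ees a - 1‖ := by
    rw [← ees_conj, ← Complex.norm_conj]; simp
  rw [h3, ees_sub_one] at h2
  have hs : ∀ x : ℝ, 0 ≤ x → x ≤ p / 2 → 2 * x / p ≤ Real.sin (Real.pi * x / p) := by
    intro x hx hx2
    have := Real.mul_le_sin (x := Real.pi * x / p) (by positivity) (by
      rw [div_le_div_iff₀ hp0 two_pos]; nlinarith [Real.pi_pos])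
    refine le_trans (le_of_eq ?_) this
    field_simp
  have key : ∀ x : ℝ, 0 < x → 2 * x / p ≤ |Real.sin (Real.pi * k / p)| → ‖Fh M a‖ ≤ p / 2 * (1 / x) := by
    intro x hx h
    have : ‖Fh M a‖ * (2 * (2 * x / p)) ≤ 2 :=
      (mul_le_mul_of_nonneg_left (by linarith) (norm_nonneg _)).trans h2
    rw [show (p : ℝ) / 2 * (1 / x) = p / (2 * x) by field_simp, le_div_iff₀ (by positivity)]
    have h5 : ‖Fh M a‖ * (2 * (2 * x / p)) = 2 * (‖Fh M a‖ * (2 * x)) / p := by ring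
    rw [h5, div_le_iff₀ hp0] at this
    linarith
  have q1 : 0 ≤ 1 / k := by positivity
  have q2 : 0 ≤ 1 / ((p : ℝ) - k) := by
    apply div_nonneg zero_le_one; linarith
  rcases le_total k (p / 2) with h | h
  · refine (key k hk0 ((hs k hk0.le h).trans (le_abs_self _))).trans ?_
    gcongr; linarith
  · refine (key (p - k) (by linarith) ?_).trans ?_
    · have := hs (p - k) (by linarith) (by linarith)
      rw [show Real.pi * (p - k) / p = Real.pi - Real.pi * k / p by field_simp, Real.sin_pi_sub] at this
      exact this.trans (le_abs_self _)
    · gcongr; linarith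

lemma sum_zmod_val (g : ℕ → ℝ) : ∑ a : ZMod p, g a.val = ∑ k ∈ range p, g k := by
  refine Finset.sum_nbij ZMod.val (fun a _ => Finset.mem_range.2 (ZMod.val_lt a))
    (fun a _ b _ h => ZMod.val_injective p h) ?_ (fun _ _ => rfl)
  intro k hk
  refine ⟨(k : ZMod p), by simp, ZMod.val_cast_of_lt (by simpa using hk)⟩

lemma Fh_sum {M : ℕ} (hM : M < p) : ∑ a : ZMod p, ‖Fh M a‖ ≤ (p : ℝ) * (2 + Real.log p) := by
  have hp1 : 1 < p := (Fact.out : p.Prime).one_lt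
  have hp0 : (0 : ℝ) < p := by exact_mod_cast (Fact.out : p.Prime).pos
  obtain ⟨q, hq⟩ : ∃ q, p = q + 1 := ⟨p - 1, by omega⟩
  let g : ℕ → ℝ := fun k => if k = 0 then (p : ℝ) else (p : ℝ) / 2 * (1 / (k : ℝ) + 1 / ((p : ℝ) - k))
  have h1 : ∑ a : ZMod p, ‖Fh M a‖ ≤ ∑ a : ZMod p, g a.val := by
    refine Finset.sum_le_sum fun a _ => ?_
    by_cases ha : a = 0
    · subst ha
      simp only [g, ZMod.val_zero, if_true]
      unfold Fh
      refine (norm_sum_le _ _).trans ?_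
      simp only [ees_norm, sum_const, Nat.card_Icc, nsmul_eq_mul, mul_one]
      have : M + 1 - 1 ≤ p := by omega
      exact_mod_cast this
    · have : a.val ≠ 0 := by rwa [Ne, ZMod.val_eq_zero]
      simp only [g, this, if_false]
      exact Fh_norm M ha
  refine h1.trans ?_
  rw [sum_zmod_val]
  have h2 : ∑ k ∈ range p, g k = p + ∑ k ∈ range q, (p : ℝ) / 2 * (1 / ((k : ℝ) + 1) + 1 / ((p : ℝ) - (k + 1))) := by
    conv_lhs => rw [hq]
    rw [Finset.sum_range_succ', add_comm]
    congr 1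
    refine Finset.sum_congr rfl fun k _ => ?_
    simp [g]
  rw [h2, ← Finset.mul_sum, Finset.sum_add_distrib]
  have hH : ∑ k ∈ range q, 1 / ((k : ℝ) + 1) ≤ 1 + Real.log p := by
    have := harmonic_le_one_add_log q
    rw [harmonic] at this
    push_cast at this
    simp only [one_div]
    refine this.trans ?_
    rcases Nat.eq_zero_or_pos q with h | h
    · omega
    · gcongr; omega
  have hR : ∑ k ∈ range q, 1 / ((p : ℝ) - (k + 1)) = ∑ k ∈ range q, 1 / ((k : ℝ) + 1) := by
    rw [← Finset.sum_range_reflect]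
    refine Finset.sum_congr rfl fun k hk => ?_
    have : k < q := by simpa using hk
    have e : q - 1 - k = q - (k + 1) := by omega
    rw [e, Nat.cast_sub (by omega), hq]
    congr 1; push_cast; ring
  rw [hR]
  nlinarith

/-- the count -/
noncomputable def cnt (p M K : ℕ) : ℕ := ((Icc 1 M).filter (fun j => invMod j p ≤ K)).card

noncomputable def ind (M : ℕ) (x : ZMod p) : ℂ := ∑ j ∈ Icc 1 M, if (j : ZMod p) = x then 1 else 0

lemma ind_fourier (M : ℕ) (x : ZMod p) : (p : ℂ) * ind M x = ∑ a : ZMod p, Fh M a * ees (a * x) := by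
  unfold Fh ind
  simp_rw [Finset.sum_mul, ← ees_add]
  rw [Finset.sum_comm, Finset.mul_sum]
  refine Finset.sum_congr rfl fun j _ => ?_
  have : ∀ a : ZMod p, -(a * (j : ZMod p)) + a * x = a * (x - j) := fun a => by ring
  simp_rw [this]
  rw [ees_sum]
  by_cases h : (j : ZMod p) = x
  · simp [h]
  · have : ¬ (x - j = 0) := fun h' => h (sub_eq_zero.1 h').symm
    simp [h, this]

lemma ind_eq {K : ℕ} (hK : K < p) (x : ZMod p) (hx : x ≠ 0) :
    ind K x = if x.val ≤ K then 1 else 0 := by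
  unfold ind
  have h : ∀ j ∈ Icc 1 K, (if (j : ZMod p) = x then (1 : ℂ) else 0) = if j = x.val then 1 else 0 := by
    intro j hj
    have hj' := Finset.mem_Icc.1 hj
    congr 1
    rw [eq_iff_iff]
    constructor
    · rintro rfl; rw [ZMod.val_cast_of_lt (by omega)]
    · rintro rfl; simp
  rw [Finset.sum_congr rfl h, Finset.sum_ite_eq']
  have : 0 < x.val := Nat.pos_of_ne_zero (by rwa [Ne, ZMod.val_eq_zero])
  simp only [Finset.mem_Icc]
  congr 1
  rw [eq_iff_iff]
  exact ⟨fun h => h.2, fun h => ⟨this, h⟩⟩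

lemma cnt_eq {M K : ℕ} (hM : M < p) (hK : K < p) : (cnt p M K : ℂ) =
    ∑ x : (ZMod p)ˣ, ind M (x : ZMod p) * ind K ((x⁻¹ : (ZMod p)ˣ) : ZMod p) := by
  unfold cnt
  rw [Finset.card_filter]
  conv_rhs => enter [2, x]; rw [ind, Finset.sum_mul]
  rw [Finset.sum_comm]
  push_cast
  refine Finset.sum_congr rfl fun j hj => ?_
  have hj' := Finset.mem_Icc.1 hj
  have hj0 : (j : ZMod p) ≠ 0 := by
    intro h
    have := (ZMod.natCast_eq_zero_iff j p).1 h
    have := Nat.le_of_dvd (by omega) this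
    omega
  rw [Finset.sum_eq_single (Units.mk0 _ hj0)]
  · rw [ind_eq hK _ (inv_ne_zero (Units.ne_zero _)), Units.val_mk0, if_pos rfl, one_mul]
    rfl
  · intro b _ hb
    have : ¬ ((j : ZMod p) = b) := fun h => hb (Units.ext h.symm)
    rw [if_neg this, zero_mul]
  · simp

lemma cnt_bound {M K : ℕ} (hM : M < p) (hK : K < p) :
    |(cnt p M K : ℝ) - M * K / p| ≤ 2 * (p : ℝ) ^ (3 / 4 : ℝ) * (2 + Real.log p) ^ 2 + 1 := by
  have hp0 : (0 : ℝ) < p := by exact_mod_cast (Fact.out : p.Prime).pos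
  have hF0 : ∀ L : ℕ, Fh L (0 : ZMod p) = L := by
    intro L; simp [Fh, ees_zero]
  have h1 : (p : ℂ) ^ 2 * (cnt p M K : ℂ) =
      ∑ z : ZMod p × ZMod p, Fh M z.1 * Fh K z.2 * Kl z.1 z.2 := by
    rw [cnt_eq hM hK, Finset.mul_sum]
    have : ∀ x : (ZMod p)ˣ, (p : ℂ) ^ 2 * (ind M (x : ZMod p) * ind K ((x⁻¹ : (ZMod p)ˣ) : ZMod p))
      = ∑ z : ZMod p × ZMod p, Fh M z.1 * Fh K z.2 *
        ees (z.1 * (x : ZMod p) + z.2 * ((x⁻¹ : (ZMod p)ˣ) : ZMod p)) := by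
      intro x
      rw [show (p : ℂ) ^ 2 * (ind M (x : ZMod p) * ind K ((x⁻¹ : (ZMod p)ˣ) : ZMod p)) =
        ((p : ℂ) * ind M (x : ZMod p)) * ((p : ℂ) * ind K ((x⁻¹ : (ZMod p)ˣ) : ZMod p)) by ring,
        ind_fourier, ind_fourier, Finset.sum_mul_sum, Fintype.sum_prod_type]
      refine Finset.sum_congr rfl fun a _ => Finset.sum_congr rfl fun b _ => ?_
      rw [ees_add]; ring
    simp_rw [this]
    rw [Finset.sum_comm]
    refine Finset.sum_congr rfl fun z _ => ?_
    rw [Kl, Finset.mul_sum]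
  rw [← Finset.add_sum_erase _ _ (Finset.mem_univ ((0 : ZMod p), (0 : ZMod p)))] at h1
  simp only [hF0, Kl_zero] at h1
  set E : ℂ := ∑ z ∈ univ.erase ((0 : ZMod p), (0 : ZMod p)), Fh M z.1 * Fh K z.2 * Kl z.1 z.2 with hE
  have hEb : ‖E‖ ≤ 2 * (p : ℝ) ^ (3 / 4 : ℝ) * ((p : ℝ) * (2 + Real.log p)) ^ 2 := by
    rw [hE]
    refine (norm_sum_le _ _).trans ?_
    have : ∀ z ∈ univ.erase ((0 : ZMod p), (0 : ZMod p)), ‖Fh M z.1 * Fh K z.2 * Kl z.1 z.2‖ ≤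
        ‖Fh M z.1‖ * ‖Fh K z.2‖ * (2 * (p : ℝ) ^ (3 / 4 : ℝ)) := by
      intro z hz
      rw [norm_mul, norm_mul]
      refine mul_le_mul_of_nonneg_left (Kl_bound ?_) (by positivity)
      intro h
      exact (Finset.mem_erase.1 hz).1 (Prod.ext h.1 h.2)
    refine (Finset.sum_le_sum this).trans ?_
    refine (Finset.sum_le_sum_of_subset_of_nonneg (Finset.erase_subset _ _)
      (fun _ _ _ => by positivity)).trans ?_
    rw [← Finset.sum_mul, mul_comm, Fintype.sum_prod_type]
    dsimp only
    rw [← Finset.sum_mul_sum, sq]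
    refine mul_le_mul_of_nonneg_left ?_ (by positivity)
    exact mul_le_mul (Fh_sum hM) (Fh_sum hK) (Finset.sum_nonneg fun _ _ => norm_nonneg _)
      ((Finset.sum_nonneg fun _ _ => norm_nonneg _).trans (Fh_sum hM))
  have h2 : E = (((p : ℝ) ^ 2 * (cnt p M K : ℝ) - M * K * (p - 1) : ℝ) : ℂ) := by
    push_cast
    linear_combination -h1
  rw [h2, Complex.norm_real, Real.norm_eq_abs] at hEb
  have h3 : (cnt p M K : ℝ) - M * K / p =
    ((p : ℝ) ^ 2 * (cnt p M K : ℝ) - M * K * (p - 1)) / (p : ℝ) ^ 2 - M * K / (p : ℝ) ^ 2 := by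
    field_simp; ring
  rw [h3]
  refine (abs_sub _ _).trans ?_
  refine add_le_add ?_ ?_
  · rw [abs_div, abs_of_nonneg (by positivity : (0 : ℝ) ≤ (p : ℝ) ^ 2), div_le_iff₀ (by positivity)]
    refine hEb.trans (le_of_eq (by ring))
  · rw [abs_of_nonneg (by positivity), div_le_one (by positivity), sq]
    have a1 : (M : ℝ) ≤ p := by exact_mod_cast hM.le
    have a2 : (K : ℝ) ≤ p := by exact_mod_cast hK.le
    exact mul_le_mul a1 a2 (by positivity) hp0.le

end Four
noncomputable def blk (p M : ℕ) (r : ℝ) : ℕ :=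
  ((Icc 1 M).filter (fun j => (invMod j p : ℝ) / (p : ℝ) ∈ Set.Icc (0 : ℝ) r)).card

section Blk
variable {p : ℕ} [Fact p.Prime]

lemma invMod_lt (j : ℕ) : invMod j p < p := ZMod.val_lt _

lemma invMod_pos {j : ℕ} (h1 : 1 ≤ j) (h2 : j < p) : 1 ≤ invMod j p := by
  unfold invMod
  apply Nat.pos_of_ne_zero
  rw [Ne, ZMod.val_eq_zero, inv_eq_zero, ZMod.natCast_eq_zero_iff]
  intro h
  have := Nat.le_of_dvd (by omega) h
  omega

lemma invMod_invMod {j : ℕ} (h2 : j < p) : invMod (invMod j p) p = j := by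
  unfold invMod
  rw [ZMod.natCast_val, ZMod.cast_id', id, inv_inv, ZMod.val_cast_of_lt h2]

lemma cnt_full {K : ℕ} (hK : K < p) : cnt p (p - 1) K = K := by
  have hp1 : 1 < p := (Fact.out : p.Prime).one_lt
  have : ((Icc 1 (p - 1)).filter (fun j => invMod j p ≤ K)).card = (Icc 1 K).card := by
    refine Finset.card_nbij' (fun j => invMod j p) (fun j => invMod j p) ?_ ?_ ?_ ?_
    · intro j hj
      simp only [coe_filter, Finset.mem_Icc, Set.mem_ofPred_eq, coe_Icc, Set.mem_Icc] at hj ⊢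
      exact ⟨invMod_pos hj.1.1 (by omega), hj.2⟩
    · intro j hj
      simp only [coe_filter, Finset.mem_Icc, Set.mem_ofPred_eq, coe_Icc, Set.mem_Icc] at hj ⊢
      have := invMod_lt (p := p) j
      rw [invMod_invMod (by omega)]
      exact ⟨⟨invMod_pos hj.1 (by omega), by omega⟩, hj.2⟩
    · intro j hj
      simp only [coe_filter, Finset.mem_Icc, Set.mem_ofPred_eq] at hj
      exact invMod_invMod (by omega)
    · intro j hj
      simp only [coe_Icc, Set.mem_Icc] at hj
      exact invMod_invMod (by omega)
  unfold cnt
  rw [this]; simp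

lemma exists_K {r : ℝ} (h0 : 0 < r) (h1 : r ≤ 1) : ∃ K : ℕ, K < p ∧ (∀ M, blk p M r = cnt p M K) ∧
    (K : ℝ) ≤ r * p ∧ r * p - 1 ≤ K := by
  have hp1 : 1 < p := (Fact.out : p.Prime).one_lt
  have hp0 : (0 : ℝ) < p := by exact_mod_cast (Fact.out : p.Prime).pos
  have hf : (⌊r * p⌋₊ : ℝ) ≤ r * p := Nat.floor_le (by positivity)
  refine ⟨min ⌊r * p⌋₊ (p - 1), by omega, ?_, ?_, ?_⟩
  · intro M
    unfold blk cnt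
    congr 1
    refine Finset.filter_congr fun j _ => ?_
    have hlt := invMod_lt (p := p) j
    rw [le_min_iff, Nat.le_floor_iff (by positivity), Set.mem_Icc, div_le_iff₀ hp0]
    constructor
    · intro h; exact ⟨h.2, by omega⟩
    · intro h; exact ⟨by positivity, h.1⟩
  · refine le_trans ?_ hf
    exact_mod_cast min_le_left _ _
  · rw [Nat.cast_min, le_min_iff]
    constructor
    · have := Nat.lt_floor_add_one (r * p); linarith
    · rw [Nat.cast_sub hp1.le]; push_cast; nlinarith

lemma blk_full {r : ℝ} (h0 : 0 < r) (h1 : r ≤ 1) :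
    |(blk p (p - 1) r : ℝ) - r * ((p - 1 : ℕ) : ℝ)| ≤ 1 := by
  have hp1 : 1 < p := (Fact.out : p.Prime).one_lt
  obtain ⟨K, hK, hb, h2, h3⟩ := exists_K (p := p) h0 h1
  rw [hb, cnt_full hK, Nat.cast_sub hp1.le, abs_le]
  push_cast
  constructor <;> linarith

lemma blk_part {r : ℝ} (h0 : 0 < r) (h1 : r ≤ 1) {M : ℕ} (hM : M < p) :
    |(blk p M r : ℝ) - r * M| ≤ 2 * (p : ℝ) ^ (3 / 4 : ℝ) * (2 + Real.log p) ^ 2 + 2 := by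
  have hp0 : (0 : ℝ) < p := by exact_mod_cast (Fact.out : p.Prime).pos
  obtain ⟨K, hK, hb, h2, h3⟩ := exists_K (p := p) h0 h1
  have hc := cnt_bound hM hK
  rw [hb]
  have hMp : (M : ℝ) / p ≤ 1 := by
    rw [div_le_one hp0]; exact_mod_cast hM.le
  have hMp0 : (0 : ℝ) ≤ (M : ℝ) / p := by positivity
  have h4 : |(M : ℝ) * K / p - r * M| ≤ 1 := by
    rw [show (M : ℝ) * K / p - r * M = (M / p) * (K - r * p) by field_simp, abs_mul,
      abs_of_nonneg hMp0]
    have : |(K : ℝ) - r * p| ≤ 1 := by rw [abs_le]; constructor <;> linarith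
    exact mul_le_one₀ hMp (abs_nonneg _) this
  have := abs_add_le ((cnt p M K : ℝ) - M * K / p) ((M : ℝ) * K / p - r * M)
  rw [show (cnt p M K : ℝ) - M * K / p + ((M : ℝ) * K / p - r * M) = cnt p M K - r * M by ring] at this
  linarith
end Blk

lemma nthPrime_prime (m : ℕ) : (nthPrime m).Prime := Nat.prime_nth_prime _

lemma Psum_succ (m : ℕ) : Psum (m + 1) = Psum m + (nthPrime (m + 1) - 1) := by
  unfold Psum
  rw [Finset.sum_Icc_succ_top (by omega)]

lemma Psum_zero : Psum 0 = 0 := by simp [Psum]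

lemma Psum_mono : Monotone Psum := monotone_nat_of_le_succ fun m => by rw [Psum_succ]; omega

lemma le_Psum (m : ℕ) : m ≤ Psum m := by
  induction m with
  | zero => omega
  | succ m ih =>
    rw [Psum_succ]
    have := (nthPrime_prime (m + 1)).one_lt
    omega

lemma eta_eq {m j : ℕ} (h1 : 1 ≤ j) (h2 : j < nthPrime (m + 1)) :
    eta (Psum m + j) = (invMod j (nthPrime (m + 1)) : ℝ) / (nthPrime (m + 1) : ℝ) := by
  have h : ∃ l, Psum m + j ≤ Psum (l + 1) := ⟨m, by rw [Psum_succ]; omega⟩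
  have hf : Nat.find h = m := by
    rw [Nat.find_eq_iff]
    refine ⟨by rw [Psum_succ]; omega, fun l hl => ?_⟩
    have := Psum_mono (show l + 1 ≤ m by omega)
    omega
  unfold eta
  rw [dif_pos h, hf, Nat.add_sub_cancel_left]

lemma starCount_add {m M : ℕ} (hM : M < nthPrime (m + 1)) (r : ℝ) :
    starCount eta (Psum m + M) r = starCount eta (Psum m) r + blk (nthPrime (m + 1)) M r := by
  unfold starCount blk
  simp only [Finset.card_filter]
  rw [sum_Icc_range, sum_Icc_range, sum_Icc_range, Finset.sum_range_add]
  congr 1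
  refine Finset.sum_congr rfl fun j hj => ?_
  have := Finset.mem_range.1 hj
  rw [add_assoc, eta_eq (by omega) (by omega)]

lemma full_bound {r : ℝ} (h0 : 0 < r) (h1 : r ≤ 1) (m : ℕ) :
    |(starCount eta (Psum m) r : ℝ) - r * Psum m| ≤ m := by
  induction m with
  | zero => simp [Psum_zero, starCount]
  | succ m ih =>
    haveI : Fact (nthPrime (m + 1)).Prime := ⟨nthPrime_prime _⟩
    have hp := (nthPrime_prime (m + 1)).one_lt
    rw [Psum_succ, starCount_add (by omega)]
    have h2 := blk_full (p := nthPrime (m + 1)) h0 h1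
    rw [abs_le] at *
    push_cast
    constructor <;> linarith [ih.1, ih.2, h2.1, h2.2]

lemma pi_nthPrime (m : ℕ) : (nthPrime (m + 1)).primeCounting = m + 1 := by
  unfold nthPrime
  rw [Nat.primeCounting, Nat.primeCounting', Nat.count_succ, if_pos (Nat.prime_nth_prime _)]
  have := Nat.primeCounting'_nth_eq m
  rw [Nat.primeCounting'] at this
  simp [this]

lemma E_bound {p : ℕ} (hp : 2 ≤ p) :
    2 * (p : ℝ) ^ (3 / 4 : ℝ) * (2 + Real.log p) ^ 2 + 2 ≤ 104000 * p.primeCounting := by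
  have hp' : (2 : ℝ) ≤ p := by exact_mod_cast hp
  set x : ℝ := (p : ℝ) with hx
  have hx0 : 0 < x := by linarith
  have hlog : 0 < Real.log x := Real.log_pos (by linarith)
  set t : ℝ := x ^ (1 / 16 : ℝ) with ht
  have ht1 : 1 ≤ t := Real.one_le_rpow (by linarith) (by norm_num)
  have h1 : Real.log x ≤ 16 * t := by
    have := Real.log_le_rpow_div hx0.le (show (0 : ℝ) < 1 / 16 by norm_num)
    rw [← ht] at this; linarith
  have tp : ∀ n : ℕ, t ^ n = x ^ ((n : ℝ) / 16) := by
    intro n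
    rw [ht, ← Real.rpow_natCast, ← Real.rpow_mul hx0.le]; congr 1; ring
  have e1 : x ^ (3 / 4 : ℝ) = t ^ 12 := by rw [tp]; norm_num
  have e2 : x = t ^ 16 := by rw [tp]; norm_num
  have h3 : 2 * x ^ (3 / 4 : ℝ) * (2 + Real.log x) ^ 2 + 2 ≤ 650 * t ^ 14 := by
    rw [e1]
    have : (2 + Real.log x) ^ 2 ≤ (18 * t) ^ 2 := by
      apply pow_le_pow_left₀ (by linarith); linarith
    have t12 : 0 ≤ 2 * t ^ 12 := by positivity
    have := mul_le_mul_of_nonneg_left this t12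
    have : 1 ≤ t ^ 14 := one_le_pow₀ ht1
    nlinarith
  have h4 : 0.1 * x ≤ x * Real.log 2 - Real.log (x + 1) := by
    have l2 := Real.log_two_gt_d9
    have l2' := Real.log_two_lt_d9
    have a : Real.log (x + 1) = Real.log ((x + 1) / 4) + 2 * Real.log 2 := by
      rw [Real.log_div (by linarith) (by norm_num), show (4 : ℝ) = 2 ^ 2 by norm_num, Real.log_pow]
      push_cast; ring
    have b := Real.log_le_sub_one_of_pos (show 0 < (x + 1) / 4 by linarith)
    nlinarith
  have h5 := Chebyshev.pi_ge p
  rw [← hx, div_le_iff₀ hlog] at h5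
  set P : ℝ := (p.primeCounting : ℝ)
  have hP : 0 ≤ P := by positivity
  have h6 : 0.1 * t ^ 16 ≤ P * (16 * t) := by
    rw [← e2]
    exact (h4.trans h5).trans (mul_le_mul_of_nonneg_left h1 hP)
  have h7 : t ^ 15 ≤ 160 * P := by
    have : t * t ^ 15 ≤ t * (160 * P) := by nlinarith
    exact le_of_mul_le_mul_left this (by linarith)
  have h8 : t ^ 14 ≤ t ^ 15 := pow_le_pow_right₀ ht1 (by norm_num)
  refine h3.trans ?_
  linarith [h7, h8]

lemma nthPrime_lower {k : ℕ} (hk : 1 ≤ k) : (k : ℝ) * Real.log k ≤ 5 * nthPrime k := by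
  obtain ⟨m, rfl⟩ : ∃ m, k = m + 1 := ⟨k - 1, by omega⟩
  have hp := nthPrime_prime (m + 1)
  have hpi := pi_nthPrime (m + 1 - 1)
  set p := nthPrime (m + 1) with hpd
  have hpi : p.primeCounting = m + 1 := pi_nthPrime m
  have hx1 : (1 : ℝ) < p := by exact_mod_cast hp.one_lt
  have h := Chebyshev.pi_le_log4_mul_div hx1
  rw [Nat.floor_natCast, hpi, Real.log_sqrt (by linarith)] at h
  have hle : m + 1 ≤ p := by
    rw [← hpi, Nat.primeCounting, Nat.primeCounting', Nat.count_eq_card_filter_range]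
    have : (range (p + 1)).filter Nat.Prime ⊆ Icc 1 p := by
      intro q hq
      have := Finset.mem_filter.1 hq
      have h2 := Finset.mem_range.1 this.1
      have := this.2.one_lt
      rw [Finset.mem_Icc]; omega
    simpa using Finset.card_le_card this
  set x : ℝ := (p : ℝ)
  have hl : 0 < Real.log x := Real.log_pos hx1
  have hs : √x * Real.log x ≤ 2 * x := by
    have h1 : Real.log x = 2 * Real.log √x := by rw [Real.log_sqrt (by linarith)]; ring
    have h2 : Real.log √x ≤ √x := by
      have := Real.log_le_sub_one_of_pos (show 0 < √x from Real.sqrt_pos.2 (by linarith))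
      linarith
    have h3 := Real.mul_self_sqrt (show 0 ≤ x by linarith)
    rw [h1]
    nlinarith [Real.sqrt_nonneg x]
  have h4 : Real.log 4 ≤ 1.4 := by
    rw [show (4 : ℝ) = 2 ^ 2 by norm_num, Real.log_pow]
    have := Real.log_two_lt_d9
    push_cast; linarith
  have h5 : ((m + 1 : ℕ) : ℝ) * Real.log x ≤ 5 * x := by
    have := mul_le_mul_of_nonneg_right h hl.le
    rw [add_mul, show Real.log 4 * x / (Real.log x / 2) * Real.log x = 2 * Real.log 4 * x by
      field_simp] at this
    nlinarith
  refine le_trans ?_ h5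
  have : Real.log ((m + 1 : ℕ) : ℝ) ≤ Real.log x :=
    Real.log_le_log (by positivity) (Nat.cast_le.2 hle)
  exact mul_le_mul_of_nonneg_left this (by positivity)

lemma Psum_lower {m : ℕ} (hm : 4 ≤ m) : (m : ℝ) ^ 2 * Real.log m ≤ 80 * Psum m := by
  have hm' : (4 : ℝ) ≤ m := by exact_mod_cast hm
  have hlog : 0 < Real.log m := Real.log_pos (by linarith)
  have h1 : ∀ k ∈ Icc ((m + 1) / 2) m, (m : ℝ) * Real.log m / 40 ≤ ((nthPrime k - 1 : ℕ) : ℝ) := by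
    intro k hk
    have hk' := Finset.mem_Icc.1 hk
    have hkm : (m : ℝ) / 2 ≤ k := by
      have : m ≤ 2 * k := by omega
      have : (m : ℝ) ≤ 2 * k := by exact_mod_cast this
      linarith
    have a := nthPrime_lower (k := k) (by omega)
    have hp := (nthPrime_prime k).two_le
    have hp' : (2 : ℝ) ≤ nthPrime k := by exact_mod_cast hp
    rw [Nat.cast_sub (by omega)]
    push_cast
    have l : Real.log m / 2 ≤ Real.log k := by
      have b : Real.log (m / 2) ≤ Real.log k := Real.log_le_log (by linarith) hkm
      rw [Real.log_div (by linarith) (by norm_num)] at b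
      have c : Real.log 4 ≤ Real.log m := Real.log_le_log (by norm_num) hm'
      rw [show (4 : ℝ) = 2 ^ 2 by norm_num, Real.log_pow] at c
      push_cast at c
      linarith
    have : (m : ℝ) / 2 * (Real.log m / 2) ≤ k * Real.log k :=
      mul_le_mul hkm l (by linarith) (by positivity)
    linarith
  have h2 : ∑ k ∈ Icc ((m + 1) / 2) m, (m : ℝ) * Real.log m / 40 ≤ (Psum m : ℝ) := by
    refine (Finset.sum_le_sum h1).trans ?_
    unfold Psum
    push_cast
    refine Finset.sum_le_sum_of_subset_of_nonneg ?_ (fun _ _ _ => by positivity)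
    exact Finset.Icc_subset_Icc (by omega) le_rfl
  rw [Finset.sum_const, nsmul_eq_mul, Nat.card_Icc] at h2
  have h3 : (m : ℝ) / 2 ≤ ((m + 1 - (m + 1) / 2 : ℕ) : ℝ) := by
    have : m ≤ 2 * (m + 1 - (m + 1) / 2) := by omega
    have : (m : ℝ) ≤ 2 * ((m + 1 - (m + 1) / 2 : ℕ) : ℝ) := by exact_mod_cast this
    linarith
  have h4 : 0 ≤ (m : ℝ) * Real.log m / 40 := by positivity
  have := mul_le_mul_of_nonneg_right h3 h4
  nlinarith

lemma m_bound {m N : ℕ} (hm : 4 ≤ m) (hN : Psum m ≤ N) :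
    (m : ℝ) * √((N : ℝ) * Real.log N) ≤ 16 * N := by
  have hm' : (4 : ℝ) ≤ m := by exact_mod_cast hm
  have hmN : (m : ℝ) ≤ N := by exact_mod_cast (le_Psum m).trans hN
  have hP : (Psum m : ℝ) ≤ N := by exact_mod_cast hN
  have h1 := Psum_lower hm
  set x : ℝ := (N : ℝ)
  set y : ℝ := (m : ℝ)
  have hx0 : 0 < x := by linarith
  have hlog : 0 < Real.log x := Real.log_pos (by linarith)
  have key : y ^ 2 * Real.log x ≤ 240 * x := by
    rcases le_total x (y ^ 3) with h | h
    · have : Real.log x ≤ 3 * Real.log y := by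
        have := Real.log_le_log hx0 h
        rw [Real.log_pow] at this
        exact_mod_cast this
      nlinarith [sq_nonneg y]
    · set t : ℝ := x ^ (1 / 3 : ℝ) with ht
      have ht0 : 0 < t := by positivity
      have ht3 : t ^ 3 = x := by
        rw [ht, ← Real.rpow_natCast, ← Real.rpow_mul hx0.le]; norm_num
      have hl : Real.log x ≤ 3 * t := by
        have := Real.log_le_rpow_div hx0.le (show (0 : ℝ) < 1 / 3 by norm_num)
        rw [← ht] at this; linarith
      have hyt : y ≤ t := le_of_pow_le_pow_left₀ (n := 3) (by norm_num) ht0.le (by rw [ht3]; exact h)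
      have : y ^ 2 ≤ t ^ 2 := pow_le_pow_left₀ (by linarith) hyt 2
      have := mul_le_mul this hl hlog.le (by positivity)
      nlinarith
  refine le_of_sq_le_sq ?_ (by positivity)
  rw [mul_pow, Real.sq_sqrt (by positivity)]
  nlinarith

/-- `D_N*(η) = O(1/√(N ln N))`: there exist an absolute constant `C > 0`
and `N₀ ∈ ℕ` such that for all `N ≥ N₀`, `D_N*(η) ≤ C / √(N ln N)`. -/
theorem eta_starDisc_isBigO :
    ∃ C : ℝ, 0 < C ∧ ∃ N₀ : ℕ, ∀ N : ℕ, N₀ ≤ N →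
      starDisc eta N ≤ C / Real.sqrt ((N : ℝ) * Real.log N) := by
  refine ⟨4000000, by norm_num, Psum 4 + 1, fun N hN => ?_⟩
  have hex : ∃ m, N ≤ Psum (m + 1) := ⟨N, (le_Psum N).trans (Psum_mono (by omega))⟩
  obtain ⟨m, hm1, hm2⟩ : ∃ m, Psum m < N ∧ N ≤ Psum (m + 1) := by
    refine ⟨Nat.find hex, ?_, Nat.find_spec hex⟩
    rcases Nat.eq_zero_or_pos (Nat.find hex) with h | h
    · rw [h, Psum_zero]; omega
    · have := Nat.find_min hex (m := Nat.find hex - 1) (by omega)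
      rw [Nat.sub_add_cancel h] at this
      omega
  have hm4 : 4 ≤ m := by
    by_contra h
    have := Psum_mono (show m + 1 ≤ 4 by omega)
    omega
  obtain ⟨M, rfl⟩ : ∃ M, N = Psum m + M := ⟨N - Psum m, by omega⟩
  have hp := nthPrime_prime (m + 1)
  haveI : Fact (nthPrime (m + 1)).Prime := ⟨hp⟩
  have hM : M < nthPrime (m + 1) := by
    rw [Psum_succ] at hm2
    have := hp.one_lt
    omega
  have hb := m_bound hm4 hm1.le
  have hN4 : 4 ≤ Psum m + M := (hm4.trans (le_Psum m)).trans hm1.le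
  have hN4' : (4 : ℝ) ≤ ((Psum m + M : ℕ) : ℝ) := by exact_mod_cast hN4
  have hm4' : (4 : ℝ) ≤ m := by exact_mod_cast hm4
  have hlog : 0 < Real.log ((Psum m + M : ℕ) : ℝ) := Real.log_pos (by linarith)
  have hsq : 0 < √(((Psum m + M : ℕ) : ℝ) * Real.log ((Psum m + M : ℕ) : ℝ)) :=
    Real.sqrt_pos.2 (mul_pos (by linarith) hlog)
  refine Real.sSup_le ?_ (by positivity)
  rintro d ⟨r, h0, h1, rfl⟩
  have e1 := full_bound h0 h1 m
  have e2 := blk_part h0 h1 hM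
  have e3 := E_bound hp.two_le
  rw [pi_nthPrime] at e3
  have e4 : |(starCount eta (Psum m + M) r : ℝ) - r * ((Psum m + M : ℕ) : ℝ)| ≤ 200000 * m := by
    rw [starCount_add hM]
    have e5 := e2.trans e3
    push_cast at e5 ⊢
    rw [abs_le] at *
    constructor <;> linarith [e1.1, e1.2, e5.1, e5.2]
  set x : ℝ := ((Psum m + M : ℕ) : ℝ)
  have hx : 0 < x := by linarith
  rw [show (starCount eta (Psum m + M) r : ℝ) / x - r =
    ((starCount eta (Psum m + M) r : ℝ) - r * x) / x by field_simp, abs_div, abs_of_pos hx,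
    div_le_div_iff₀ hx hsq]
  have := mul_le_mul_of_nonneg_right e4 hsq.le
  nlinarith
end

section
/- For each m ∈ ℕ let p_m denote the m-th prime number, and let E_{p_m} be the finite sequence ((j⁻¹ mod p_m)/p_m) for j = 1, 2, ..., p_m − 1. Then max_{1 ≤ k ≤ p_m − 1} k · D_k*(E_{p_m}) = o(m) as m → ∞; that is, (1/m) · max_{1 ≤ k ≤ p_m − 1} k · D_k*(E_{p_m}) → 0 as m → ∞. -/
open Filter Finset
open scoped BigOperators Classical

/-- The block `E_p`: the finite sequence `(j⁻¹ mod p)/p` for `j = 1, …, p−1`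
(indexed from 1). -/
noncomputable def Eblock (p : ℕ) : ℕ → ℝ := fun j => (invMod j p : ℝ) / (p : ℝ)

/-- `maxKD p = max_{1 ≤ k ≤ p−1} k · D_k*(E_p)`. -/
noncomputable def maxKD (p : ℕ) : ℝ :=
  sSup {x : ℝ | ∃ k : ℕ, 1 ≤ k ∧ k ≤ p - 1 ∧ x = (k : ℝ) * starDisc (Eblock p) k}


open ZMod in
noncomputable def kl (p : ℕ) [Fact p.Prime] (a b : ZMod p) : ℂ :=
  ∑ u : (ZMod p)ˣ, stdAddChar (a * (u : ZMod p) + b * ((u⁻¹ : (ZMod p)ˣ) : ZMod p))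

def sS {p : ℕ} (q : ((ZMod p)ˣ × (ZMod p)ˣ) × ((ZMod p)ˣ × (ZMod p)ˣ)) : ZMod p :=
  (q.1.1 : ZMod p) + q.1.2 - q.2.1 - q.2.2

def tS {p : ℕ} (q : ((ZMod p)ˣ × (ZMod p)ˣ) × ((ZMod p)ˣ × (ZMod p)ˣ)) : ZMod p :=
  ((q.1.1⁻¹ : (ZMod p)ˣ) : ZMod p) + ((q.1.2⁻¹ : (ZMod p)ˣ) : ZMod p)
    - ((q.2.1⁻¹ : (ZMod p)ˣ) : ZMod p) - ((q.2.2⁻¹ : (ZMod p)ˣ) : ZMod p)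

lemma kl_pow4 (p : ℕ) [Fact p.Prime] (a b : ZMod p) :
    ((‖kl p a b‖ ^ 4 : ℝ) : ℂ) =
      ∑ q : ((ZMod p)ˣ × (ZMod p)ˣ) × ((ZMod p)ˣ × (ZMod p)ˣ),
        ZMod.stdAddChar (a * sS q) * ZMod.stdAddChar (b * tS q) := by
  have h1 : ((‖kl p a b‖ ^ 4 : ℝ) : ℂ) =
      (kl p a b * kl p a b) *
      ((starRingEnd ℂ) (kl p a b) * (starRingEnd ℂ) (kl p a b)) := by
    have := Complex.mul_conj' (kl p a b)
    push_cast
    calc _ = ((‖kl p a b‖ : ℂ)^2)^2 := by ring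
      _ = _ := by rw [← this]; ring
  rw [h1]
  have h2 : (starRingEnd ℂ) (kl p a b) = ∑ u : (ZMod p)ˣ,
      ZMod.stdAddChar (-(a * (u : ZMod p) + b * ((u⁻¹ : (ZMod p)ˣ) : ZMod p))) := by
    rw [kl, map_sum]
    exact Finset.sum_congr rfl fun u _ => (AddChar.map_neg_eq_conj _ _).symm
  rw [h2, kl, Finset.sum_mul_sum, Finset.sum_mul_sum, ← Finset.sum_product',
    ← Finset.sum_product', Finset.sum_mul_sum, ← Finset.sum_product']
  refine Finset.sum_congr rfl fun q _ => ?_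
  simp only [← AddChar.map_add_eq_mul]
  congr 1
  simp only [sS, tS]
  ring

lemma card_sol (p : ℕ) [Fact p.Prime] :
    ((Finset.univ : Finset (((ZMod p)ˣ × (ZMod p)ˣ) × ((ZMod p)ˣ × (ZMod p)ˣ))).filter
      (fun q => sS q = 0 ∧ tS q = 0)).card ≤ 3 * (p - 1) ^ 2 := by
  have hsub : ((Finset.univ : Finset (((ZMod p)ˣ × (ZMod p)ˣ) × ((ZMod p)ˣ × (ZMod p)ˣ))).filter
      (fun q => sS q = 0 ∧ tS q = 0)) ⊆
      (Finset.univ.image (fun w : (ZMod p)ˣ × (ZMod p)ˣ => (w, w))) ∪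
      (Finset.univ.image (fun w : (ZMod p)ˣ × (ZMod p)ˣ => (w, (w.2, w.1)))) ∪
      (Finset.univ.image (fun w : (ZMod p)ˣ × (ZMod p)ˣ => ((w.1, -w.1), (w.2, -w.2)))) := by
    intro q hq
    have h := (Finset.mem_filter.1 hq).2
    clear hq
    obtain ⟨⟨x, y⟩, ⟨z, w⟩⟩ := q
    simp only [sS, tS] at h
    obtain ⟨h1, h2⟩ := h
    have hx : (x : ZMod p) ≠ 0 := x.ne_zero
    have hy : (y : ZMod p) ≠ 0 := y.ne_zero
    have hz : (z : ZMod p) ≠ 0 := z.ne_zero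
    have hw : (w : ZMod p) ≠ 0 := w.ne_zero
    simp only [Finset.mem_union, Finset.mem_image, Finset.mem_univ, true_and, Prod.mk.injEq,
      Prod.exists, Units.ext_iff, Units.val_neg]
    simp only [Units.val_inv_eq_inv_val] at h2
    field_simp at h2
    have e : ((x : ZMod p) + y) * ((x - z) * (x - w)) = 0 := by
      have hw' : (w : ZMod p) = x + y - z := by linear_combination -h1
      rw [hw'] at h2 ⊢
      linear_combination h2
    rcases mul_eq_zero.1 e with e | e
    · right
      exact ⟨x, z, ⟨rfl, by linear_combination -e⟩, rfl, by linear_combination -e + h1⟩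
    rcases mul_eq_zero.1 e with e | e
    · left; left
      exact ⟨x, y, ⟨rfl, rfl⟩, by linear_combination e, by linear_combination h1 - e⟩
    · left; right
      exact ⟨x, y, ⟨rfl, rfl⟩, by linear_combination h1 - e, by linear_combination e⟩
  have hc : (Finset.univ : Finset ((ZMod p)ˣ × (ZMod p)ˣ)).card = (p - 1) ^ 2 := by
    rw [Finset.card_univ, Fintype.card_prod, ZMod.card_units, sq]
  refine (Finset.card_le_card hsub).trans ?_
  refine (Finset.card_union_le _ _).trans ?_
  have := Finset.card_union_le (Finset.univ.image (fun w : (ZMod p)ˣ × (ZMod p)ˣ => (w, w)))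
    (Finset.univ.image (fun w : (ZMod p)ˣ × (ZMod p)ˣ => (w, (w.2, w.1))))
  have a1 := Finset.card_image_le (s := Finset.univ)
    (f := fun w : (ZMod p)ˣ × (ZMod p)ˣ => (w, w))
  have a2 := Finset.card_image_le (s := Finset.univ)
    (f := fun w : (ZMod p)ˣ × (ZMod p)ˣ => (w, (w.2, w.1)))
  have a3 := Finset.card_image_le (s := Finset.univ)
    (f := fun w : (ZMod p)ˣ × (ZMod p)ˣ => ((w.1, -w.1), (w.2, -w.2)))
  rw [hc] at a1 a2 a3
  omega

lemma sum_char (p : ℕ) [Fact p.Prime] (b : ZMod p) :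
    ∑ a : ZMod p, ZMod.stdAddChar (a * b) = if b = 0 then (p : ℂ) else 0 := by
  have := AddChar.sum_mulShift b (ZMod.isPrimitive_stdAddChar p)
  rw [ZMod.card] at this
  rw [this]
  split_ifs <;> simp

lemma kl_moment (p : ℕ) [Fact p.Prime] :
    ∑ a : ZMod p, ∑ b : ZMod p, ‖kl p a b‖ ^ 4 ≤ 3 * (p : ℝ) ^ 2 * ((p : ℝ) - 1) ^ 2 := by
  have h : ((∑ a : ZMod p, ∑ b : ZMod p, ‖kl p a b‖ ^ 4 : ℝ) : ℂ) =
      (((p : ℝ) ^ 2 * (((Finset.univ : Finset (((ZMod p)ˣ × (ZMod p)ˣ) ×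
        ((ZMod p)ˣ × (ZMod p)ˣ))).filter
      (fun q => sS q = 0 ∧ tS q = 0)).card : ℝ) : ℝ) : ℂ) := by
    rw [Complex.ofReal_sum]
    simp only [Complex.ofReal_sum]
    simp only [kl_pow4]
    have : ∀ a : ZMod p, ∑ b : ZMod p, ∑ q : ((ZMod p)ˣ × (ZMod p)ˣ) × ((ZMod p)ˣ × (ZMod p)ˣ),
        ZMod.stdAddChar (a * sS q) * ZMod.stdAddChar (b * tS q) =
        ∑ q : ((ZMod p)ˣ × (ZMod p)ˣ) × ((ZMod p)ˣ × (ZMod p)ˣ),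
        ZMod.stdAddChar (a * sS q) * (if tS q = 0 then (p : ℂ) else 0) := by
      intro a
      rw [Finset.sum_comm]
      refine Finset.sum_congr rfl fun q _ => ?_
      rw [← Finset.mul_sum, sum_char]
    simp only [this]
    rw [Finset.sum_comm]
    simp only [← Finset.sum_mul, sum_char]
    rw [Finset.card_filter]
    push_cast
    rw [Finset.mul_sum]
    refine Finset.sum_congr rfl fun q _ => ?_
    by_cases h1 : sS q = 0 <;> by_cases h2 : tS q = 0 <;> simp [h1, h2, sq]
  have h' := Complex.ofReal_injective h
  rw [h']
  have hc : ((((Finset.univ : Finset (((ZMod p)ˣ × (ZMod p)ˣ) ×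
        ((ZMod p)ˣ × (ZMod p)ˣ))).filter
      (fun q => sS q = 0 ∧ tS q = 0)).card : ℕ) : ℝ) ≤ ((3 * (p - 1) ^ 2 : ℕ) : ℝ) :=
    Nat.cast_le.2 (card_sol p)
  have hp : 1 ≤ p := (Fact.out : p.Prime).one_le
  push_cast [Nat.cast_sub hp] at hc
  nlinarith [sq_nonneg (p : ℝ)]

lemma kl_shift (p : ℕ) [Fact p.Prime] (a b : ZMod p) (t : (ZMod p)ˣ) :
    kl p (a * t) (b * ((t⁻¹ : (ZMod p)ˣ) : ZMod p)) = kl p a b := by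
  unfold kl
  refine Fintype.sum_equiv (Equiv.mulLeft t) _ _ fun u => ?_
  congr 1
  simp only [Equiv.coe_mulLeft, mul_inv, Units.val_mul]
  ring

lemma kl_bound (p : ℕ) [Fact p.Prime] (a b : ZMod p) (hab : a ≠ 0 ∨ b ≠ 0) :
    ‖kl p a b‖ ^ 4 ≤ 3 * (p : ℝ) ^ 3 := by
  have hp : 2 ≤ p := (Fact.out : p.Prime).two_le
  have hp' : (2 : ℝ) ≤ p := by exact_mod_cast hp
  have hinj : Function.Injective (fun t : (ZMod p)ˣ =>
      ((a * t, b * ((t⁻¹ : (ZMod p)ˣ) : ZMod p)) : ZMod p × ZMod p)) := by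
    intro s t h
    simp only [Prod.mk.injEq] at h
    rcases hab with h0 | h0
    · exact Units.ext (mul_left_cancel₀ h0 h.1)
    · exact inv_injective (Units.ext (mul_left_cancel₀ h0 h.2))
  have h1 : ∑ t : (ZMod p)ˣ, ‖kl p (a * t) (b * ((t⁻¹ : (ZMod p)ˣ) : ZMod p))‖ ^ 4 ≤
      ∑ a : ZMod p, ∑ b : ZMod p, ‖kl p a b‖ ^ 4 := by
    rw [← Finset.sum_product']
    have := Finset.sum_image (f := fun w : ZMod p × ZMod p => ‖kl p w.1 w.2‖ ^ 4)
      (s := Finset.univ) (fun x _ y _ h => hinj h)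
    simp only at this
    rw [← this]
    refine Finset.sum_le_sum_of_subset_of_nonneg (fun x _ => by simp) fun _ _ _ => by positivity
  simp only [kl_shift, Finset.sum_const, Finset.card_univ, ZMod.card_units, nsmul_eq_mul] at h1
  rw [Nat.cast_sub (by omega)] at h1
  have h2 := h1.trans (kl_moment p)
  push_cast at h2
  have h3 : ‖kl p a b‖ ^ 4 ≤ 3 * (p : ℝ) ^ 2 * ((p : ℝ) - 1) := by
    have : (0 : ℝ) < p - 1 := by linarith
    refine le_of_mul_le_mul_left (a := (p : ℝ) - 1) ?_ this
    linarith
  nlinarith [sq_nonneg (p : ℝ)]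

noncomputable def fh (p : ℕ) [Fact p.Prime] (n : ℕ) (a : ZMod p) : ℂ :=
  ∑ i ∈ Finset.range n, ZMod.stdAddChar (-(a * (i : ZMod p)))

lemma fh_ind (p : ℕ) [Fact p.Prime] (n : ℕ) (hn : n ≤ p) (x : ZMod p) :
    ∑ a : ZMod p, fh p n a * ZMod.stdAddChar (a * x) = if x.val < n then (p : ℂ) else 0 := by
  simp only [fh, Finset.sum_mul]
  rw [Finset.sum_comm]
  have : ∀ i ∈ Finset.range n, ∑ a : ZMod p, ZMod.stdAddChar (-(a * (i : ZMod p))) *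
      ZMod.stdAddChar (a * x) = if x.val = i then (p : ℂ) else 0 := by
    intro i hi
    have hip : i < p := (Finset.mem_range.1 hi).trans_le hn
    have h1 : ∀ a : ZMod p, ZMod.stdAddChar (-(a * (i : ZMod p))) *
      ZMod.stdAddChar (a * x) = (ZMod.stdAddChar (a * (x - (i : ZMod p))) : ℂ) := by
      intro a
      rw [← AddChar.map_add_eq_mul]
      congr 1
      ring
    simp only [h1, sum_char]
    refine if_congr ?_ rfl rfl
    rw [sub_eq_zero]
    constructor
    · rintro rfl
      exact ZMod.val_cast_of_lt hip
    · rintro rfl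
      simp
  rw [Finset.sum_congr rfl this]
  simp

lemma fh_zero (p : ℕ) [Fact p.Prime] (n : ℕ) : fh p n 0 = n := by
  simp [fh]

lemma norm_char_sub_one (p : ℕ) [Fact p.Prime] (a : ZMod p) :
    ‖(ZMod.stdAddChar (-a) : ℂ) - 1‖ = 2 * Real.sin (Real.pi * (a.val / p)) := by
  have hp : (0 : ℝ) < p := by exact_mod_cast (Fact.out : p.Prime).pos
  have h0 : (ZMod.stdAddChar (-a) : ℂ) - 1 = (starRingEnd ℂ) (ZMod.stdAddChar a - 1) := by
    rw [AddChar.map_neg_eq_conj]; simp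
  rw [h0, RCLike.norm_conj]
  have h1 : (ZMod.stdAddChar a : ℂ) = Complex.exp (Complex.I * ((2 * Real.pi * (a.val / p) : ℝ) : ℂ)) := by
    have := ZMod.stdAddChar_coe (N := p) (a.val : ℤ)
    rw [Int.cast_natCast, Int.cast_natCast, ZMod.natCast_zmod_val] at this
    rw [this]
    congr 1
    push_cast
    ring
  rw [h1, Complex.norm_exp_I_mul_ofReal_sub_one, Real.norm_eq_abs, abs_of_nonneg]
  · congr 2; ring
  · have : (0 : ℝ) ≤ a.val / p := by positivity
    have h3 : (a.val : ℝ) / p ≤ 1 := by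
      rw [div_le_one hp]; exact_mod_cast (ZMod.val_lt a).le
    have := Real.sin_nonneg_of_nonneg_of_le_pi (x := 2 * Real.pi * (a.val / p) / 2)
      (by positivity) (by nlinarith [Real.pi_pos])
    linarith

lemma sin_lower (t : ℝ) (h0 : 0 < t) (h1 : t < 1) :
    1 / Real.sin (Real.pi * t) ≤ 1 / 2 * (1 / t + 1 / (1 - t)) := by
  have hpi := Real.pi_pos
  have h1' : 0 < 1 - t := by linarith
  rcases le_total t (1 / 2) with h | h
  · have := Real.mul_le_sin (x := Real.pi * t) (by positivity) (by nlinarith)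
    have e : 2 / Real.pi * (Real.pi * t) = 2 * t := by field_simp
    rw [e] at this
    calc _ ≤ 1 / (2 * t) := one_div_le_one_div_of_le (by positivity) this
      _ = 1 / 2 * (1 / t) := by field_simp
      _ ≤ _ := by
        have : 0 < 1 / (1 - t) := by positivity
        linarith
  · have := Real.mul_le_sin (x := Real.pi * (1 - t)) (by positivity) (by nlinarith)
    have e : 2 / Real.pi * (Real.pi * (1 - t)) = 2 * (1 - t) := by field_simp
    have e2 : Real.sin (Real.pi * (1 - t)) = Real.sin (Real.pi * t) := by
      rw [← Real.sin_pi_sub]; congr 1; ring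
    rw [e, e2] at this
    calc _ ≤ 1 / (2 * (1 - t)) := one_div_le_one_div_of_le (by positivity) this
      _ = 1 / 2 * (1 / (1 - t)) := by field_simp
      _ ≤ _ := by
        have : 0 < 1 / t := by positivity
        linarith

lemma fh_norm (p : ℕ) [Fact p.Prime] (n : ℕ) (a : ZMod p) (ha : a ≠ 0) :
    ‖fh p n a‖ ≤ (p : ℝ) / 2 * (1 / a.val + 1 / (p - a.val)) := by
  have hp : (0 : ℝ) < p := by exact_mod_cast (Fact.out : p.Prime).pos
  have hv : (0 : ℝ) < a.val := by
    have : a.val ≠ 0 := by rwa [Ne, ZMod.val_eq_zero]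
    exact_mod_cast Nat.pos_of_ne_zero this
  have hv2 : (a.val : ℝ) < p := by exact_mod_cast ZMod.val_lt a
  set t : ℝ := a.val / p with ht
  have t0 : 0 < t := by positivity
  have t1 : t < 1 := by rw [ht, div_lt_one hp]; exact hv2
  have hs : 0 < Real.sin (Real.pi * t) :=
    Real.sin_pos_of_pos_of_lt_pi (by positivity) (by nlinarith [Real.pi_pos])
  have hg : fh p n a * ((ZMod.stdAddChar (-a) : ℂ) - 1) = (ZMod.stdAddChar (-a) : ℂ) ^ n - 1 := by
    rw [← geom_sum_mul]
    congr 1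
    refine Finset.sum_congr rfl fun i _ => ?_
    rw [← AddChar.map_nsmul_eq_pow]
    congr 1
    simp
    ring
  have hn : ‖(ZMod.stdAddChar (-a) : ℂ) ^ n - 1‖ ≤ 2 := by
    refine (norm_sub_le _ _).trans ?_
    rw [norm_pow, AddChar.norm_apply]
    norm_num
  rw [← hg, norm_mul, norm_char_sub_one, ← ht] at hn
  have h2 : ‖fh p n a‖ ≤ 1 / Real.sin (Real.pi * t) := by
    rw [le_div_iff₀ hs]; linarith
  refine h2.trans ((sin_lower t t0 t1).trans (le_of_eq ?_))
  have : (p : ℝ) - a.val ≠ 0 := by linarith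
  have e1 : 1 - t = ((p : ℝ) - a.val) / p := by rw [ht]; field_simp
  rw [e1, ht]
  field_simp

lemma sum_val (p : ℕ) [Fact p.Prime] (g : ℕ → ℝ) :
    ∑ a : ZMod p, g a.val = ∑ i ∈ Finset.range p, g i := by
  refine Finset.sum_bij (fun a _ => a.val) (fun a _ => Finset.mem_range.2 (ZMod.val_lt a))
    (fun a _ b _ h => ZMod.val_injective p h) (fun i hi => ⟨(i : ZMod p), Finset.mem_univ _,
      ZMod.val_cast_of_lt (Finset.mem_range.1 hi)⟩) (fun _ _ => rfl)

lemma fh_l1 (p : ℕ) [Fact p.Prime] (n : ℕ) (hn : n ≤ p) :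
    ∑ a : ZMod p, ‖fh p n a‖ ≤ p * (2 + Real.log p) := by
  let g : ℕ → ℝ := fun i => if i = 0 then (p : ℝ) else (p : ℝ) / 2 * (1 / i + 1 / (p - i))
  have h1 : ∑ a : ZMod p, ‖fh p n a‖ ≤ ∑ a : ZMod p, g a.val := by
    refine Finset.sum_le_sum fun a _ => ?_
    by_cases ha : a = 0
    · subst ha
      simp only [g, ZMod.val_zero, if_true, fh_zero]
      simpa using hn
    · have : a.val ≠ 0 := by rwa [Ne, ZMod.val_eq_zero]
      simp only [g, this, if_false]
      exact fh_norm p n a ha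
  refine h1.trans ?_
  rw [sum_val]
  obtain ⟨q, hq⟩ : ∃ q, p = q + 1 := ⟨p - 1, by have := (Fact.out : p.Prime).pos; omega⟩
  have hq1 : 1 ≤ q := by have := (Fact.out : p.Prime).two_le; omega
  have hr : Finset.range p = Finset.range (q + 1) := by rw [hq]
  rw [hr, Finset.sum_range_succ']
  have hH : (harmonic q : ℝ) ≤ 1 + Real.log p := by
    refine (harmonic_le_one_add_log q).trans ?_
    have : Real.log q ≤ Real.log p := Real.log_le_log (by exact_mod_cast hq1)
      (by exact_mod_cast (by omega : q ≤ p))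
    linarith
  have e1 : (harmonic q : ℝ) = ∑ i ∈ Finset.range q, 1 / ((i : ℝ) + 1) := by
    simp [harmonic]
  have e2 : (harmonic q : ℝ) = ∑ i ∈ Finset.range q, 1 / ((p : ℝ) - (i + 1)) := by
    rw [e1, ← Finset.sum_range_reflect]
    refine Finset.sum_congr rfl fun i hi => ?_
    have hi := Finset.mem_range.1 hi
    rw [Nat.sub_sub, Nat.cast_sub (by omega), hq]
    push_cast
    congr 1
    ring
  have e3 : ∑ i ∈ Finset.range q, g (i + 1) = p / 2 * (harmonic q + harmonic q) := by
    nth_rewrite 1 [e1]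
    rw [e2, ← Finset.sum_add_distrib, Finset.mul_sum]
    refine Finset.sum_congr rfl fun i hi => ?_
    simp [g]
  rw [e3]
  simp only [g, if_true]
  have hp : (0 : ℝ) < p := by exact_mod_cast (Fact.out : p.Prime).pos
  nlinarith

noncomputable def NN (p : ℕ) [Fact p.Prime] (n L : ℕ) : ℕ :=
  ((Finset.univ : Finset (ZMod p)ˣ).filter (fun u : (ZMod p)ˣ => (u : ZMod p).val < n ∧
    ((u⁻¹ : (ZMod p)ˣ) : ZMod p).val < L)).card

lemma NN_formula (p : ℕ) [Fact p.Prime] (n L : ℕ) (hn : n ≤ p) (hL : L ≤ p) :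
    (p : ℂ) ^ 2 * (NN p n L : ℂ) =
      ∑ w : ZMod p × ZMod p, fh p n w.1 * fh p L w.2 * kl p w.1 w.2 := by
  have h1 : (p : ℂ) ^ 2 * (NN p n L : ℂ) = ∑ u : (ZMod p)ˣ,
      (∑ a : ZMod p, fh p n a * ZMod.stdAddChar (a * (u : ZMod p))) *
      (∑ b : ZMod p, fh p L b * ZMod.stdAddChar (b * ((u⁻¹ : (ZMod p)ˣ) : ZMod p))) := by
    rw [NN, Finset.card_filter]
    push_cast
    rw [Finset.mul_sum]
    refine Finset.sum_congr rfl fun u _ => ?_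
    rw [fh_ind p n hn, fh_ind p L hL]
    split_ifs <;> first | (exfalso; tauto) | (simp [sq])
  rw [h1]
  simp only [Finset.sum_mul_sum]
  rw [Fintype.sum_prod_type, Finset.sum_comm]
  refine Finset.sum_congr rfl fun a _ => ?_
  rw [Finset.sum_comm]
  refine Finset.sum_congr rfl fun b _ => ?_
  rw [kl, Finset.mul_sum]
  refine Finset.sum_congr rfl fun u _ => ?_
  rw [AddChar.map_add_eq_mul]
  ring

lemma NN_bound (p : ℕ) [Fact p.Prime] (n L : ℕ) (hn : n ≤ p) (hL : L ≤ p) :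
    |(NN p n L : ℝ) - n * L * (p - 1) / p ^ 2| ≤
      2 * (p : ℝ) ^ (3 / 4 : ℝ) * (2 + Real.log p) ^ 2 := by
  have hp : (0 : ℝ) < p := by exact_mod_cast (Fact.out : p.Prime).pos
  set B : ℝ := 2 * (p : ℝ) ^ (3 / 4 : ℝ) with hB
  have hB0 : 0 ≤ B := by positivity
  have hB4 : B ^ 4 = 16 * (p : ℝ) ^ 3 := by
    rw [hB, mul_pow, ← Real.rpow_natCast ((p : ℝ) ^ (3 / 4 : ℝ)), ← Real.rpow_mul hp.le]
    norm_num
  have hK : ∀ w : ZMod p × ZMod p, w ≠ (0, 0) → ‖kl p w.1 w.2‖ ≤ B := by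
    intro w hw
    have : w.1 ≠ 0 ∨ w.2 ≠ 0 := by
      by_contra h
      push Not at h
      exact hw (Prod.ext h.1 h.2)
    have := kl_bound p w.1 w.2 this
    refine le_of_pow_le_pow_left₀ (n := 4) (by norm_num) hB0 ?_
    rw [hB4]
    nlinarith [pow_pos hp 3]
  have hf := NN_formula p n L hn hL
  rw [← Finset.add_sum_erase _ _ (Finset.mem_univ ((0, 0) : ZMod p × ZMod p))] at hf
  have h00 : kl p 0 0 = (p : ℂ) - 1 := by
    simp only [kl, zero_mul, add_zero, AddChar.map_zero_eq_one, Finset.sum_const, Finset.card_univ,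
      ZMod.card_units, nsmul_eq_mul, mul_one, Nat.cast_sub (Fact.out : p.Prime).one_le,
      Nat.cast_one]
  simp only [fh_zero, h00] at hf
  have hE : ‖∑ w ∈ (Finset.univ : Finset (ZMod p × ZMod p)).erase (0, 0),
      fh p n w.1 * fh p L w.2 * kl p w.1 w.2‖ ≤ (p * (2 + Real.log p)) * (p * (2 + Real.log p)) * B := by
    refine (norm_sum_le _ _).trans ?_
    calc _ ≤ ∑ w ∈ (Finset.univ : Finset (ZMod p × ZMod p)).erase (0, 0),
          ‖fh p n w.1‖ * ‖fh p L w.2‖ * B := by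
          refine Finset.sum_le_sum fun w hw => ?_
          rw [norm_mul, norm_mul]
          exact mul_le_mul_of_nonneg_left (hK w (Finset.ne_of_mem_erase hw)) (by positivity)
      _ ≤ ∑ w : ZMod p × ZMod p, ‖fh p n w.1‖ * ‖fh p L w.2‖ * B :=
          Finset.sum_le_sum_of_subset_of_nonneg (Finset.erase_subset _ _)
            fun _ _ _ => by positivity
      _ = (∑ a : ZMod p, ‖fh p n a‖) * (∑ b : ZMod p, ‖fh p L b‖) * B := by
          rw [← Finset.sum_mul, Fintype.sum_prod_type, Finset.sum_mul_sum]
      _ ≤ _ := by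
          have h1 := fh_l1 p n hn
          have h2 := fh_l1 p L hL
          have : 0 ≤ ∑ b : ZMod p, ‖fh p L b‖ := Finset.sum_nonneg fun _ _ => norm_nonneg _
          have : 0 ≤ ∑ b : ZMod p, ‖fh p n b‖ := Finset.sum_nonneg fun _ _ => norm_nonneg _
          gcongr
  have hre : ((((p : ℝ) ^ 2 * ((NN p n L : ℝ) - n * L * (p - 1) / p ^ 2)) : ℝ) : ℂ) =
      ∑ w ∈ (Finset.univ : Finset (ZMod p × ZMod p)).erase (0, 0),
      fh p n w.1 * fh p L w.2 * kl p w.1 w.2 := by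
    have e : (p : ℝ) ^ 2 * ((NN p n L : ℝ) - n * L * (p - 1) / p ^ 2) =
      (p : ℝ) ^ 2 * (NN p n L : ℝ) - n * L * (p - 1) := by field_simp
    rw [e]
    push_cast
    rw [hf]
    ring
  rw [← hre, Complex.norm_real, Real.norm_eq_abs, abs_mul, abs_of_pos (by positivity : (0:ℝ) < (p:ℝ)^2)] at hE
  have hp2 : (0 : ℝ) < (p : ℝ) ^ 2 := by positivity
  refine le_of_mul_le_mul_left (hE.trans (le_of_eq ?_)) hp2
  ring

lemma starCount_eq (p : ℕ) [Fact p.Prime] (k : ℕ) (hk : k ≤ p - 1) (r : ℝ) (hr : 0 < r) :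
    starCount (Eblock p) k r = NN p (k + 1) (min (⌊r * p⌋₊ + 1) p) := by
  have hp : (0 : ℝ) < p := by exact_mod_cast (Fact.out : p.Prime).pos
  have hp1 := (Fact.out : p.Prime).one_le
  have key : ∀ x : ZMod p, ((x.val : ℝ) / p ∈ Set.Icc (0 : ℝ) r ↔
      x.val < min (⌊r * p⌋₊ + 1) p) := by
    intro x
    have h1 : (0 : ℝ) ≤ (x.val : ℝ) / p := by positivity
    rw [Set.mem_Icc, lt_min_iff, Nat.lt_succ_iff, Nat.le_floor_iff (by positivity), div_le_iff₀ hp]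
    exact ⟨fun h => ⟨h.2, ZMod.val_lt x⟩, fun h => ⟨h1, h.1⟩⟩
  unfold starCount NN
  symm
  refine Finset.card_bij (fun u _ => (u : ZMod p).val) ?_ ?_ ?_
  · intro u hu
    have hu := (Finset.mem_filter.1 hu).2
    have h0 : (u : ZMod p).val ≠ 0 := by
      rw [Ne, ZMod.val_eq_zero]; exact u.ne_zero
    refine Finset.mem_filter.2 ⟨Finset.mem_Icc.2 ⟨by omega, by omega⟩, ?_⟩
    simp only [Eblock, invMod, ZMod.natCast_zmod_val]
    rw [key, ← Units.val_inv_eq_inv_val]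
    exact hu.2
  · intro u _ v _ h
    exact Units.ext (ZMod.val_injective p h)
  · intro j hj
    obtain ⟨hj1, hj2⟩ := Finset.mem_filter.1 hj
    have hj1 := Finset.mem_Icc.1 hj1
    have hv : (j : ZMod p).val = j := ZMod.val_cast_of_lt (by omega)
    have h0 : (j : ZMod p) ≠ 0 := by
      rw [Ne, ← ZMod.val_eq_zero, hv]; omega
    refine ⟨Units.mk0 (j : ZMod p) h0, Finset.mem_filter.2 ⟨Finset.mem_univ _, ?_, ?_⟩, ?_⟩
    · simp only [Units.val_mk0, hv]; omega
    · simp only [Eblock, invMod] at hj2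
      rw [key] at hj2
      rw [Units.val_inv_eq_inv_val]
      exact hj2
    · simp only [Units.val_mk0, hv]

lemma count_bound (p : ℕ) [Fact p.Prime] (k : ℕ) (hk : k ≤ p - 1) (r : ℝ) (hr : 0 < r)
    (hr1 : r ≤ 1) :
    |(starCount (Eblock p) k r : ℝ) - k * r| ≤
      2 * (p : ℝ) ^ (3 / 4 : ℝ) * (2 + Real.log p) ^ 2 + 2 := by
  have hp : (0 : ℝ) < p := by exact_mod_cast (Fact.out : p.Prime).pos
  have hp1 := (Fact.out : p.Prime).one_le
  have hp1' : (1 : ℝ) ≤ p := by exact_mod_cast hp1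
  rw [starCount_eq p k hk r hr]
  set L := min (⌊r * p⌋₊ + 1) p with hL
  have hb := NN_bound p (k + 1) L (by omega) (min_le_right _ _)
  have hfl := Nat.floor_le (a := r * p) (by positivity)
  have hfl2 := Nat.lt_floor_add_one (r * p)
  have L1 : r * p ≤ L := by
    rw [hL, Nat.cast_min]
    refine le_min ?_ ?_
    · push_cast; exact hfl2.le
    · nlinarith
  have L2 : (L : ℝ) ≤ r * p + 1 := by
    have : L ≤ ⌊r * p⌋₊ + 1 := min_le_left _ _
    have : (L : ℝ) ≤ (⌊r * p⌋₊ : ℝ) + 1 := by exact_mod_cast this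
    linarith
  have hk' : (k : ℝ) + 1 ≤ p := by exact_mod_cast (by omega : k + 1 ≤ p)
  have hk0 : (0 : ℝ) ≤ k := Nat.cast_nonneg _
  push_cast at hb
  have hm : |((k : ℝ) + 1) * L * (p - 1) / p ^ 2 - k * r| ≤ 2 := by
    rw [abs_le]
    constructor
    · rw [le_sub_iff_add_le, le_div_iff₀ (by positivity)]
      have h1 : ((k : ℝ) + 1) * (r * p) * (p - 1) ≤ (k + 1) * L * (p - 1) := by
        have : (0 : ℝ) ≤ p - 1 := by linarith
        gcongr
      refine le_trans ?_ h1
      have : ((k : ℝ) + 1) * r ≤ p := by nlinarith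
      nlinarith [mul_le_mul_of_nonneg_right this hp.le, mul_pos hr hp, mul_pos (mul_pos hr hp) hp]
    · rw [sub_le_iff_le_add, div_le_iff₀ (by positivity)]
      have h1 : ((k : ℝ) + 1) * L * (p - 1) ≤ (k + 1) * (r * p + 1) * p := by
        have : (0 : ℝ) ≤ p - 1 := by linarith
        gcongr
        linarith
      refine h1.trans ?_
      have a1 : ((k : ℝ) + 1) * p ≤ p * p := mul_le_mul_of_nonneg_right hk' hp.le
      have a2 : r * (p * p) ≤ 1 * (p * p) := mul_le_mul_of_nonneg_right hr1 (by positivity)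
      nlinarith
  have := abs_add_le ((NN p (k + 1) L : ℝ) - ((k : ℝ) + 1) * L * (p - 1) / p ^ 2)
    (((k : ℝ) + 1) * L * (p - 1) / p ^ 2 - k * r)
  rw [sub_add_sub_cancel] at this
  linarith

lemma starDisc_nonneg (ξ : ℕ → ℝ) (k : ℕ) : 0 ≤ starDisc ξ k := by
  refine Real.sSup_nonneg ?_
  rintro d ⟨r, _, _, rfl⟩
  exact abs_nonneg _

lemma maxKD_nonneg (p : ℕ) : 0 ≤ maxKD p := by
  refine Real.sSup_nonneg ?_
  rintro d ⟨k, _, _, rfl⟩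
  exact mul_nonneg (Nat.cast_nonneg _) (starDisc_nonneg _ _)

lemma maxKD_le (p : ℕ) (hpp : p.Prime) :
    maxKD p ≤ 2 * (p : ℝ) ^ (3 / 4 : ℝ) * (2 + Real.log p) ^ 2 + 2 := by
  have : Fact p.Prime := ⟨hpp⟩
  have hC : 0 ≤ 2 * (p : ℝ) ^ (3 / 4 : ℝ) * (2 + Real.log p) ^ 2 + 2 := by positivity
  refine Real.sSup_le ?_ hC
  rintro x ⟨k, hk1, hk2, rfl⟩
  have hk : (0 : ℝ) < k := by exact_mod_cast hk1
  rw [mul_comm, ← le_div_iff₀ hk]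
  refine Real.sSup_le ?_ (by positivity)
  rintro d ⟨r, hr, hr1, rfl⟩
  rw [le_div_iff₀ hk]
  refine le_trans (le_of_eq ?_) (count_bound p k hk2 r hr hr1)
  rw [← abs_of_pos hk, ← abs_mul, abs_of_pos hk]
  congr 1
  field_simp

lemma pi_nthPrime_s3 (m : ℕ) (hm : 1 ≤ m) : Nat.primeCounting (nthPrime m) = m := by
  rw [Nat.primeCounting, Nat.primeCounting', Nat.count_succ, nthPrime,
    if_pos (Nat.prime_nth_prime _)]
  have := Nat.primeCounting'_nth_eq (m - 1)
  rw [Nat.primeCounting'] at this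
  rw [this]; omega

lemma tendsto_nthPrime : Filter.Tendsto (fun m : ℕ => ((nthPrime m : ℕ) : ℝ))
    Filter.atTop Filter.atTop := by
  refine tendsto_natCast_atTop_atTop.comp ?_
  refine Filter.tendsto_atTop_mono (f := fun m : ℕ => m) ?_ Filter.tendsto_id
  intro m
  have := Nat.add_two_le_nth_prime (m - 1)
  unfold nthPrime
  omega

lemma analytic_bound : ∀ᶠ x : ℝ in Filter.atTop, ∀ M N : ℝ, 0 ≤ M →
    M ≤ 2 * x ^ (3 / 4 : ℝ) * (2 + Real.log x) ^ 2 + 2 →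
    (x * Real.log 2 - Real.log (x + 1)) / Real.log x ≤ N →
    M / N ≤ 80 * x ^ (-(5 / 32) : ℝ) := by
  have h1 := (isLittleO_log_rpow_atTop (r := 1 / 32) (by norm_num)).bound (c := 1) one_pos
  have h2 := Real.isLittleO_log_id_atTop.bound (c := 1 / 10) (by norm_num)
  filter_upwards [h1, h2, Filter.eventually_ge_atTop 10] with x h1 h2 hx M N hM hMle hN
  have hx0 : 0 < x := by linarith
  have hlog : 0 < Real.log x := Real.log_pos (by linarith)
  rw [Real.norm_of_nonneg hlog.le, Real.norm_of_nonneg (by positivity), one_mul] at h1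
  rw [Real.norm_of_nonneg hlog.le, id, Real.norm_of_nonneg hx0.le] at h2
  set y : ℝ := x ^ (1 / 32 : ℝ) with hy
  have hy1 : 1 ≤ y := Real.one_le_rpow (by linarith) (by norm_num)
  have hy0 : 0 < y := by linarith
  have hyn : ∀ n : ℕ, x ^ ((n : ℝ) / 32) = y ^ n := by
    intro n
    rw [hy, ← Real.rpow_natCast, ← Real.rpow_mul hx0.le]
    congr 1; ring
  have e1 : x ^ (3 / 4 : ℝ) = y ^ 24 := by rw [← hyn]; norm_num
  have e2 : x = y ^ 32 := by rw [← hyn]; norm_num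
  have e3 : x ^ (-(5 / 32) : ℝ) = (y ^ 5)⁻¹ := by
    rw [← hyn, Real.rpow_neg hx0.le]; norm_num
  have hM' : M ≤ 20 * y ^ 26 := by
    have : (2 + Real.log x) ^ 2 ≤ (3 * y) ^ 2 := by
      apply pow_le_pow_left₀ (by linarith); linarith
    rw [e1] at hMle
    have h3 : 2 * y ^ 24 * (2 + Real.log x) ^ 2 ≤ 2 * y ^ 24 * (3 * y) ^ 2 := by gcongr
    have h4 : 1 ≤ y ^ 26 := one_le_pow₀ hy1
    nlinarith
  have hl2 := Real.log_two_gt_d9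
  have hx1 : Real.log (x + 1) ≤ 1 / 5 * x := by
    have : Real.log (x + 1) ≤ Real.log (2 * x) := Real.log_le_log (by linarith) (by linarith)
    rw [Real.log_mul (by norm_num) hx0.ne'] at this
    have := Real.log_two_lt_d9
    linarith
  have hN' : 1 / 4 * y ^ 31 ≤ N := by
    refine le_trans ?_ hN
    rw [le_div_iff₀ hlog]
    calc 1 / 4 * y ^ 31 * Real.log x ≤ 1 / 4 * y ^ 31 * y := by gcongr
      _ = 1 / 4 * x := by rw [e2]; ring
      _ ≤ _ := by nlinarith
  have hN0 : 0 < N := lt_of_lt_of_le (by positivity) hN'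
  rw [e3, div_le_iff₀ hN0]
  calc M ≤ 20 * y ^ 26 := hM'
    _ = 80 * (y ^ 5)⁻¹ * (1 / 4 * y ^ 31) := by field_simp; norm_num
    _ ≤ _ := by gcongr

/-- `max_{1 ≤ k ≤ p_m − 1} k · D_k*(E_{p_m}) = o(m)` as `m → ∞`. -/
theorem maxKD_isLittleO :
    Filter.Tendsto (fun m : ℕ => maxKD (nthPrime m) / (m : ℝ)) Filter.atTop (nhds 0) := by

  have hlim : Filter.Tendsto (fun m : ℕ => 80 * ((nthPrime m : ℕ) : ℝ) ^ (-(5 / 32) : ℝ))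
      Filter.atTop (nhds 0) := by
    have := ((tendsto_rpow_neg_atTop (y := 5 / 32) (by norm_num)).comp
      tendsto_nthPrime).const_mul 80
    simpa using this
  refine squeeze_zero' (Filter.Eventually.of_forall fun m =>
    div_nonneg (maxKD_nonneg _) (Nat.cast_nonneg _)) ?_ hlim
  filter_upwards [tendsto_nthPrime.eventually analytic_bound, Filter.eventually_ge_atTop 1]
    with m h hm
  refine h _ _ (maxKD_nonneg _) (maxKD_le _ (Nat.prime_nth_prime _)) ?_
  have := Chebyshev.pi_ge (nthPrime m)
  rw [pi_nthPrime_s3 m hm] at this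
  exact this
end

section
/- For each m ∈ ℕ let p_m denote the m-th prime number, and let E_{p_m} be the finite sequence ((j⁻¹ mod p_m)/p_m) for j = 1, 2, ..., p_m − 1. Then max_{1 ≤ k ≤ p_m − 1} k · D_k*(E_{p_m}) = O(m^{1/2} (ln m)^{5/2}) as m → ∞. -/
open Filter Finset
open scoped BigOperators Classical

namespace KS
open Polynomial

lemma hasse_dvd {K : Type*} [Field K] (f h : K[X]) (N : ℕ) : ∀ i, f ^ (N - i) ∣ hasseDeriv i (f ^ N * h) := by
  induction N with
  | zero => intro i; simp
  | succ N ih =>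
    intro i
    rw [pow_succ', mul_assoc, hasseDeriv_mul]
    refine Finset.dvd_sum ?_
    rintro ⟨a, b⟩ hab
    rw [HasAntidiagonal.mem_antidiagonal] at hab
    simp only at hab ⊢
    rcases Nat.eq_zero_or_pos a with rfl | ha
    · obtain rfl : b = i := by omega
      have : f ^ (N + 1 - b) ∣ f ^ (1 + (N - b)) := pow_dvd_pow _ (by omega)
      refine this.trans ?_
      rw [pow_add, pow_one, hasseDeriv_zero']
      exact mul_dvd_mul dvd_rfl (ih b)
    · exact ((pow_dvd_pow f (by omega)).trans (ih b)).mul_left _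

lemma hasse_quot {K : Type*} [Field K] (f r : K[X]) (hf : f.Monic) (N i B : ℕ) (hi : i ≤ N)
    (hr : r ∈ degreeLT K B) :
    ∃ u ∈ degreeLT K (B + i * f.natDegree), hasseDeriv i (f ^ N * r) = f ^ (N - i) * u := by
  obtain ⟨u, hu⟩ := hasse_dvd f r N i
  refine ⟨u, ?_, hu⟩
  rw [mem_degreeLT] at *
  by_cases hu0 : u = 0
  · subst hu0; rw [degree_zero]; exact WithBot.bot_lt_coe _
  by_cases hr0 : r = 0
  · subst hr0
    simp at hu
    rcases hu with h | h
    · exact absurd h.1 hf.ne_zero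
    · exact absurd h hu0
  rw [degree_eq_natDegree hr0, Nat.cast_lt] at hr
  rw [degree_eq_natDegree hu0, Nat.cast_lt]
  have h1 := natDegree_hasseDeriv_le (f ^ N * r) i
  rw [hu, natDegree_mul (pow_ne_zero _ hf.ne_zero) hu0,
    natDegree_mul (pow_ne_zero _ hf.ne_zero) hr0, natDegree_pow, natDegree_pow] at h1
  obtain ⟨c, rfl⟩ := Nat.exists_eq_add_of_le hi
  rw [Nat.add_sub_cancel_left, add_mul] at h1
  omega

lemma sqfree_desc {K : Type*} [Field K] (f : K[X]) (hf : Squarefree f) (hd : 0 < f.natDegree) (c : K) (hc : c ≠ 0) :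
    ∀ n (r s : K[X]), s.natDegree ≤ n → f * r ^ 2 = C c * s ^ 2 → r = 0 ∧ s = 0 := by
  have hf0 : f ≠ 0 := by rintro rfl; simp at hd
  have key : ∀ (r s : K[X]), f * r ^ 2 = C c * s ^ 2 → s = 0 → r = 0 := by
    rintro r s h rfl
    simpa [hf0] using h
  intro n
  induction n using Nat.strong_induction_on with
  | _ n ih =>
    intro r s hs h
    by_cases hs0 : s = 0
    · exact ⟨key r s h hs0, hs0⟩
    exfalso
    have hu : IsUnit (C c) := isUnit_C.mpr hc.isUnit
    have h1 : f ∣ s := by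
      have : f ∣ C c * s ^ 2 := ⟨_, h.symm⟩
      exact hf.isRadical 2 _ ((hu.dvd_mul_left).1 this)
    obtain ⟨t, rfl⟩ := h1
    have h2 : r ^ 2 = C c * f * t ^ 2 := by
      apply mul_left_cancel₀ hf0
      rw [h]; ring
    have h3 : f ∣ r := hf.isRadical 2 _ ⟨C c * t ^ 2, by rw [h2]; ring⟩
    obtain ⟨u, rfl⟩ := h3
    have h4 : f * u ^ 2 = C c * t ^ 2 := by
      apply mul_left_cancel₀ hf0
      linear_combination h2
    have ht : t ≠ 0 := right_ne_zero_of_mul hs0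
    rw [natDegree_mul hf0 ht] at hs
    exact ht (ih t.natDegree (by omega) u t le_rfl h4).2

lemma pow_card_expand {K : Type*} [Field K] [Fintype K] (f : K[X]) :
    ∃ h, f ^ Fintype.card K = C (f.eval 0) + X ^ Fintype.card K * h := by
  obtain ⟨p, hp⟩ := CharP.exists K
  haveI := hp
  obtain ⟨n, hpp, hn⟩ := FiniteField.card K p
  haveI : Fact p.Prime := ⟨hpp⟩
  refine ⟨f.divX ^ Fintype.card K, ?_⟩
  conv_lhs => rw [← divX_mul_X_add f, hn, add_pow_char_pow, ← hn, mul_pow, ← C_pow, FiniteField.pow_card]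
  rw [coeff_zero_eq_eval_zero]; ring

lemma base_nonvanish {K : Type*} [Field K] [Fintype K] (f : K[X]) (hf : Squarefree f)
    (hd : 0 < f.natDegree) (h0 : f.eval 0 ≠ 0) (e B : ℕ) (he : 2 * e + 1 = Fintype.card K)
    (hB : 2 * B + f.natDegree ≤ Fintype.card K) (r s : K[X]) (hr : r ∈ degreeLT K B)
    (hs : s ∈ degreeLT K B) (h : X ^ Fintype.card K ∣ r + s * f ^ e) : r = 0 ∧ s = 0 := by
  obtain ⟨w, hw⟩ := pow_card_expand f
  have h1 : X ^ Fintype.card K ∣ f * r ^ 2 - C (f.eval 0) * s ^ 2 := by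
    have : f * r ^ 2 - C (f.eval 0) * s ^ 2 = (r + s * f ^ e) * (r - s * f ^ e) * f
        + X ^ Fintype.card K * (w * s ^ 2) := by
      have h2 : f ^ (2 * e + 1) = C (f.eval 0) + X ^ Fintype.card K * w := by rw [he, hw]
      have : (r + s * f ^ e) * (r - s * f ^ e) * f = f * r ^ 2 - s ^ 2 * f ^ (2 * e + 1) := by ring
      rw [this, h2]; ring
    rw [this]
    exact dvd_add ((h.mul_right _).mul_right _) (dvd_mul_right _ _)
  have h2 : f * r ^ 2 - C (f.eval 0) * s ^ 2 = 0 := by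
    apply eq_zero_of_dvd_of_degree_lt h1
    rw [degree_X_pow]
    have hf0 : f ≠ 0 := by rintro rfl; simp at hd
    have aux : ∀ t : K[X], t ∈ degreeLT K B → t ≠ 0 → t.natDegree < B := by
      intro t ht ht0
      rw [mem_degreeLT, degree_eq_natDegree ht0, Nat.cast_lt] at ht
      exact ht
    refine (degree_sub_le _ _).trans_lt (max_lt ?_ ?_)
    · by_cases hr0 : r = 0
      · subst hr0; simp
      · have := aux r hr hr0
        rw [degree_eq_natDegree (by positivity), Nat.cast_lt, natDegree_mul hf0 (by positivity), natDegree_pow]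
        omega
    · by_cases hs0 : s = 0
      · subst hs0; simp
      · have := aux s hs hs0
        rw [degree_C_mul h0, degree_eq_natDegree (by positivity), Nat.cast_lt, natDegree_pow]
        omega
  exact sqfree_desc f hf hd _ h0 _ r s le_rfl (sub_eq_zero.1 h2)

lemma nonvanish {K : Type*} [Field K] [Fintype K] (f : K[X]) (hf : Squarefree f)
    (hd : 0 < f.natDegree) (h0 : f.eval 0 ≠ 0) (e B : ℕ) (he : 2 * e + 1 = Fintype.card K)
    (hB : 2 * B + f.natDegree ≤ Fintype.card K) (J : ℕ) : ∀ (r s : ℕ → K[X])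
    (hr : ∀ j, r j ∈ degreeLT K B)
    (hs : ∀ j, s j ∈ degreeLT K B)
    (h : ∑ j ∈ range J, (r j + s j * f ^ e) * X ^ (Fintype.card K * j) = 0),
    ∀ j < J, r j = 0 ∧ s j = 0 := by
  induction J with
  | zero => intro r s _ _ _ j hj; omega
  | succ J ih =>
    intro r s hr hs h
    rw [Finset.sum_range_succ'] at h
    have h1 : ∑ j ∈ range J, (r (j+1) + s (j+1) * f ^ e) * X ^ (Fintype.card K * (j+1)) =
      X ^ Fintype.card K * ∑ j ∈ range J, (r (j+1) + s (j+1) * f ^ e) * X ^ (Fintype.card K * j) := by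
      rw [Finset.mul_sum]
      refine Finset.sum_congr rfl fun j _ => ?_
      rw [mul_add, mul_one, pow_add]; ring
    rw [h1] at h
    simp only [mul_zero, pow_zero, mul_one] at h
    have h2 := base_nonvanish f hf hd h0 e B he hB (r 0) (s 0) (hr 0) (hs 0)
      ⟨-_, by rw [mul_neg]; exact (neg_eq_of_add_eq_zero_right h).symm⟩
    rw [h2.1, h2.2, zero_mul, add_zero, add_zero] at h
    have h3 := ih (fun j => r (j+1)) (fun j => s (j+1)) (fun j => hr _) (fun j => hs _)
      ((mul_eq_zero.1 h).resolve_left (pow_ne_zero _ X_ne_zero))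
    intro j hj
    rcases j with _ | j
    · exact h2
    · exact h3 j (by omega)

lemma taylor_shift {K : Type*} [Field K] [Fintype K] (x : K) (h : K[X]) (i j : ℕ)
    (hi : i < Fintype.card K) :
    (taylor x (h * X ^ (Fintype.card K * j))).coeff i = x ^ j * (hasseDeriv i h).eval x := by
  rw [taylor_mul, taylor_pow, taylor_X, pow_mul]
  obtain ⟨w, hw⟩ := pow_card_expand (X + C x)
  rw [hw]
  simp only [eval_add, eval_X, eval_C, zero_add]
  obtain ⟨v, hv⟩ : X ^ Fintype.card K ∣ (C x + X ^ Fintype.card K * w) ^ j - (C x) ^ j := by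
    refine Dvd.dvd.trans ?_ (sub_dvd_pow_sub_pow _ _ j)
    simp
  rw [sub_eq_iff_eq_add.1 hv, mul_add, coeff_add, ← taylor_coeff, ← C_pow, coeff_mul_C,
    show taylor x h * (X ^ Fintype.card K * v) = X ^ Fintype.card K * (taylor x h * v) by ring,
    coeff_X_pow_mul', if_neg (by omega)]
  ring

lemma roots_count {K : Type*} [Field K] (R : K[X]) (hR : R ≠ 0) (l : ℕ) (S : Finset K)
    (h : ∀ x ∈ S, (X - C x) ^ l ∣ R) : l * S.card ≤ R.natDegree := by
  have h1 : ∏ x ∈ S, (X - C x) ^ l ∣ R := by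
    refine Finset.prod_dvd_of_coprime ?_ h
    intro a _ b _ hab
    exact (pairwise_coprime_X_sub_C Function.injective_id hab).pow
  have := natDegree_le_of_dvd h1 hR
  rwa [natDegree_prod_of_monic _ _ (fun x _ => (monic_X_sub_C x).pow _), 
    Finset.sum_congr rfl (fun x _ => by rw [natDegree_pow, natDegree_X_sub_C, mul_one]), 
    Finset.sum_const, smul_eq_mul, mul_comm] at this

end KS

namespace KS
open Polynomial

lemma mulX_mem {K : Type*} [Field K] (u : K[X]) (a b j : ℕ) (h : u ∈ degreeLT K a) (hab : a + j ≤ b) :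
    X ^ j * u ∈ degreeLT K b := by
  rw [mem_degreeLT] at *
  by_cases hu : u = 0
  · subst hu; rw [mul_zero, degree_zero]; exact WithBot.bot_lt_coe _
  rw [degree_eq_natDegree hu, Nat.cast_lt] at h
  rw [degree_eq_natDegree (mul_ne_zero (pow_ne_zero _ X_ne_zero) hu), Nat.cast_lt,
    natDegree_mul (pow_ne_zero _ X_ne_zero) hu, natDegree_X_pow]
  omega

lemma finrank_degreeLT {K : Type*} [Field K] (B : ℕ) : Module.finrank K (degreeLT K B) = B := by
  rw [(degreeLTEquiv K B).finrank_eq]; simp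

noncomputable instance fd_degreeLT {K : Type*} [Field K] (B : ℕ) : FiniteDimensional K (degreeLT K B) :=
  Module.Finite.equiv (degreeLTEquiv K B).symm

/-- the linear conditions -/
noncomputable def Phi {K : Type*} [Field K] (f : K[X]) (e l J B : ℕ) (ε : K) (i : ℕ) :
    ((Fin J → degreeLT K B) × (Fin J → degreeLT K B)) →ₗ[K] K[X] where
  toFun v := ∑ j : Fin J, X ^ (j : ℕ) * (f ^ e * hasseDeriv i (f ^ l * (v.1 j : K[X])) +
    C ε * hasseDeriv i (f ^ (l + e) * (v.2 j : K[X])))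
  map_add' v w := by
    rw [← Finset.sum_add_distrib]
    refine Finset.sum_congr rfl fun j _ => ?_
    simp only [Prod.fst_add, Prod.snd_add, Pi.add_apply, Submodule.coe_add, mul_add, map_add]
    ring
  map_smul' c v := by
    rw [Finset.smul_sum]
    refine Finset.sum_congr rfl fun j _ => ?_
    simp only [Prod.smul_fst, Prod.smul_snd, Pi.smul_apply, Submodule.coe_smul, mul_smul_comm, map_smul,
      smul_add, RingHom.id_apply, mul_add]

lemma Phi_mem {K : Type*} [Field K] (f : K[X]) (hf : f.Monic) (e l J B : ℕ) (ε : K) (i : ℕ) (hi : i < l) (v) :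
    Phi f e l J B ε i v ∈ (degreeLT K (B + l * f.natDegree + J)).map (LinearMap.mulLeft K (f ^ (e + (l - i)))) := by
  have hdef : Phi f e l J B ε i v = ∑ j : Fin J, X ^ (j : ℕ) * (f ^ e * hasseDeriv i (f ^ l * (v.1 j : K[X])) +
    C ε * hasseDeriv i (f ^ (l + e) * (v.2 j : K[X]))) := rfl
  rw [hdef]
  refine Submodule.sum_mem _ fun j _ => ?_
  obtain ⟨u, hu, hu'⟩ := hasse_quot f (v.1 j) hf l i B hi.le (v.1 j).2
  obtain ⟨w, hw, hw'⟩ := hasse_quot f (v.2 j) hf (l + e) i B (by omega) (v.2 j).2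
  refine ⟨X ^ (j : ℕ) * (u + ε • w), ?_, ?_⟩
  · refine mulX_mem _ (B + i * f.natDegree) _ _ (Submodule.add_mem _ hu (Submodule.smul_mem _ _ hw)) ?_
    have := j.2
    have : i * f.natDegree ≤ l * f.natDegree := Nat.mul_le_mul_right _ hi.le
    omega
  · rw [LinearMap.mulLeft_apply, hu', hw', smul_eq_C_mul, show l + e - i = e + (l - i) by omega, pow_add]
    ring

lemma exists_sol {K : Type*} [Field K] (f : K[X]) (hf : f.Monic) (e l J B : ℕ) (ε : K)
    (h : l * (B + l * f.natDegree + J) < 2 * J * B) :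
    ∃ v, v ≠ 0 ∧ ∀ i < l, Phi f e l J B ε i v = 0 := by
  let U : Fin l → Submodule K K[X] := fun i =>
    (degreeLT K (B + l * f.natDegree + J)).map (LinearMap.mulLeft K (f ^ (e + (l - i))))
  let Ψ : ((Fin J → degreeLT K B) × (Fin J → degreeLT K B)) →ₗ[K] (∀ i, U i) :=
    LinearMap.pi fun i => (Phi f e l J B ε i).codRestrict (U i) (fun v => Phi_mem f hf e l J B ε i i.2 v)
  have hfr : Module.finrank K (∀ i, U i) ≤ l * (B + l * f.natDegree + J) := by
    rw [Module.finrank_pi_fintype]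
    refine (Finset.sum_le_sum (g := fun _ => B + l * f.natDegree + J) fun i _ => ?_).trans ?_
    · refine (Submodule.finrank_map_le _ _).trans ?_
      rw [finrank_degreeLT]
    · simp
  have hlt : Module.finrank K (∀ i, U i) < Module.finrank K ((Fin J → degreeLT K B) × (Fin J → degreeLT K B)) := by
    refine hfr.trans_lt (h.trans_le (le_of_eq ?_))
    rw [Module.finrank_prod, Module.finrank_pi_fintype]
    simp only [finrank_degreeLT]
    simp; ring
  have := LinearMap.ker_ne_bot_of_finrank_lt (f := Ψ) hlt
  obtain ⟨v, hv, hv0⟩ := Submodule.exists_mem_ne_zero_of_ne_bot this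
  refine ⟨v, hv0, fun i hi => ?_⟩
  have := congrFun (LinearMap.mem_ker.1 hv) ⟨i, hi⟩
  exact congrArg Subtype.val this

theorem stepanov {K : Type*} [Field K] [Fintype K] (f : K[X]) (hfm : f.Monic) (hf : Squarefree f)
    (hd : 0 < f.natDegree) (h0 : f.eval 0 ≠ 0) (e B l J : ℕ) (he : 2 * e + 1 = Fintype.card K)
    (hB : 2 * B + f.natDegree ≤ Fintype.card K) (hl : l ≤ Fintype.card K)
    (h : l * (B + l * f.natDegree + J) < 2 * J * B) (ε : K) (hε : ε ≠ 0)  :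
    l * (Finset.univ.filter fun x : K => (f.eval x) ^ e = ε).card ≤
      l * f.natDegree + B + e * f.natDegree + J * Fintype.card K := by
  obtain ⟨v, hv, hΦ⟩ := exists_sol f hfm e l J B ε h
  let r : ℕ → K[X] := fun j => if hj : j < J then (v.1 ⟨j, hj⟩ : K[X]) else 0
  let s : ℕ → K[X] := fun j => if hj : j < J then (v.2 ⟨j, hj⟩ : K[X]) else 0
  have hr : ∀ j, r j ∈ degreeLT K B := by
    intro j; simp only [r]; split_ifs
    · exact Subtype.property _
    · exact Submodule.zero_mem _
  have hs : ∀ j, s j ∈ degreeLT K B := by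
    intro j; simp only [s]; split_ifs
    · exact Subtype.property _
    · exact Submodule.zero_mem _
  set R : K[X] := f ^ l * ∑ j ∈ range J, (r j + s j * f ^ e) * X ^ (Fintype.card K * j) with hRdef
  have hR : R ≠ 0 := by
    intro hR
    have h1 := (mul_eq_zero.1 hR).resolve_left (pow_ne_zero _ hfm.ne_zero)
    have h2 := nonvanish f hf hd h0 e B he hB J r s hr hs h1
    apply hv
    ext j : 2
    · ext1
      have := (h2 j j.2).1
      simpa [r] using this
    · ext1
      have := (h2 j j.2).2
      simpa [s] using this
  refine (roots_count R hR l _ ?_).trans ?_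
  · intro x hx
    rw [Finset.mem_filter] at hx
    have hx := hx.2
    rw [X_sub_C_pow_dvd_iff, ← taylor_apply, X_pow_dvd_iff]
    intro i hi
    have hR' : R = ∑ j ∈ range J, (f ^ l * r j + f ^ (l + e) * s j) * X ^ (Fintype.card K * j) := by
      rw [hRdef, Finset.mul_sum]
      refine Finset.sum_congr rfl fun j _ => ?_
      ring
    rw [hR', map_sum, finset_sum_coeff]
    simp only [taylor_shift x _ i _ (hi.trans_le hl)]
    have h3 := congrArg (eval x) (hΦ i hi)
    have h4 : eval x (Phi f e l J B ε i v) = ε * ∑ j ∈ range J, x ^ j * eval x (hasseDeriv i (f ^ l * r j + f ^ (l + e) * s j)) := by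
      rw [Finset.sum_range, Finset.mul_sum]
      simp only [Phi, LinearMap.coe_mk, AddHom.coe_mk, eval_finset_sum]
      refine Finset.sum_congr rfl fun j _ => ?_
      simp only [eval_mul, eval_add, eval_pow, eval_X, eval_C, map_add, hx]
      simp only [r, s, j.2, dif_pos, Fin.eta]
      ring
    rw [h4, eval_zero] at h3
    exact (mul_eq_zero.1 h3).resolve_left hε
  · rw [hRdef, natDegree_mul (pow_ne_zero _ hfm.ne_zero) (right_ne_zero_of_mul hR), natDegree_pow]
    rw [add_assoc, add_assoc]
    gcongr
    refine natDegree_sum_le_of_forall_le _ _ fun j hj => ?_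
    rw [Finset.mem_range] at hj
    refine natDegree_mul_le.trans ?_
    rw [natDegree_X_pow, ← add_assoc]
    have h5 : Fintype.card K * j ≤ J * Fintype.card K := by
      rw [mul_comm]; exact Nat.mul_le_mul_right _ hj.le
    have aux : ∀ t ∈ degreeLT K B, t.natDegree ≤ B := by
      intro t ht
      rw [mem_degreeLT] at ht
      exact natDegree_le_of_degree_le ht.le
    refine add_le_add ((natDegree_add_le _ _).trans (max_le ((aux _ (hr j)).trans (by omega)) ?_)) h5
    refine natDegree_mul_le.trans ?_
    rw [natDegree_pow]
    exact add_le_add (aux _ (hs j)) le_rfl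

end KS

namespace KS
open Polynomial

lemma stepanov_params (p k : ℕ) (hp : 3 ≤ p) (hk : 2 ≤ k) (hodd : Odd p) :
    ∃ e B l J : ℕ, 2 * e + 1 = p ^ (2 * k) ∧ 2 * B + 2 * p ≤ p ^ (2 * k) ∧ l ≤ p ^ (2 * k) ∧
      l * (B + l * (2 * p) + J) < 2 * J * B ∧ 0 < l ∧
      2 * (l * (2 * p) + B + e * (2 * p) + J * p ^ (2 * k)) ≤
        l * (p ^ (2 * k) + (4 * p + (2 * p + 3) * p ^ 2) * p ^ k) := by
  obtain ⟨t, rfl⟩ := Nat.exists_eq_add_of_le hk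
  obtain ⟨e, he⟩ : Odd (p ^ (2 * (2 + t))) := hodd.pow
  obtain ⟨j, hj⟩ : Odd (p ^ t) := hodd.pow
  refine ⟨e, p ^ (2 * t + 3), p ^ t, j + 1, he.symm, ?_, ?_, ?_, ?_, ?_⟩
  · have h1 : p ^ (2 * (2 + t)) = p * p ^ (2 * t + 3) := by ring
    have h2 : p ^ (2 * t + 3) = p ^ (2 * t + 2) * p := by ring
    have h3 : 2 ≤ p ^ (2 * t + 2) := by
      calc 2 ≤ p ^ 1 := by rw [pow_one]; omega
        _ ≤ _ := Nat.pow_le_pow_right (by omega) (by omega)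
    have h4 : 2 * p ≤ p ^ (2 * t + 3) := by rw [h2]; exact Nat.mul_le_mul_right _ h3
    rw [h1]
    nlinarith
  · exact Nat.pow_le_pow_right (by omega) (by omega)
  · have hl : 0 < p ^ t := by positivity
    have h5 : p ^ (2 * t + 3) = (p ^ t) ^ 2 * p ^ 3 := by ring
    have h6 : 2 * p + 1 < p ^ 3 := by nlinarith [sq_nonneg p]
    have h7 : (p ^ t) ^ 2 * (2 * p + 1) < p ^ (2 * t + 3) := by
      rw [h5]; exact Nat.mul_lt_mul_of_pos_left h6 (by positivity)
    have h8 : j + 1 ≤ p ^ t := by omega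
    have h9 : 2 * (j + 1) * p ^ (2 * t + 3) = p ^ t * p ^ (2 * t + 3) + p ^ (2 * t + 3) := by
      have : 2 * (j + 1) = p ^ t + 1 := by omega
      rw [this]; ring
    rw [h9]
    nlinarith
  · positivity
  · set L := p ^ t
    have h1 : p ^ (2 * (2 + t)) = L ^ 2 * p ^ 4 := by simp only [L]; ring
    have h2 : p ^ (2 * t + 3) = L ^ 2 * p ^ 3 := by simp only [L]; ring
    have h3 : p ^ (2 + t) = L * p ^ 2 := by simp only [L]; ring
    have hL : 1 ≤ L := Nat.one_le_iff_ne_zero.2 (by positivity)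
    rw [h2]
    rw [h1] at he ⊢
    rw [h3]
    have h4 : 2 * e ≤ L ^ 2 * p ^ 4 := by omega
    have h5 : 2 * (j + 1) = L + 1 := by omega
    calc 2 * (L * (2 * p) + L ^ 2 * p ^ 3 + e * (2 * p) + (j + 1) * (L ^ 2 * p ^ 4))
        = 4 * L * p + 2 * L ^ 2 * p ^ 3 + (2 * e) * (2 * p) + (2 * (j + 1)) * (L ^ 2 * p ^ 4) := by ring
      _ ≤ 4 * L * p + 2 * L ^ 2 * p ^ 3 + (L ^ 2 * p ^ 4) * (2 * p) + (L + 1) * (L ^ 2 * p ^ 4) := by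
          rw [h5]; gcongr
      _ ≤ L * (L ^ 2 * p ^ 4 + (4 * p + (2 * p + 3) * p ^ 2) * (L * p ^ 2)) := by
          have a1 : L * p ≤ L ^ 2 * p ^ 3 := by
            calc L * p = L * p * 1 := by ring
              _ ≤ L * p * (L * p ^ 2) := Nat.mul_le_mul_left _ (Nat.one_le_iff_ne_zero.2 (by positivity))
              _ = _ := by ring
          have a2 : L ^ 2 * p ^ 3 ≤ L ^ 2 * p ^ 4 := by
            gcongr <;> omega
          ring_nf at a1 a2 ⊢
          omega

/-- The polynomial. -/
noncomputable def ff (K : Type*) [Field K] (p : ℕ) (a : K) : K[X] := (X ^ p - X) ^ 2 - C (4 * a)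

lemma ff_natDegree {K : Type*} [Field K] (p : ℕ) (hp : 3 ≤ p) (a : K) :
    (ff K p a).natDegree = 2 * p ∧ (ff K p a).Monic := by
  have h1 : (X ^ p - X : K[X]).Monic := monic_X_pow_sub (by rw [degree_X]; exact_mod_cast (by omega : 1 < p))
  have h2 : (X ^ p - X : K[X]).natDegree = p := by
    rw [natDegree_sub_eq_left_of_natDegree_lt] <;> simp; omega
  have h3 : ((X ^ p - X : K[X]) ^ 2).natDegree = 2 * p := by rw [natDegree_pow, h2]
  refine ⟨by rw [ff, natDegree_sub_C, h3], ?_⟩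
  refine (h1.pow 2).sub_of_left ?_
  refine degree_C_le.trans_lt ?_
  rw [← natDegree_pos_iff_degree_pos, h3]; omega

lemma ff_sqfree {K : Type*} [Field K] (p : ℕ) [CharP K p] (hp : p.Prime) (h3 : 3 ≤ p) (a : K) (ha : a ≠ 0) :
    Squarefree (ff K p a) := by
  apply Separable.squarefree
  have h2 : (2 : K) ≠ 0 := by
    have := (CharP.cast_eq_zero_iff K p 2).not.2 (fun h => by have := Nat.le_of_dvd (by norm_num) h; omega)
    exact_mod_cast this
  have h4 : (4 * a : K) ≠ 0 := by
    have : (4 : K) = 2 * 2 := by norm_num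
    rw [this]; positivity
  rw [separable_def]
  have hd : derivative (ff K p a) = - C 2 * (X ^ p - X) := by
    simp [ff, derivative_pow]
  rw [hd]
  refine ⟨-C (4 * a)⁻¹, - C (4 * a)⁻¹ * C (2⁻¹) * (X ^ p - X), ?_⟩
  have e1 : (C (4 * a)⁻¹ : K[X]) * C (4 * a) = 1 := by rw [← C_mul, inv_mul_cancel₀ h4, C_1]
  have e2 : (C (2⁻¹) : K[X]) * C 2 = 1 := by rw [← C_mul, inv_mul_cancel₀ h2, C_1]
  rw [ff]
  linear_combination e1 + (C (4 * a)⁻¹ * (X ^ p - X)^2) * e2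

lemma charsum {K : Type*} [Field K] [Fintype K] (p k : ℕ) [CharP K p] (hp : p.Prime) (h3 : 3 ≤ p)
    (hk : 2 ≤ k) (hc : Fintype.card K = p ^ (2 * k)) (a : K) (ha : a ≠ 0) :
    |∑ x : K, quadraticChar K ((x ^ p - x) ^ 2 - 4 * a)| ≤ ((4 * p + (2 * p + 3) * p ^ 2) * p ^ k + 2 * p : ℕ) := by
  have hodd : Odd p := hp.odd_of_ne_two (by omega)
  obtain ⟨e, B, l, J, he, hB, hl, hcond, hl0, hfin⟩ := stepanov_params p k h3 hk hodd
  obtain ⟨hdeg, hmon⟩ := ff_natDegree p h3 a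
  have h2 : (2 : K) ≠ 0 := by
    have := (CharP.cast_eq_zero_iff K p 2).not.2 (fun h => by have := Nat.le_of_dvd (by norm_num) h; omega)
    exact_mod_cast this
  have hch2 : ringChar K ≠ 2 := by
    rw [ringChar.eq K p]; omega
  have h4 : (4 * a : K) ≠ 0 := by
    have : (4 : K) = 2 * 2 := by norm_num
    rw [this]; positivity
  have h0 : (ff K p a).eval 0 ≠ 0 := by
    simp [ff, zero_pow hp.ne_zero]
    rw [← not_or, ← mul_eq_zero]; exact h4
  have ev : ∀ x, (ff K p a).eval x = (x ^ p - x) ^ 2 - 4 * a := by intro x; simp [ff]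
  set D := (4 * p + (2 * p + 3) * p ^ 2) * p ^ k with hD
  have key : ∀ ε : K, ε ≠ 0 → 2 * (univ.filter fun x : K => ((x ^ p - x) ^ 2 - 4 * a) ^ e = ε).card ≤ p ^ (2 * k) + D := by
    intro ε hε
    have := stepanov (ff K p a) hmon (ff_sqfree p hp h3 a ha) (by omega) h0 e B l J (by omega) (by omega)
      (by omega) (by rw [hdeg]; exact hcond) ε hε
    simp only [ev, hdeg, hc] at this
    refine Nat.le_of_mul_le_mul_left ?_ hl0
    refine le_trans ?_ hfin
    linarith
  have hE : Fintype.card K / 2 = e := by omega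
  have hpow : ∀ y : K, ((quadraticChar K y : ℤ) : K) = y ^ e := by
    intro y; rw [quadraticChar_eq_pow_of_char_ne_two' hch2, hE]
  have hne : (1 : K) ≠ -1 := by
    intro h
    apply h2
    linear_combination h
  have hchar : ∀ y : K, quadraticChar K y = (if y ^ e = 1 then 1 else 0) - (if y ^ e = -1 then 1 else 0) := by
    intro y
    rw [← hpow y]
    by_cases hy : y = 0
    · subst hy; simp
    · rcases quadraticChar_dichotomy hy with h | h <;> rw [h] <;> simp [hne, hne.symm]
  have htri : ∀ y : K, (1 : ℕ) = (if y ^ e = 1 then 1 else 0) + (if y ^ e = -1 then 1 else 0) + (if y = 0 then 1 else 0) := by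
    intro y
    by_cases hy : y = 0
    · subst hy
      have : e ≠ 0 := by
        rintro rfl
        have : 3 ^ 1 ≤ p ^ (2 * k) := (Nat.pow_le_pow_left h3 1).trans (Nat.pow_le_pow_right (by omega) (by omega))
        omega
      simp [zero_pow this]
    · rw [← hpow y]
      rcases quadraticChar_dichotomy hy with h | h <;> rw [h] <;> simp [hne, hne.symm, hy]
  have hZ : (univ.filter fun x : K => (x ^ p - x) ^ 2 - 4 * a = 0).card ≤ 2 * p := by
    have hsub : (univ.filter fun x : K => (x ^ p - x) ^ 2 - 4 * a = 0) ⊆ (ff K p a).roots.toFinset := by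
      intro x hx
      rw [Finset.mem_filter] at hx
      rw [Multiset.mem_toFinset, mem_roots hmon.ne_zero, IsRoot, ev]
      exact hx.2
    refine (Finset.card_le_card hsub).trans ((Multiset.toFinset_card_le _).trans ?_)
    rw [← hdeg]; exact card_roots' _
  have hsum : p ^ (2 * k) = (univ.filter fun x : K => ((x ^ p - x) ^ 2 - 4 * a) ^ e = 1).card +
      (univ.filter fun x : K => ((x ^ p - x) ^ 2 - 4 * a) ^ e = -1).card +
      (univ.filter fun x : K => (x ^ p - x) ^ 2 - 4 * a = 0).card := by
    rw [← hc, ← Finset.card_univ, Finset.card_eq_sum_ones,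
      Finset.sum_congr rfl (fun x _ => htri ((x ^ p - x) ^ 2 - 4 * a))]
    simp only [Finset.sum_add_distrib, Finset.card_filter]
  simp only [hchar, Finset.sum_sub_distrib, ← Finset.natCast_card_filter]
  have k1 := key 1 one_ne_zero
  have k2 := key (-1) (neg_ne_zero.2 one_ne_zero)
  rw [abs_le]
  constructor <;> push_cast <;> zify at k1 k2 hsum hZ <;> linarith

lemma quad_count {K : Type*} [Field K] [Fintype K] (h2 : ringChar K ≠ 2) (w a : K) :
    ((univ.filter fun u : K => u ^ 2 - w * u + a = 0).card : ℤ) = 1 + quadraticChar K (w ^ 2 - 4 * a) := by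
  have h2' : (2 : K) ≠ 0 := Ring.two_ne_zero h2
  rw [add_comm, ← quadraticChar_card_sqrts h2]
  norm_cast
  refine Finset.card_bij (fun u _ => 2 * u - w) ?_ ?_ ?_
  · intro u hu
    simp at hu ⊢
    linear_combination 4 * hu
  · intro u _ v _ h
    exact mul_left_cancel₀ h2' (sub_left_injective h)
  · intro y hy
    simp at hy
    refine ⟨(y + w) / 2, ?_, ?_⟩
    · simp
      field_simp
      linear_combination hy
    · field_simp; ring

theorem curve_count {K : Type*} [Field K] [Fintype K] (p k : ℕ) [CharP K p] (hp : p.Prime) (h3 : 3 ≤ p)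
    (hk : 2 ≤ k) (hc : Fintype.card K = p ^ (2 * k)) (a : K) (ha : a ≠ 0) :
    |∑ u ∈ univ.filter (fun u : K => u ≠ 0), ((univ.filter fun x : K => x ^ p - x = u + a / u).card : ℤ) - p ^ (2 * k)|
      ≤ ((4 * p + (2 * p + 3) * p ^ 2) * p ^ k + 2 * p : ℕ) := by
  have hch2 : ringChar K ≠ 2 := by
    rw [ringChar.eq K p]; omega
  convert charsum p k hp h3 hk hc a ha using 2
  have h1 : ∀ x : K, (quadraticChar K ((x ^ p - x) ^ 2 - 4 * a) : ℤ) =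
      ((univ.filter fun u : K => u ^ 2 - (x ^ p - x) * u + a = 0).card : ℤ) - 1 := by
    intro x; rw [quad_count hch2]; ring
  simp only [h1, Finset.sum_sub_distrib]
  congr 1
  · simp only [Finset.natCast_card_filter]
    rw [Finset.sum_comm]
    refine Finset.sum_congr rfl fun x _ => ?_
    rw [Finset.sum_filter]
    refine Finset.sum_congr rfl fun u _ => ?_
    by_cases hu : u = 0
    · subst hu; simp [ha]
    · simp only [ne_eq, hu, not_false_eq_true, if_true]
      congr 1
      rw [eq_iff_iff]
      constructor
      · intro h; rw [h]; field_simp; ring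
      · intro h; field_simp; linear_combination -h
  · simp [hc]

end KS

namespace KS
open Polynomial

noncomputable def KSum {p : ℕ} (K : Type*) [Field K] [Fintype K] [Algebra (ZMod p) K] (ψ : AddChar (ZMod p) ℂ)
    (a b : ZMod p) : ℂ :=
  ∑ x ∈ univ.filter (fun x : K => x ≠ 0), ψ (a * Algebra.trace (ZMod p) K x + b * Algebra.trace (ZMod p) K x⁻¹)

lemma trace_frob {p : ℕ} [Fact p.Prime] (K : Type*) [Field K] [Fintype K] [Algebra (ZMod p) K] (x : K) :
    Algebra.trace (ZMod p) K (x ^ p) = Algebra.trace (ZMod p) K x := by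
  have := Algebra.trace_eq_of_algEquiv (FiniteField.frobeniusAlgEquivOfAlgebraic (ZMod p) K) x
  rw [← this]
  congr 1
  simp

lemma ker_trace_card {p : ℕ} [Fact p.Prime] (K : Type*) [Field K] [Fintype K] [Algebra (ZMod p) K] :
    p * (univ.filter fun w : K => Algebra.trace (ZMod p) K w = 0).card = Fintype.card K := by
  have h1 := LinearMap.finrank_range_add_finrank_ker (Algebra.trace (ZMod p) K)
  rw [LinearMap.range_eq_top.2 (Algebra.trace_surjective (ZMod p) K), finrank_top, Module.finrank_self] at h1
  rw [Module.card_eq_pow_finrank (K := ZMod p) (V := K), ← h1, ZMod.card, pow_add, pow_one]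
  congr 1
  have := Module.card_eq_pow_finrank (K := ZMod p) (V := LinearMap.ker (Algebra.trace (ZMod p) K))
  rw [ZMod.card] at this
  rw [← this, ← Fintype.card_subtype]
  exact Fintype.card_congr (Equiv.subtypeEquivRight fun x => LinearMap.mem_ker.symm)

lemma fiber_le {p : ℕ} (hp : 3 ≤ p) (K : Type*) [Field K] [Fintype K] (w : K) :
    (univ.filter fun x : K => x ^ p - x = w).card ≤ p := by
  have h1 : (X ^ p - X : K[X]).Monic := monic_X_pow_sub (by rw [degree_X]; exact_mod_cast (by omega : 1 < p))
  have h2 : (X ^ p - X : K[X]).natDegree = p := by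
    rw [natDegree_sub_eq_left_of_natDegree_lt] <;> simp; omega
  have h3 : (X ^ p - X - C w : K[X]).natDegree = p := by rw [natDegree_sub_C, h2]
  have h0 : (X ^ p - X - C w : K[X]) ≠ 0 := by
    intro h; rw [h] at h3; simp at h3; omega
  have hsub : (univ.filter fun x : K => x ^ p - x = w) ⊆ (X ^ p - X - C w : K[X]).roots.toFinset := by
    intro x hx
    rw [Finset.mem_filter] at hx
    rw [Multiset.mem_toFinset, mem_roots h0, IsRoot]
    simp [hx.2]
  refine (Finset.card_le_card hsub).trans ((Multiset.toFinset_card_le _).trans ?_)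
  conv_rhs => rw [← h3]
  exact card_roots' _

lemma fiber_card {p : ℕ} [Fact p.Prime] (hp : 3 ≤ p) (K : Type*) [Field K] [Fintype K] [Algebra (ZMod p) K] (w : K) :
    (univ.filter fun x : K => x ^ p - x = w).card = if Algebra.trace (ZMod p) K w = 0 then p else 0 := by
  have hz : ∀ w : K, Algebra.trace (ZMod p) K w ≠ 0 → (univ.filter fun x : K => x ^ p - x = w).card = 0 := by
    intro w hw
    rw [Finset.card_eq_zero, Finset.filter_eq_empty_iff]
    rintro x _ rfl
    exact hw (by rw [map_sub, trace_frob, sub_self])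
  split_ifs with h
  · have hs : ∑ w ∈ univ.filter (fun w : K => Algebra.trace (ZMod p) K w = 0),
        (univ.filter fun x : K => x ^ p - x = w).card = ∑ w ∈ univ.filter (fun w : K => Algebra.trace (ZMod p) K w = 0), p := by
      rw [Finset.sum_const, smul_eq_mul, mul_comm, ker_trace_card, ← Finset.card_univ,
        Finset.card_eq_sum_card_fiberwise (f := fun x : K => x ^ p - x)
          (t := univ.filter (fun w : K => Algebra.trace (ZMod p) K w = 0))]
      intro x _
      simp [trace_frob]
    exact (Finset.sum_eq_sum_iff_of_le (fun w _ => fiber_le hp K w)).1 hs w (by simp [h])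
  · exact hz w h

theorem sum_bound {p : ℕ} [Fact p.Prime] (hp : 3 ≤ p) (ψ : AddChar (ZMod p) ℂ) (hψ : ψ.IsPrimitive) (a : ZMod p)
    (ha : a ≠ 0) (K : Type*) [Field K] [Fintype K] [Algebra (ZMod p) K] (k : ℕ) (hk : 2 ≤ k)
    (hc : Fintype.card K = p ^ (2 * k)) :
    ‖∑ c ∈ univ.filter (fun c : ZMod p => c ≠ 0), KSum K ψ c (c * a)‖ ≤
      ((4 * p + (2 * p + 3) * p ^ 2) + 2 * p + 1 : ℕ) * (p : ℝ) ^ k := by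
  have hpp := Fact.out (p := p.Prime)
  haveI : CharP K p := charP_of_injective_algebraMap' (ZMod p) p
  have hT := curve_count (K := K) p k hpp hp hk hc (algebraMap _ _ a) (by simpa using ha)
  have hall : ∑ c : ZMod p, KSum K ψ c (c * a) =
      ((∑ u ∈ univ.filter (fun u : K => u ≠ 0), ((univ.filter fun x : K => x ^ p - x = u + (algebraMap _ _ a) / u).card : ℤ) : ℤ) : ℂ) := by
    simp only [KSum]
    rw [Finset.sum_comm]
    push_cast
    refine Finset.sum_congr rfl fun u _ => ?_
    rw [fiber_card hp]
    have := AddChar.sum_mulShift (Algebra.trace (ZMod p) K (u + (algebraMap _ _ a) / u)) hψ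
    rw [ZMod.card] at this
    refine Eq.trans ?_ (this.trans ?_)
    rotate_left
    · split_ifs <;> simp
    · refine Finset.sum_congr rfl fun c _ => ?_
      congr 1
      rw [map_add, div_eq_mul_inv, ← Algebra.smul_def, map_smul, smul_eq_mul]
      ring
  have h0 : KSum K ψ 0 (0 * a) = (p : ℂ) ^ (2 * k) - 1 := by
    simp only [KSum, zero_mul, add_zero, AddChar.map_zero_eq_one, Finset.sum_const]
    rw [Finset.filter_ne', Finset.card_erase_of_mem (mem_univ _), Finset.card_univ, hc]
    rw [nsmul_eq_mul, mul_one, Nat.cast_sub (Nat.one_le_pow _ _ (by omega))]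
    simp
  have hsplit : ∑ c ∈ univ.filter (fun c : ZMod p => c ≠ 0), KSum K ψ c (c * a) =
      ((∑ u ∈ univ.filter (fun u : K => u ≠ 0), ((univ.filter fun x : K => x ^ p - x = u + (algebraMap _ _ a) / u).card : ℤ) - p ^ (2 * k) : ℤ) : ℂ) + 1 := by
    have he := Finset.sum_erase_add univ (fun c : ZMod p => KSum K ψ c (c * a)) (mem_univ (0 : ZMod p))
    rw [hall, h0] at he
    rw [Finset.filter_ne', eq_sub_of_add_eq he]
    push_cast
    ring
  rw [hsplit]
  refine (norm_add_le _ _).trans ?_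
  rw [Complex.norm_intCast, norm_one]
  have hT' : ((|∑ u ∈ univ.filter (fun u : K => u ≠ 0), ((univ.filter fun x : K => x ^ p - x = u + (algebraMap _ _ a) / u).card : ℤ) - p ^ (2 * k)| : ℤ) : ℝ)
     ≤ (((4 * p + (2 * p + 3) * p ^ 2) * p ^ k + 2 * p : ℕ) : ℝ) := by exact_mod_cast hT
  rw [Int.cast_abs] at hT'
  refine (add_le_add_left hT' _).trans ?_
  have h1 : (1 : ℝ) ≤ (p : ℝ) ^ k := one_le_pow₀ (by exact_mod_cast (by omega : 1 ≤ p))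
  push_cast
  have hp0 : (0 : ℝ) ≤ p := by positivity
  nlinarith

end KS

namespace KS
open Polynomial

noncomputable def Lam {p : ℕ} [Fact p.Prime] (ψ : AddChar (ZMod p) ℂ) (a b : ZMod p) (f : (ZMod p)[X]) : ℂ :=
  if f.coeff 0 = 0 then 0 else ψ (-(a * f.nextCoeff + b * (f.coeff 1 / f.coeff 0)))

lemma Lam_mul {p : ℕ} [Fact p.Prime] (ψ : AddChar (ZMod p) ℂ) (a b : ZMod p) (f g : (ZMod p)[X])
    (hf : f.Monic) (hg : g.Monic) : Lam ψ a b (f * g) = Lam ψ a b f * Lam ψ a b g := by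
  simp only [Lam]
  rw [mul_coeff_zero, mul_coeff_one, hf.nextCoeff_mul hg]
  by_cases h1 : f.coeff 0 = 0
  · simp [h1]
  by_cases h2 : g.coeff 0 = 0
  · simp [h2]
  rw [if_neg (mul_ne_zero h1 h2), if_neg h1, if_neg h2, ← AddChar.map_add_eq_mul]
  congr 1
  field_simp
  ring

lemma Lam_one {p : ℕ} [Fact p.Prime] (ψ : AddChar (ZMod p) ℂ) (a b : ZMod p) : Lam ψ a b 1 = 1 := by
  have : (1 : (ZMod p)[X]).nextCoeff = 0 := by simp [nextCoeff]
  simp [Lam, coeff_one, this]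

lemma Lam_pow {p : ℕ} [Fact p.Prime] (ψ : AddChar (ZMod p) ℂ) (a b : ZMod p) (f : (ZMod p)[X])
    (hf : f.Monic) (j : ℕ) : Lam ψ a b (f ^ j) = Lam ψ a b f ^ j := by
  induction j with
  | zero => simp [Lam_one]
  | succ j ih => rw [pow_succ, pow_succ, Lam_mul _ _ _ _ _ (hf.pow _) hf, ih]

lemma fin_deg (p : ℕ) [Fact p.Prime] (n : ℕ) : {f : (ZMod p)[X] | f.natDegree ≤ n}.Finite := by
  have : Finite (degreeLT (ZMod p) (n + 1)) :=
    Finite.of_equiv _ (degreeLTEquiv (ZMod p) (n + 1)).symm.toEquiv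
  refine Set.Finite.subset (Set.toFinite (degreeLT (ZMod p) (n + 1) : Set (ZMod p)[X])) ?_
  intro f hf
  rw [SetLike.mem_coe, mem_degreeLT]
  exact degree_le_natDegree.trans_lt (by exact_mod_cast Nat.lt_succ_of_le hf)

noncomputable def Mon (p : ℕ) [Fact p.Prime] (n : ℕ) : Finset (ZMod p)[X] :=
  (fin_deg p n).toFinset.filter fun f => f.Monic ∧ f.natDegree = n

noncomputable def Irr (p : ℕ) [Fact p.Prime] (n : ℕ) : Finset (ZMod p)[X] :=
  (fin_deg p n).toFinset.filter fun f => f.Monic ∧ Irreducible f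

lemma mem_Mon {p : ℕ} [Fact p.Prime] {n : ℕ} {f : (ZMod p)[X]} : f ∈ Mon p n ↔ f.Monic ∧ f.natDegree = n := by
  simp only [Mon, Finset.mem_filter, Set.Finite.mem_toFinset, Set.mem_setOf_eq]
  constructor
  · exact fun h => h.2
  · exact fun h => ⟨h.2.le, h⟩

lemma mem_Irr {p : ℕ} [Fact p.Prime] {n : ℕ} {f : (ZMod p)[X]} :
    f ∈ Irr p n ↔ f.Monic ∧ Irreducible f ∧ f.natDegree ≤ n := by
  simp only [Irr, Finset.mem_filter, Set.Finite.mem_toFinset, Set.mem_setOf_eq]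
  tauto

noncomputable def AA {p : ℕ} [Fact p.Prime] (ψ : AddChar (ZMod p) ℂ) (a b : ZMod p) (n : ℕ) : ℂ :=
  ∑ f ∈ Mon p n, Lam ψ a b f

lemma AA_zero {p : ℕ} [Fact p.Prime] (ψ : AddChar (ZMod p) ℂ) (a b : ZMod p) : AA ψ a b 0 = 1 := by
  have : Mon p 0 = {1} := by
    ext f
    rw [mem_Mon, Finset.mem_singleton]
    constructor
    · rintro ⟨h1, h2⟩; exact h1.natDegree_eq_zero.1 h2
    · rintro rfl; simp
  rw [AA, this, Finset.sum_singleton, Lam_one]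

lemma shift_mem {p : ℕ} [Fact p.Prime] (n : ℕ) (hn : 1 ≤ n) (t : ZMod p) (f : (ZMod p)[X]) (hf : f ∈ Mon p n) :
    f + C t * X ^ (n - 1) ∈ Mon p n := by
  rw [mem_Mon] at *
  have hlt : (C t * X ^ (n - 1) : (ZMod p)[X]).degree < f.degree := by
    rw [degree_eq_natDegree hf.1.ne_zero, hf.2]
    refine (degree_C_mul_X_pow_le _ _).trans_lt ?_
    exact_mod_cast (by omega : n - 1 < n)
  exact ⟨hf.1.add_of_left hlt, by rw [natDegree_add_eq_left_of_degree_lt hlt, hf.2]⟩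

lemma AA_big {p : ℕ} [Fact p.Prime] (ψ : AddChar (ZMod p) ℂ) (hψ : ψ.IsPrimitive) (a b : ZMod p) (ha : a ≠ 0)
    (n : ℕ) (hn : 3 ≤ n) : AA ψ a b n = 0 := by
  obtain ⟨t, ht⟩ : ∃ t, ψ (-(a * t)) ≠ 1 := by
    have := hψ (neg_ne_zero.2 ha)
    rw [AddChar.ne_one_iff] at this
    obtain ⟨t, ht⟩ := this
    refine ⟨t, ?_⟩
    rwa [AddChar.mulShift_apply, neg_mul] at ht
  have h1 : AA ψ a b n = ψ (-(a * t)) * AA ψ a b n := by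
    conv_lhs => rw [AA]
    rw [AA, Finset.mul_sum]
    symm
    refine Finset.sum_nbij' (fun f => f + C t * X ^ (n - 1)) (fun f => f + C (-t) * X ^ (n - 1))
      (fun f hf => shift_mem n (by omega) t f hf) (fun f hf => shift_mem n (by omega) (-t) f hf) ?_ ?_ ?_
    · intro f _; simp
    · intro f _; simp
    · intro f hf
      have hf' := mem_Mon.1 (shift_mem n (by omega) t f hf)
      rw [mem_Mon] at hf
      have e0 : (f + C t * X ^ (n - 1)).coeff 0 = f.coeff 0 := by
        rw [coeff_add, coeff_C_mul_X_pow, if_neg (by omega), add_zero]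
      have e1 : (f + C t * X ^ (n - 1)).coeff 1 = f.coeff 1 := by
        rw [coeff_add, coeff_C_mul_X_pow, if_neg (by omega), add_zero]
      have e2 : (f + C t * X ^ (n - 1)).nextCoeff = f.nextCoeff + t := by
        rw [nextCoeff_of_natDegree_pos (by omega), nextCoeff_of_natDegree_pos (by omega), hf'.2, hf.2,
          coeff_add, coeff_C_mul_X_pow, if_pos rfl]
      simp only [Lam]
      rw [e0, e1, e2]
      split_ifs
      · simp
      · rw [← AddChar.map_add_eq_mul]; congr 1; ring
  have h2 : (ψ (-(a * t)) - 1) * AA ψ a b n = 0 := by linear_combination -h1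
  exact (mul_eq_zero.1 h2).resolve_left (sub_ne_zero.2 ht)

lemma deg_identity {p : ℕ} [Fact p.Prime] (n : ℕ) (f : (ZMod p)[X]) (hf : f ∈ Mon p n) :
    n = ∑ P ∈ Irr p n, ∑ j ∈ Finset.Icc 1 n, if P ^ j ∣ f then P.natDegree else 0 := by
  obtain ⟨hm, hd⟩ := mem_Mon.1 hf
  have hf0 := hm.ne_zero
  have hprod : (UniqueFactorizationMonoid.normalizedFactors f).prod = f := by
    rw [UniqueFactorizationMonoid.prod_normalizedFactors_eq hf0, hm.normalize_eq_self]
  have hirr : ∀ P ∈ UniqueFactorizationMonoid.normalizedFactors f, P ∈ Irr p n := by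
    intro P hP
    have hi := UniqueFactorizationMonoid.irreducible_of_normalized_factor P hP
    have hn := UniqueFactorizationMonoid.normalize_normalized_factor P hP
    have hdv := UniqueFactorizationMonoid.dvd_of_mem_normalizedFactors hP
    refine mem_Irr.2 ⟨?_, hi, ?_⟩
    · rw [← hn]; exact monic_normalize hi.ne_zero
    · rw [← hd]; exact natDegree_le_of_dvd hdv hf0
  have h1 : n = ((UniqueFactorizationMonoid.normalizedFactors f).map natDegree).sum := by
    rw [← natDegree_multiset_prod _ (UniqueFactorizationMonoid.zero_notMem_normalizedFactors f), hprod, hd]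
  conv_lhs => rw [h1]
  rw [Finset.sum_multiset_map_count]
  refine Finset.sum_subset_zero_on_sdiff ?_ ?_ ?_
  · intro P hP
    exact hirr P (Multiset.mem_toFinset.1 hP)
  · intro P hP
    rw [Finset.mem_sdiff, Multiset.mem_toFinset] at hP
    obtain ⟨hP1, hP2, hP3⟩ := mem_Irr.1 hP.1
    refine Finset.sum_eq_zero fun j hj => ?_
    rw [Finset.mem_Icc] at hj
    rw [if_neg]
    intro hdv
    apply hP.2
    rw [UniqueFactorizationMonoid.mem_normalizedFactors_iff' hf0]
    exact ⟨hP2, hP1.normalize_eq_self, (dvd_pow_self P (by omega)).trans hdv⟩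
  · intro P hP
    obtain ⟨hP1, hP2, hP3⟩ := mem_Irr.1 (hirr P (Multiset.mem_toFinset.1 hP))
    rw [← Finset.sum_filter, Finset.sum_const]
    congr 1
    have : (Finset.Icc 1 n).filter (fun j => P ^ j ∣ f) = Finset.Icc 1 ((UniqueFactorizationMonoid.normalizedFactors f).count P) := by
      ext j
      rw [Finset.mem_filter, Finset.mem_Icc, Finset.mem_Icc]
      have h2 : P ^ j ∣ f ↔ j ≤ (UniqueFactorizationMonoid.normalizedFactors f).count P := by
        rw [pow_dvd_iff_le_emultiplicity,
          UniqueFactorizationMonoid.emultiplicity_eq_count_normalizedFactors hP2 hf0, hP1.normalize_eq_self]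
        exact_mod_cast Iff.rfl
      rw [← h2]
      constructor
      · exact fun h => ⟨h.1.1, h.2⟩
      · intro h
        refine ⟨⟨h.1, ?_⟩, h.2⟩
        have := natDegree_le_of_dvd h.2 hf0
        rw [natDegree_pow, hd] at this
        have := hP2.natDegree_pos
        nlinarith
    rw [this]; simp

lemma sum_mult {p : ℕ} [Fact p.Prime] (ψ : AddChar (ZMod p) ℂ) (a b : ZMod p) (n : ℕ) (Q : (ZMod p)[X]) (hQ : Q.Monic) :
    ∑ f ∈ (Mon p n).filter (fun f => Q ∣ f), Lam ψ a b f =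
      if Q.natDegree ≤ n then Lam ψ a b Q * AA ψ a b (n - Q.natDegree) else 0 := by
  split_ifs with h
  · rw [AA, Finset.mul_sum]
    symm
    refine Finset.sum_bij (fun g _ => Q * g) ?_ ?_ ?_ ?_
    · intro g hg
      rw [mem_Mon] at hg
      rw [Finset.mem_filter, mem_Mon]
      exact ⟨⟨hQ.mul hg.1, by rw [hQ.natDegree_mul hg.1]; omega⟩, dvd_mul_right _ _⟩
    · intro g _ g' _ h; exact mul_left_cancel₀ hQ.ne_zero h
    · intro f hf
      rw [Finset.mem_filter, mem_Mon] at hf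
      obtain ⟨⟨hm, hd⟩, g, rfl⟩ := hf
      have hg := hQ.of_mul_monic_left hm
      refine ⟨g, mem_Mon.2 ⟨hg, ?_⟩, rfl⟩
      rw [hQ.natDegree_mul hg] at hd; omega
    · intro g hg
      rw [mem_Mon] at hg
      rw [Lam_mul _ _ _ _ _ hQ hg.1]
  · rw [Finset.sum_eq_zero]
    intro f hf
    rw [Finset.mem_filter, mem_Mon] at hf
    exfalso; apply h
    rw [← hf.1.2]
    exact natDegree_le_of_dvd hf.2 hf.1.1.ne_zero

noncomputable def WW {p : ℕ} [Fact p.Prime] (ψ : AddChar (ZMod p) ℂ) (a b : ZMod p) (n k : ℕ) : ℂ :=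
  ∑ P ∈ (Irr p n).filter (fun P => P.natDegree ∣ k), (P.natDegree : ℂ) * Lam ψ a b P ^ (k / P.natDegree)

lemma recurrence {p : ℕ} [Fact p.Prime] (ψ : AddChar (ZMod p) ℂ) (a b : ZMod p) (n : ℕ) :
    (n : ℂ) * AA ψ a b n = ∑ k ∈ Finset.Icc 1 n, WW ψ a b n k * AA ψ a b (n - k) := by
  have h1 : (n : ℂ) * AA ψ a b n = ∑ f ∈ Mon p n, ∑ P ∈ Irr p n, ∑ j ∈ Finset.Icc 1 n,
      if P ^ j ∣ f then (P.natDegree : ℂ) * Lam ψ a b f else 0 := by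
    rw [AA, Finset.mul_sum]
    refine Finset.sum_congr rfl fun f hf => ?_
    conv_lhs => rw [deg_identity n f hf]
    push_cast
    rw [Finset.sum_mul]
    refine Finset.sum_congr rfl fun P _ => ?_
    rw [Finset.sum_mul]
    refine Finset.sum_congr rfl fun j _ => ?_
    split_ifs <;> simp
  rw [h1, Finset.sum_comm]
  have h2 : ∀ P ∈ Irr p n, ∑ f ∈ Mon p n, ∑ j ∈ Finset.Icc 1 n,
      (if P ^ j ∣ f then (P.natDegree : ℂ) * Lam ψ a b f else 0) =
      ∑ k ∈ Finset.Icc 1 n, if P.natDegree ∣ k then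
        (P.natDegree : ℂ) * Lam ψ a b P ^ (k / P.natDegree) * AA ψ a b (n - k) else 0 := by
    intro P hP
    obtain ⟨hP1, hP2, hP3⟩ := mem_Irr.1 hP
    have hpos := hP2.natDegree_pos
    rw [Finset.sum_comm]
    have h3 : ∀ j, ∑ f ∈ Mon p n, (if P ^ j ∣ f then (P.natDegree : ℂ) * Lam ψ a b f else 0) =
        if j * P.natDegree ≤ n then (P.natDegree : ℂ) * Lam ψ a b P ^ j * AA ψ a b (n - j * P.natDegree) else 0 := by
      intro j
      rw [← Finset.sum_filter, ← Finset.mul_sum, sum_mult _ _ _ _ _ (hP1.pow j), natDegree_pow, Lam_pow _ _ _ _ hP1]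
      split_ifs <;> ring
    simp only [h3]
    rw [← Finset.sum_filter, ← Finset.sum_filter]
    refine Finset.sum_bij (fun j _ => j * P.natDegree) ?_ ?_ ?_ ?_
    · intro j hj
      simp only [Finset.mem_filter, Finset.mem_Icc] at hj ⊢
      exact ⟨⟨Nat.mul_pos (by omega) hpos, hj.2⟩, dvd_mul_left _ _⟩
    · intro j _ j' _ h
      exact Nat.eq_of_mul_eq_mul_right hpos h
    · intro k hk
      simp only [Finset.mem_filter, Finset.mem_Icc] at hk
      obtain ⟨⟨hk1, hk2⟩, c, rfl⟩ := hk
      refine ⟨c, ?_, by ring⟩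
      simp only [Finset.mem_filter, Finset.mem_Icc]
      refine ⟨⟨Nat.pos_of_ne_zero (by rintro rfl; simp at hk1), by nlinarith⟩, by rw [mul_comm]; exact hk2⟩
    · intro j _
      rw [Nat.mul_div_cancel _ hpos]
  rw [Finset.sum_congr rfl h2, Finset.sum_comm]
  refine Finset.sum_congr rfl fun k _ => ?_
  rw [WW, Finset.sum_mul, Finset.sum_filter]

end KS

namespace KS
open Polynomial IntermediateField

lemma adjoin_inv {F K : Type*} [Field F] [Field K] [Algebra F K] (x : K) : F⟮x⁻¹⟯ = F⟮x⟯ := by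
  apply le_antisymm
  · rw [adjoin_simple_le_iff]
    exact inv_mem (mem_adjoin_simple_self F x)
  · rw [adjoin_simple_le_iff]
    have := inv_mem (mem_adjoin_simple_self F x⁻¹)
    rwa [inv_inv] at this

lemma nextCoeff_minpoly_inv {F K : Type*} [Field F] [Field K] [Algebra F K] [FiniteDimensional F K] (x : K)
    (hx : x ≠ 0) : (minpoly F x⁻¹).nextCoeff = (minpoly F x).coeff 1 / (minpoly F x).coeff 0 := by
  have hi : IsIntegral F x := IsIntegral.of_finite F x
  have hi' : IsIntegral F x⁻¹ := IsIntegral.of_finite F x⁻¹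
  set P := minpoly F x with hP
  have hPm : P.Monic := minpoly.monic hi
  have h0 : P.coeff 0 ≠ 0 := minpoly.coeff_zero_ne_zero hi hx
  have hdpos : 0 < P.natDegree := minpoly.natDegree_pos hi
  have hdeg : (minpoly F x⁻¹).natDegree = P.natDegree := by
    rw [← adjoin.finrank hi', ← adjoin.finrank hi, adjoin_inv]
  have hrd : P.reverse.natDegree = P.natDegree := by
    rw [reverse_natDegree, natTrailingDegree_eq_zero.2 (Or.inr h0), Nat.sub_zero]
  have hrl : P.reverse.leadingCoeff = P.coeff 0 := by
    rw [reverse_leadingCoeff, trailingCoeff, natTrailingDegree_eq_zero.2 (Or.inr h0)]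
  set Q : F[X] := C (P.coeff 0)⁻¹ * P.reverse with hQ
  have hQd : Q.natDegree = P.natDegree := by
    rw [hQ, natDegree_C_mul (inv_ne_zero h0), hrd]
  have hQm : Q.Monic := by
    rw [Monic, hQ, leadingCoeff_mul, leadingCoeff_C, hrl, inv_mul_cancel₀ h0]
  have hroot : aeval x⁻¹ Q = 0 := by
    rw [hQ, map_mul]
    have : eval₂ (algebraMap F K) x⁻¹ P.reverse = 0 := by
      letI := invertibleOfNonzero hx
      rw [← invOf_eq_inv x]
      have h := eval₂_reverse_eq_zero_iff (algebraMap F K) x P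
      rw [h]
      exact minpoly.aeval F x
    rw [show aeval x⁻¹ P.reverse = 0 from this, mul_zero]
  have hdvd : minpoly F x⁻¹ ∣ Q := minpoly.dvd F _ hroot
  have heq : minpoly F x⁻¹ = Q := 
    (eq_of_monic_of_dvd_of_natDegree_le (minpoly.monic hi') hQm hdvd (by rw [hQd, hdeg])).symm
  rw [heq, nextCoeff_of_natDegree_pos (by omega), hQd, hQ, coeff_C_mul, coeff_reverse, revAt_le (by omega),
    show P.natDegree - (P.natDegree - 1) = 1 by omega]
  field_simp

lemma psi_trace {p : ℕ} [Fact p.Prime] (ψ : AddChar (ZMod p) ℂ) (a b : ZMod p) (K : Type*) [Field K] [Fintype K]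
    [Algebra (ZMod p) K] (x : K) (hx : x ≠ 0) :
    ψ (a * Algebra.trace (ZMod p) K x + b * Algebra.trace (ZMod p) K x⁻¹) =
      Lam ψ a b (minpoly (ZMod p) x) ^ (Module.finrank (ZMod p) K / (minpoly (ZMod p) x).natDegree) := by
  have hi : IsIntegral (ZMod p) x := IsIntegral.of_finite _ x
  have h0 : (minpoly (ZMod p) x).coeff 0 ≠ 0 := minpoly.coeff_zero_ne_zero hi hx
  have hk : Module.finrank (ZMod p) K / (minpoly (ZMod p) x).natDegree = Module.finrank (ZMod p)⟮x⟯ K := by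
    rw [← adjoin.finrank hi, ← Module.finrank_mul_finrank (ZMod p) (ZMod p)⟮x⟯ K]
    exact Nat.mul_div_cancel_left _ Module.finrank_pos
  rw [trace_eq_finrank_mul_minpoly_nextCoeff, trace_eq_finrank_mul_minpoly_nextCoeff, adjoin_inv,
    nextCoeff_minpoly_inv x hx, hk, Lam, if_neg h0, ← AddChar.map_nsmul_eq_pow, nsmul_eq_mul]
  congr 1
  ring

lemma card_minpoly {p : ℕ} [Fact p.Prime] (K : Type*) [Field K] [Fintype K]
    [Algebra (ZMod p) K] (P : (ZMod p)[X]) (hP : P.Monic) (hi : Irreducible P) :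
    (univ.filter fun x : K => minpoly (ZMod p) x = P).card =
      if P.natDegree ∣ Module.finrank (ZMod p) K then P.natDegree else 0 := by
  split_ifs with h
  · rw [hi.natDegree_dvd_iff_dvd_X_pow_card_pow_sub_X, Nat.card_zmod] at h
    have hcard : Nat.card K = p ^ Module.finrank (ZMod p) K := by
      rw [Nat.card_eq_fintype_card, Module.card_eq_pow_finrank (K := ZMod p) (V := K), ZMod.card]
    have hs : ((X ^ p ^ Module.finrank (ZMod p) K - X : (ZMod p)[X]).map (algebraMap (ZMod p) K)).Splits := by
      rw [← hcard]
      have := FiniteField.splits_X_pow_nat_card_sub_X p (K := K)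
      simpa using this
    have hne : (X ^ p ^ Module.finrank (ZMod p) K - X : (ZMod p)[X]) ≠ 0 :=
      FiniteField.X_pow_card_pow_sub_X_ne_zero _ Module.finrank_pos.ne' (Fact.out (p := p.Prime)).one_lt
    have hs' : (P.map (algebraMap (ZMod p) K)).Splits :=
      hs.of_dvd ((Polynomial.map_ne_zero_iff (algebraMap (ZMod p) K).injective).2 hne) (Polynomial.map_dvd _ h)
    have hsep : P.Separable := PerfectField.separable_of_irreducible hi
    rw [← card_rootSet_eq_natDegree hsep hs', ← Set.toFinset_card]
    congr 1
    ext x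
    rw [Finset.mem_filter, Set.mem_toFinset, mem_rootSet]
    constructor
    · rintro ⟨_, rfl⟩
      exact ⟨hP.ne_zero, minpoly.aeval _ _⟩
    · rintro ⟨_, hx⟩
      exact ⟨mem_univ _, (minpoly.eq_of_irreducible_of_monic hi hx hP).symm⟩
  · rw [Finset.card_eq_zero, Finset.filter_eq_empty_iff]
    rintro x _ rfl
    exact h (minpoly.degree_dvd (IsIntegral.of_finite _ x))

theorem KSum_eq_WW {p : ℕ} [Fact p.Prime] (ψ : AddChar (ZMod p) ℂ) (a b : ZMod p) (K : Type*) [Field K] [Fintype K]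
    [Algebra (ZMod p) K] (n : ℕ) (hn : Module.finrank (ZMod p) K ≤ n) :
    KSum K ψ a b = WW ψ a b n (Module.finrank (ZMod p) K) := by
  set k := Module.finrank (ZMod p) K
  have hk : 0 < k := Module.finrank_pos
  have h1 : KSum K ψ a b = ∑ x : K, Lam ψ a b (minpoly (ZMod p) x) ^ (k / (minpoly (ZMod p) x).natDegree) := by
    rw [KSum, Finset.sum_filter]
    refine Finset.sum_congr rfl fun x _ => ?_
    by_cases hx : x = 0
    · subst hx
      rw [if_neg (by simp), minpoly.zero, natDegree_X, Nat.div_one, Lam, if_pos (by simp), zero_pow hk.ne']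
    · rw [if_pos hx, psi_trace _ _ _ _ _ hx]
  have hmem : ∀ x ∈ (univ : Finset K), minpoly (ZMod p) x ∈ Irr p n := by
    intro x _
    have hi : IsIntegral (ZMod p) x := IsIntegral.of_finite _ x
    exact mem_Irr.2 ⟨minpoly.monic hi, minpoly.irreducible hi,
      (Nat.le_of_dvd hk (minpoly.degree_dvd hi)).trans hn⟩
  rw [h1, ← Finset.sum_fiberwise_of_maps_to hmem, WW, Finset.sum_filter]
  refine Finset.sum_congr rfl fun P hP => ?_
  obtain ⟨hP1, hP2, hP3⟩ := mem_Irr.1 hP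
  rw [Finset.sum_congr rfl (g := fun _ => Lam ψ a b P ^ (k / P.natDegree))
    (fun x hx => by rw [(Finset.mem_filter.1 hx).2]), Finset.sum_const, card_minpoly K P hP1 hP2]
  split_ifs <;> simp

end KS

namespace KS
open Polynomial

lemma power_sum {ι : Type*} (s : Finset ι) (z : ι → ℂ) (D R : ℝ) (hR : 0 < R) (k0 : ℕ)
    (h : ∀ k, k0 ≤ k → ‖∑ i ∈ s, z i ^ k‖ ≤ D * R ^ k) (i0 : ι) (hi0 : i0 ∈ s) : ‖z i0‖ ≤ R := by
  by_contra hlt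
  push Not at hlt
  set P : ℂ[X] := ∏ w ∈ (s.image z).erase (z i0), (X - C w) with hP
  have hP0 : P.eval (z i0) ≠ 0 := by
    rw [hP, eval_prod, Finset.prod_ne_zero_iff]
    intro w hw
    have := (Finset.mem_erase.1 hw).1
    simp only [eval_sub, eval_X, eval_C]
    exact sub_ne_zero.2 (Ne.symm this)
  have hP1 : ∀ i ∈ s, z i ≠ z i0 → P.eval (z i) = 0 := by
    intro i hi hne
    rw [hP, eval_prod]
    apply Finset.prod_eq_zero (i := z i)
    · exact Finset.mem_erase.2 ⟨hne, Finset.mem_image_of_mem _ hi⟩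
    · simp
  have e1 : ∀ k, ∑ i ∈ s, P.eval (z i) * z i ^ k =
      ((s.filter fun i => z i = z i0).card : ℂ) * (P.eval (z i0) * z i0 ^ k) := by
    intro k
    rw [← nsmul_eq_mul, ← Finset.sum_const, Finset.sum_filter]
    refine Finset.sum_congr rfl fun i hi => ?_
    split_ifs with hc
    · rw [hc]
    · rw [hP1 i hi hc, zero_mul]
  have e2 : ∀ k, ∑ i ∈ s, P.eval (z i) * z i ^ k =
      ∑ j ∈ range (P.natDegree + 1), P.coeff j * ∑ i ∈ s, z i ^ (j + k) := by
    intro k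
    simp_rw [Finset.mul_sum]
    rw [Finset.sum_comm]
    refine Finset.sum_congr rfl fun i hi => ?_
    rw [eval_eq_sum_range, Finset.sum_mul]
    refine Finset.sum_congr rfl fun j _ => ?_
    rw [pow_add]; ring
  have hcard : 1 ≤ (s.filter fun i => z i = z i0).card :=
    Finset.card_pos.2 ⟨i0, Finset.mem_filter.2 ⟨hi0, rfl⟩⟩
  set D' : ℝ := ∑ j ∈ range (P.natDegree + 1), ‖P.coeff j‖ * (D * R ^ j)
  have e3 : ∀ k, k0 ≤ k → ‖P.eval (z i0)‖ * ‖z i0‖ ^ k ≤ D' * R ^ k := by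
    intro k hk
    have h1 : ‖P.eval (z i0)‖ * ‖z i0‖ ^ k ≤ ‖∑ i ∈ s, P.eval (z i) * z i ^ k‖ := by
      rw [e1, norm_mul, norm_mul, norm_pow, Complex.norm_natCast]
      have : (1:ℝ) ≤ ((s.filter fun i => z i = z i0).card : ℝ) := by exact_mod_cast hcard
      exact le_mul_of_one_le_left (by positivity) this
    refine h1.trans ?_
    rw [e2, Finset.sum_mul]
    refine (norm_sum_le _ _).trans (Finset.sum_le_sum fun j _ => ?_)
    rw [norm_mul, mul_assoc, mul_assoc, ← pow_add]
    exact mul_le_mul_of_nonneg_left (h _ (by omega)) (norm_nonneg _)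
  have hq : 1 < ‖z i0‖ / R := by rwa [one_lt_div hR]
  have hpos : 0 < ‖P.eval (z i0)‖ := norm_pos_iff.2 hP0
  obtain ⟨k, hk1, hk2⟩ := ((tendsto_pow_atTop_atTop_of_one_lt hq).eventually_gt_atTop
    (D' / ‖P.eval (z i0)‖) |>.and (eventually_ge_atTop k0)).exists
  have := e3 k hk2
  rw [div_pow, div_lt_div_iff₀ hpos (by positivity)] at hk1
  linarith

lemma WW_stable {p : ℕ} [Fact p.Prime] (ψ : AddChar (ZMod p) ℂ) (a b : ZMod p) (n k : ℕ) (hk : 1 ≤ k)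
    (hn : k ≤ n) : WW ψ a b n k = WW ψ a b k k := by
  letI : Fintype (GaloisField p k) := Fintype.ofFinite _
  have hf : Module.finrank (ZMod p) (GaloisField p k) = k := GaloisField.finrank p (by omega)
  have h1 := KSum_eq_WW ψ a b (GaloisField p k) n (by omega)
  have h2 := KSum_eq_WW ψ a b (GaloisField p k) k (by omega)
  rw [hf] at h1 h2
  rw [← h1, ← h2]

lemma exists_roots {p : ℕ} [Fact p.Prime] (ψ : AddChar (ZMod p) ℂ) (hψ : ψ.IsPrimitive) (a b : ZMod p)
    (ha : a ≠ 0) : ∃ α β : ℂ, ∀ n, 1 ≤ n → WW ψ a b n n = -(α ^ n + β ^ n) := by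
  have key : ∀ n : ℕ, (n:ℂ) * AA ψ a b n = ∑ k ∈ Icc 1 n, WW ψ a b k k * AA ψ a b (n - k) := by
    intro n
    rw [recurrence]
    refine Finset.sum_congr rfl fun k hk => ?_
    rw [WW_stable ψ a b n k (Finset.mem_Icc.1 hk).1 (Finset.mem_Icc.1 hk).2]
  obtain ⟨s, hs⟩ := IsAlgClosed.exists_eq_mul_self (AA ψ a b 1 ^ 2 - 4 * AA ψ a b 2)
  set A1 := AA ψ a b 1
  set A2 := AA ψ a b 2
  have h1 : WW ψ a b 1 1 = A1 := by
    have := key 1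
    simp [AA_zero] at this
    exact this.symm
  have h2 : WW ψ a b 2 2 = 2 * A2 - A1 ^ 2 := by
    have := key 2
    rw [Finset.sum_Icc_succ_top (by norm_num)] at this
    simp [AA_zero, h1] at this
    linear_combination -this
  have h3 : ∀ m, WW ψ a b (m+3) (m+3) = - A1 * WW ψ a b (m+2) (m+2) - A2 * WW ψ a b (m+1) (m+1) := by
    intro m
    have := key (m+3)
    rw [AA_big ψ hψ a b ha _ (by omega), Finset.sum_Icc_succ_top (by omega), Finset.sum_Icc_succ_top (by omega),
      Finset.sum_Icc_succ_top (by omega), Finset.sum_eq_zero (s := Icc 1 m)] at this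
    · rw [show m + 3 - (m + 1) = 2 by omega, show m + 2 + 1 - (m+2+1) = 0 by omega,
        show m + 3 - (m + 1 + 1) = 1 by omega, AA_zero] at this
      linear_combination -this
    · intro k hk
      rw [AA_big ψ hψ a b ha _ (by have := Finset.mem_Icc.1 hk; omega), mul_zero]
  refine ⟨(-A1 + s) / 2, (-A1 - s) / 2, ?_⟩
  have hsum : (-A1 + s) / 2 + (-A1 - s) / 2 = - A1 := by ring
  have hprod : (-A1 + s) / 2 * ((-A1 - s) / 2) = A2 := by linear_combination (1/4 : ℂ) * hs
  generalize (-A1 + s) / 2 = α at *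
  generalize (-A1 - s) / 2 = β at *
  have e1 : A1 = -(α + β) := by rw [hsum, neg_neg]
  intro n
  induction n using Nat.strong_induction_on with
  | _ n ih =>
    intro hn
    rcases n with _ | _ | _ | m
    · omega
    · simp only [zero_add]; rw [h1, e1]; ring
    · simp only [zero_add]
      rw [show 1 + 1 = 2 from rfl, h2, e1, ← hprod]; ring
    · rw [show m + 1 + 1 + 1 = m + 3 from rfl, h3, ih (m+2) (by omega) (by omega), ih (m+1) (by omega) (by omega), e1,
        ← hprod]
      ring

theorem weil_aux {p : ℕ} [Fact p.Prime] (hp : 3 ≤ p) (ψ : AddChar (ZMod p) ℂ) (hψ : ψ.IsPrimitive) (a : ZMod p)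
    (ha : a ≠ 0) : ‖WW ψ 1 a 1 1‖ ≤ 2 * Real.sqrt p := by
  have hex : ∀ c : ZMod p, ∃ z : Bool → ℂ, c ≠ 0 → ∀ n, 1 ≤ n → WW ψ c (c * a) n n =
      -(z true ^ n + z false ^ n) := by
    intro c
    by_cases hc : c = 0
    · exact ⟨fun _ => 0, fun h => absurd hc h⟩
    · obtain ⟨α, β, h⟩ := exists_roots ψ hψ c (c * a) hc
      exact ⟨fun b => if b then α else β, fun _ n hn => by simpa using h n hn⟩
  choose z hz using hex
  have hp0 : (0:ℝ) < p := by positivity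
  have hb : ∀ i ∈ (univ.filter fun c : ZMod p => c ≠ 0) ×ˢ (univ : Finset Bool), ‖z i.1 i.2 ^ 2‖ ≤ p := by
    refine power_sum _ (fun i : ZMod p × Bool => z i.1 i.2 ^ 2)
      ((4*p + (2*p+3)*p^2) + 2*p + 1 : ℕ) p hp0 2 ?_
    intro k hk
    letI : Fintype (GaloisField p (2*k)) := Fintype.ofFinite _
    have hf : Module.finrank (ZMod p) (GaloisField p (2*k)) = 2*k := GaloisField.finrank p (by omega)
    have hc : Fintype.card (GaloisField p (2*k)) = p ^ (2*k) := by
      rw [← Nat.card_eq_fintype_card, GaloisField.card p _ (by omega)]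
    have := sum_bound hp ψ hψ a ha (GaloisField p (2*k)) k hk hc
    refine le_of_eq_of_le ?_ this
    rw [Finset.sum_product, ← norm_neg, ← Finset.sum_neg_distrib]
    congr 1
    refine Finset.sum_congr rfl fun c hc => ?_
    have h := KSum_eq_WW ψ c (c*a) (GaloisField p (2*k)) (2*k) (by omega)
    rw [hf] at h
    rw [h, hz c (Finset.mem_filter.1 hc).2 _ (by omega)]
    simp [← pow_mul]
  have hb' : ∀ b, ‖z 1 b‖ ≤ Real.sqrt p := by
    intro b
    apply Real.le_sqrt_of_sq_le
    rw [← norm_pow]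
    exact hb (1, b) (by simp)
  have := hz 1 one_ne_zero 1 le_rfl
  rw [one_mul] at this
  rw [this, norm_neg, pow_one, pow_one]
  exact (norm_add_le _ _).trans (by linarith [hb' true, hb' false])

noncomputable def SS {p : ℕ} [Fact p.Prime] (ψ : AddChar (ZMod p) ℂ) (a b : ZMod p) : ℂ :=
  ∑ x ∈ univ.filter (fun x : ZMod p => x ≠ 0), ψ (a * x + b * x⁻¹)

lemma SS_eq {p : ℕ} [Fact p.Prime] (ψ : AddChar (ZMod p) ℂ) (a b : ZMod p) : SS ψ a b = WW ψ a b 1 1 := by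
  have h := KSum_eq_WW ψ a b (ZMod p) 1 (by simp)
  rw [Module.finrank_self] at h
  rw [← h, SS, KSum]
  simp

lemma SS_one_zero {p : ℕ} [Fact p.Prime] (ψ : AddChar (ZMod p) ℂ) (hψ : ψ.IsPrimitive) (a : ZMod p) (ha : a ≠ 0) :
    SS ψ a 0 = -1 := by
  have h : ∑ x : ZMod p, ψ (a * x) = 0 := by
    have := AddChar.sum_mulShift (ψ := ψ) a hψ
    rw [if_neg ha] at this
    simpa [mul_comm] using this
  rw [SS, Finset.filter_ne', ← Finset.sum_erase_add _ _ (Finset.mem_univ (0:ZMod p))] at *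
  simp at h ⊢
  linear_combination h

lemma SS_swap {p : ℕ} [Fact p.Prime] (ψ : AddChar (ZMod p) ℂ) (a b : ZMod p) : SS ψ a b = SS ψ b a := by
  unfold SS
  refine Finset.sum_nbij' (fun x => x⁻¹) (fun x => x⁻¹) ?_ ?_ ?_ ?_ ?_ <;> intro x hx <;> simp at hx ⊢
  · exact hx
  · exact hx
  · rw [add_comm]

lemma SS_scale {p : ℕ} [Fact p.Prime] (ψ : AddChar (ZMod p) ℂ) (a b : ZMod p) (ha : a ≠ 0) :
    SS ψ a b = SS ψ 1 (a * b) := by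
  unfold SS
  refine Finset.sum_nbij' (fun x => a * x) (fun x => a⁻¹ * x) ?_ ?_ ?_ ?_ ?_ <;> intro x hx <;>
    simp only [Finset.mem_filter, Finset.mem_univ, true_and] at hx ⊢
  · exact mul_ne_zero ha hx
  · exact mul_ne_zero (inv_ne_zero ha) hx
  · field_simp
  · field_simp
  · congr 1; field_simp

theorem weil {p : ℕ} [Fact p.Prime] (hp : 3 ≤ p) (ψ : AddChar (ZMod p) ℂ) (hψ : ψ.IsPrimitive) (a b : ZMod p)
    (hab : a ≠ 0 ∨ b ≠ 0) : ‖SS ψ a b‖ ≤ 2 * Real.sqrt p := by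
  have h1 : (1:ℝ) ≤ Real.sqrt p := by
    rw [Real.one_le_sqrt]; exact_mod_cast (by omega : 1 ≤ p)
  by_cases ha : a = 0
  · have hb : b ≠ 0 := by tauto
    rw [ha, SS_swap, SS_one_zero ψ hψ b hb]
    simp; linarith
  · by_cases hb : b = 0
    · rw [hb, SS_one_zero ψ hψ a ha]
      simp; linarith
    · rw [SS_scale ψ a b ha, SS_eq]
      exact weil_aux hp ψ hψ _ (mul_ne_zero ha hb)

end KS

namespace KS

noncomputable def hat {p : ℕ} [Fact p.Prime] (ψ : AddChar (ZMod p) ℂ) (I : Finset (ZMod p)) (h : ZMod p) : ℂ :=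
  ∑ x ∈ I, ψ (-(h * x))

lemma hat_inv {p : ℕ} [Fact p.Prime] (ψ : AddChar (ZMod p) ℂ) (hψ : ψ.IsPrimitive) (I : Finset (ZMod p)) (x : ZMod p) :
    ∑ h, hat ψ I h * ψ (h * x) = if x ∈ I then (p : ℂ) else 0 := by
  unfold hat
  simp_rw [Finset.sum_mul]
  rw [Finset.sum_comm]
  have : ∀ y ∈ I, ∑ h : ZMod p, ψ (-(h * y)) * ψ (h * x) = if x = y then (p:ℂ) else 0 := by
    intro y _
    have := AddChar.sum_mulShift (ψ := ψ) (x - y) hψ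
    rw [ZMod.card] at this
    simp_rw [← AddChar.map_add_eq_mul]
    rw [Finset.sum_congr rfl (g := fun h => ψ (h * (x - y))) (fun h _ => by congr 1; ring), this]
    by_cases hxy : x = y
    · simp [hxy]
    · simp [hxy, sub_eq_zero]
  rw [Finset.sum_congr rfl this, Finset.sum_ite_eq]

lemma count_formula {p : ℕ} [Fact p.Prime] (ψ : AddChar (ZMod p) ℂ) (hψ : ψ.IsPrimitive) (I J : Finset (ZMod p)) :
    ((univ.filter fun x : ZMod p => x ≠ 0 ∧ x ∈ I ∧ x⁻¹ ∈ J).card : ℂ) * (p:ℂ) ^ 2 =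
      ∑ h, ∑ l, hat ψ I h * hat ψ J l * SS ψ h l := by
  have e1 : ∑ h, ∑ l, hat ψ I h * hat ψ J l * SS ψ h l =
      ∑ x ∈ univ.filter (fun x : ZMod p => x ≠ 0), (∑ h, hat ψ I h * ψ (h * x)) * (∑ l, hat ψ J l * ψ (l * x⁻¹)) := by
    unfold SS
    have e : ∀ h l, hat ψ I h * hat ψ J l * ∑ x ∈ univ.filter (fun x : ZMod p => x ≠ 0), ψ (h * x + l * x⁻¹) =
        ∑ x ∈ univ.filter (fun x : ZMod p => x ≠ 0), (hat ψ I h * ψ (h * x)) * (hat ψ J l * ψ (l * x⁻¹)) := by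
      intro h l
      rw [Finset.mul_sum]
      refine Finset.sum_congr rfl fun x _ => ?_
      rw [AddChar.map_add_eq_mul]; ring
    simp_rw [e, Finset.sum_mul_sum]
    conv_rhs => rw [Finset.sum_comm]
    refine Finset.sum_congr rfl fun h _ => ?_
    rw [Finset.sum_comm]
  rw [e1]
  simp_rw [hat_inv ψ hψ]
  rw [Finset.card_filter, Finset.sum_filter]
  push_cast
  rw [Finset.sum_mul]
  refine Finset.sum_congr rfl fun x _ => ?_
  by_cases h1 : x ≠ 0 <;> by_cases h2 : x ∈ I <;> by_cases h3 : x⁻¹ ∈ J <;> simp [h1, h2, h3, sq]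

lemma SS_zero {p : ℕ} [Fact p.Prime] (ψ : AddChar (ZMod p) ℂ) : SS ψ 0 0 = (p:ℂ) - 1 := by
  unfold SS
  simp [Finset.filter_ne', ZMod.card]
  rw [Nat.cast_sub (Fact.out (p := p.Prime)).one_le, Nat.cast_one]

lemma hat_zero {p : ℕ} [Fact p.Prime] (ψ : AddChar (ZMod p) ℂ) (I : Finset (ZMod p)) : hat ψ I 0 = I.card := by
  simp [hat]

lemma count_bound {p : ℕ} [Fact p.Prime] (hp : 3 ≤ p) (ψ : AddChar (ZMod p) ℂ) (hψ : ψ.IsPrimitive)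
    (I J : Finset (ZMod p)) :
    |((univ.filter fun x : ZMod p => x ≠ 0 ∧ x ∈ I ∧ x⁻¹ ∈ J).card : ℝ) * (p:ℝ) ^ 2 - I.card * J.card * (p - 1)| ≤
      2 * Real.sqrt p * ((∑ h, ‖hat ψ I h‖) * (∑ h, ‖hat ψ J h‖)) := by
  have h := count_formula ψ hψ I J
  rw [← Finset.sum_product', ← Finset.sum_erase_add _ _ (show ((0, 0) : ZMod p × ZMod p) ∈ univ ×ˢ univ by simp)] at h
  simp only [SS_zero, hat_zero] at h
  have h' := sub_eq_of_eq_add h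
  have e : ((((univ.filter fun x : ZMod p => x ≠ 0 ∧ x ∈ I ∧ x⁻¹ ∈ J).card : ℝ) * (p:ℝ) ^ 2 - I.card * J.card * (p - 1) : ℝ) : ℂ) =
     ((univ.filter fun x : ZMod p => x ≠ 0 ∧ x ∈ I ∧ x⁻¹ ∈ J).card : ℂ) * (p:ℂ) ^ 2 - I.card * J.card * (p - 1) := by
    push_cast; rfl
  rw [← Real.norm_eq_abs, ← Complex.norm_real, e, h']
  refine (norm_sum_le _ _).trans ?_
  rw [Finset.sum_mul_sum, ← Finset.sum_product', Finset.mul_sum]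
  refine (Finset.sum_le_sum (g := fun x : ZMod p × ZMod p => 2 * Real.sqrt p * (‖hat ψ I x.1‖ * ‖hat ψ J x.2‖)) ?_).trans ?_
  · rintro ⟨a, b⟩ hx
    have hne := (Finset.mem_erase.1 hx).1
    have hw := weil hp ψ hψ a b (by
      by_contra hc; push Not at hc; exact hne (by rw [hc.1, hc.2]))
    rw [norm_mul, norm_mul, mul_comm]
    exact mul_le_mul_of_nonneg_right hw (by positivity)
  · exact Finset.sum_le_sum_of_subset_of_nonneg (Finset.erase_subset _ _) (fun _ _ _ => by positivity)

lemma sum_zmod {p : ℕ} [Fact p.Prime] (f : ZMod p → ℝ) : ∑ h, f h = ∑ v ∈ range p, f (v : ZMod p) := by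
  refine Finset.sum_nbij' (fun h => h.val) (fun v => (v : ZMod p)) ?_ ?_ ?_ ?_ ?_
  · intro h _; exact Finset.mem_range.2 (ZMod.val_lt h)
  · intro v _; exact Finset.mem_univ _
  · intro h _; exact ZMod.natCast_zmod_val h
  · intro v hv; exact ZMod.val_cast_of_lt (Finset.mem_range.1 hv)
  · intro h _; simp

lemma sin_lower (p v : ℕ) (hv : 1 ≤ v) (hvp : v < p) :
    2 * min (v:ℝ) (p - v) / p ≤ Real.sin (Real.pi * v / p) := by
  have hp : (0:ℝ) < p := by exact_mod_cast (by omega : 0 < p)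
  have hv' : (0:ℝ) < v := by exact_mod_cast hv
  have hvp' : (v:ℝ) < p := by exact_mod_cast hvp
  have hpi := Real.pi_pos
  have gen : ∀ w : ℝ, 0 ≤ w → 2 * w ≤ p → 2 * w / p ≤ Real.sin (Real.pi * w / p) := by
    intro w hw h
    have := Real.mul_le_sin (x := Real.pi * w / p) (by positivity) (by
      rw [div_le_div_iff₀ hp (by norm_num)]; nlinarith)
    refine le_of_eq_of_le ?_ this
    field_simp
  rcases le_total (2 * (v:ℝ)) p with h | h
  · refine le_trans ?_ (gen v hv'.le h)
    gcongr
    exact min_le_left _ _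
  · have := gen (p - v) (by linarith) (by linarith)
    rw [show Real.pi * (p - v) / p = Real.pi - Real.pi * v / p by field_simp, Real.sin_pi_sub] at this
    refine le_trans ?_ this
    gcongr
    exact min_le_right _ _

lemma char_lower {p : ℕ} [Fact p.Prime] (v : ℕ) (hv : 1 ≤ v) (hvp : v < p) :
    4 * min (v:ℝ) (p - v) / p ≤ ‖(ZMod.stdAddChar (N := p)) (-(v : ZMod p)) - 1‖ := by
  have h1 : ‖(ZMod.stdAddChar (N := p)) (-(v : ZMod p)) - 1‖ = ‖(ZMod.stdAddChar (N := p)) (v : ZMod p) - 1‖ := by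
    rw [AddChar.map_neg_eq_conj, ← Complex.norm_conj]
    simp
  have h2 : (ZMod.stdAddChar (N := p)) (v : ZMod p) = Complex.exp (Complex.I * ((2 * Real.pi * v / p : ℝ) : ℂ)) := by
    have := ZMod.stdAddChar_coe (N := p) (v : ℤ)
    push_cast at this
    rw [this]
    congr 1
    push_cast
    ring
  rw [h1, h2, Complex.norm_exp_I_mul_ofReal_sub_one, Real.norm_eq_abs]
  refine le_trans ?_ (le_abs_self _)
  have := sin_lower p v hv hvp
  rw [show 2 * Real.pi * v / p / 2 = Real.pi * v / p by ring]
  calc _ = 2 * (2 * min (v:ℝ) (p - v) / p) := by ring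
    _ ≤ _ := by linarith

lemma hat_interval {p : ℕ} [Fact p.Prime] (s t : ℕ) (hst : s ≤ t) (htp : t ≤ p) :
    ∑ h, ‖hat (ZMod.stdAddChar (N := p)) ((Ico s t).image (Nat.cast : ℕ → ZMod p)) h‖ ≤ p * (2 + Real.log p) := by
  have hp0 : 0 < p := (Fact.out (p := p.Prime)).pos
  have hp : (0:ℝ) < p := by exact_mod_cast hp0
  have hinj : Set.InjOn (Nat.cast : ℕ → ZMod p) (Ico s t) := by
    intro x hx y hy hxy
    have hx := Finset.mem_Ico.1 hx
    have hy := Finset.mem_Ico.1 hy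
    have := congrArg ZMod.val hxy
    rwa [ZMod.val_cast_of_lt (by omega), ZMod.val_cast_of_lt (by omega)] at this
  rw [sum_zmod, Finset.range_eq_Ico, ← Finset.sum_Ioo_add_eq_sum_Ico hp0]
  have h0 : ‖hat (ZMod.stdAddChar (N := p)) ((Ico s t).image (Nat.cast : ℕ → ZMod p)) ((0:ℕ) : ZMod p)‖ ≤ p := by
    rw [Nat.cast_zero, hat_zero, Complex.norm_natCast]
    have : ((Ico s t).image (Nat.cast : ℕ → ZMod p)).card ≤ p := by
      refine Finset.card_image_le.trans ?_
      simp; omega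
    exact_mod_cast this
  have h1 : ∀ v ∈ Ioo 0 p, ‖hat (ZMod.stdAddChar (N := p)) ((Ico s t).image (Nat.cast : ℕ → ZMod p)) (v : ZMod p)‖ ≤
      p / 2 * ((v:ℝ)⁻¹ + ((p - v : ℕ):ℝ)⁻¹) := by
    intro v hv
    obtain ⟨hv1, hv2⟩ := Finset.mem_Ioo.1 hv
    have hv1' : (0:ℝ) < v := by exact_mod_cast hv1
    have hv2' : (v:ℝ) < p := by exact_mod_cast hv2
    have hc := char_lower v hv1 hv2
    have hm : 0 < min (v:ℝ) (p - v) := lt_min hv1' (by linarith)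
    have hpos : 0 < ‖(ZMod.stdAddChar (N := p)) (-(v : ZMod p)) - 1‖ := lt_of_lt_of_le (by positivity) hc
    rw [hat, Finset.sum_image hinj]
    rw [Finset.sum_congr rfl (g := fun i => (ZMod.stdAddChar (N := p)) (-(v : ZMod p)) ^ i) (fun i _ => by
      rw [← AddChar.map_nsmul_eq_pow, nsmul_eq_mul]; congr 1; ring)]
    rw [geom_sum_Ico (sub_ne_zero.1 (norm_pos_iff.1 hpos)) hst, norm_div, div_le_iff₀ hpos]
    have hn : ‖(ZMod.stdAddChar (N := p)) (-(v : ZMod p)) ^ t - (ZMod.stdAddChar (N := p)) (-(v : ZMod p)) ^ s‖ ≤ 2 := by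
      refine (norm_sub_le _ _).trans ?_
      rw [norm_pow, norm_pow, AddChar.norm_apply]; norm_num
    refine hn.trans ?_
    rw [Nat.cast_sub hv2.le]
    have hmi : (min (v:ℝ) (p - v))⁻¹ ≤ (v:ℝ)⁻¹ + ((p:ℝ) - v)⁻¹ := by
      have a1 : 0 < (v:ℝ)⁻¹ := by positivity
      have a2 : 0 < ((p:ℝ) - v)⁻¹ := inv_pos.2 (by linarith)
      rcases min_choice (v:ℝ) (p - v) with h | h <;> rw [h] <;> linarith
    calc (2:ℝ) = p / 2 * (min (v:ℝ) (p - v))⁻¹ * (4 * min (v:ℝ) (p - v) / p) := by field_simp; norm_num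
      _ ≤ _ := by gcongr
  have h2 := Finset.sum_le_sum h1
  have h3 : ∑ v ∈ Ioo 0 p, (p:ℝ) / 2 * ((v:ℝ)⁻¹ + ((p - v : ℕ):ℝ)⁻¹) = p * ∑ v ∈ Ioo 0 p, (v:ℝ)⁻¹ := by
    rw [← Finset.mul_sum, Finset.sum_add_distrib]
    have : ∑ v ∈ Ioo 0 p, ((p - v : ℕ):ℝ)⁻¹ = ∑ v ∈ Ioo 0 p, (v:ℝ)⁻¹ := by
      refine Finset.sum_nbij' (fun v => p - v) (fun v => p - v) ?_ ?_ ?_ ?_ ?_ <;> intro v hv <;>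
        simp only [Finset.mem_Ioo] at hv ⊢ <;> omega
    rw [this]; ring
  have h4 : ∑ v ∈ Ioo 0 p, (v:ℝ)⁻¹ ≤ 1 + Real.log p := by
    refine le_trans ?_ (harmonic_le_one_add_log p)
    rw [harmonic_eq_sum_Icc]
    push_cast
    refine Finset.sum_le_sum_of_subset_of_nonneg ?_ (fun _ _ _ => by positivity)
    intro v hv
    simp only [Finset.mem_Ioo, Finset.mem_Icc] at hv ⊢
    omega
  rw [h3] at h2
  nlinarith

lemma starCount_eq {p : ℕ} [Fact p.Prime] (k : ℕ) (hk : k ≤ p - 1) (r : ℝ) (hr : 0 < r) (hM : ⌊r * p⌋₊ < p) :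
    starCount (Eblock p) k r = (univ.filter fun x : ZMod p => x ≠ 0 ∧ x ∈ (Ico 1 (k+1)).image (Nat.cast : ℕ → ZMod p) ∧
      x⁻¹ ∈ (Ico 0 (⌊r * p⌋₊ + 1)).image (Nat.cast : ℕ → ZMod p)).card := by
  have hp0 : 0 < p := (Fact.out (p := p.Prime)).pos
  have hp : (0:ℝ) < p := by exact_mod_cast hp0
  have hJ : ∀ y : ZMod p, y ∈ (Ico 0 (⌊r * p⌋₊ + 1)).image (Nat.cast : ℕ → ZMod p) ↔ y.val ≤ ⌊r * p⌋₊ := by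
    intro y
    simp only [Finset.mem_image, Finset.mem_Ico]
    constructor
    · rintro ⟨a, ha, rfl⟩
      rw [ZMod.val_cast_of_lt (by omega)]; omega
    · intro h
      exact ⟨y.val, by omega, ZMod.natCast_zmod_val y⟩
  unfold starCount
  refine Finset.card_nbij' (fun n => (n : ZMod p)) (fun x => x.val) ?_ ?_ ?_ ?_
  · intro n hn
    simp only [Finset.coe_filter, Set.mem_setOf_eq, Finset.mem_Icc, Set.mem_Icc] at hn
    obtain ⟨⟨h1, h2⟩, h3, h4⟩ := hn
    simp only [Finset.coe_filter, Set.mem_setOf_eq, hJ]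
    refine ⟨Finset.mem_univ _, ?_, Finset.mem_image_of_mem _ (Finset.mem_Ico.2 ⟨h1, by omega⟩), ?_⟩
    · rw [Ne, ZMod.natCast_eq_zero_iff]
      exact fun h => absurd (Nat.le_of_dvd h1 h) (by omega)
    · rw [Eblock, invMod, div_le_iff₀ hp] at h4
      exact Nat.le_floor h4
  · intro x hx
    simp only [Finset.coe_filter, Set.mem_setOf_eq, hJ] at hx
    obtain ⟨_, h0, h1, h2⟩ := hx
    obtain ⟨n, hn, rfl⟩ := Finset.mem_image.1 h1
    have hn := Finset.mem_Ico.1 hn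
    simp only [Finset.coe_filter, Set.mem_setOf_eq, Finset.mem_Icc, Set.mem_Icc]
    rw [ZMod.val_cast_of_lt (by omega)]
    refine ⟨by omega, by unfold Eblock; positivity, ?_⟩
    rw [Eblock, invMod, div_le_iff₀ hp]
    exact (Nat.le_floor_iff (by positivity)).1 h2
  · intro n hn
    have := (Finset.mem_Icc.1 (Finset.mem_filter.1 hn).1)
    exact ZMod.val_cast_of_lt (by omega)
  · intro x _
    exact ZMod.natCast_zmod_val x

lemma disc_bound {p : ℕ} [Fact p.Prime] (hp3 : 3 ≤ p) (k : ℕ) (hk1 : 1 ≤ k) (hk : k ≤ p - 1) (r : ℝ) (hr : 0 < r)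
    (hr1 : r ≤ 1) :
    |(starCount (Eblock p) k r : ℝ) - k * r| ≤ 1 + 2 * Real.sqrt p * (2 + Real.log p) ^ 2 := by
  have hp0 : 0 < p := (Fact.out (p := p.Prime)).pos
  have hp : (0:ℝ) < p := by exact_mod_cast hp0
  have hlog : 0 ≤ Real.log p := Real.log_natCast_nonneg p
  by_cases hM : ⌊r * p⌋₊ < p
  · have hcI : ((Ico 1 (k+1)).image (Nat.cast : ℕ → ZMod p)).card = k := by
      rw [Finset.card_image_of_injOn]
      · simp
      intro x hx y hy hxy
      have hx := Finset.mem_Ico.1 hx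
      have hy := Finset.mem_Ico.1 hy
      have := congrArg ZMod.val hxy
      rwa [ZMod.val_cast_of_lt (by omega), ZMod.val_cast_of_lt (by omega)] at this
    have hcJ : ((Ico 0 (⌊r * p⌋₊ + 1)).image (Nat.cast : ℕ → ZMod p)).card = ⌊r * p⌋₊ + 1 := by
      rw [Finset.card_image_of_injOn]
      · simp
      intro x hx y hy hxy
      have hx := Finset.mem_Ico.1 hx
      have hy := Finset.mem_Ico.1 hy
      have := congrArg ZMod.val hxy
      rwa [ZMod.val_cast_of_lt (by omega), ZMod.val_cast_of_lt (by omega)] at this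
    have hb := count_bound hp3 (ZMod.stdAddChar (N := p)) (ZMod.isPrimitive_stdAddChar p)
      ((Ico 1 (k+1)).image (Nat.cast : ℕ → ZMod p)) ((Ico 0 (⌊r * p⌋₊ + 1)).image (Nat.cast : ℕ → ZMod p))
    rw [← starCount_eq k hk r hr hM, hcI, hcJ] at hb
    have hI := hat_interval (p := p) 1 (k+1) (by omega) (by omega)
    have hJ := hat_interval (p := p) 0 (⌊r * p⌋₊ + 1) (by omega) (by omega)
    have hb2 := hb.trans (mul_le_mul_of_nonneg_left (mul_le_mul hI hJ (Finset.sum_nonneg fun _ _ => norm_nonneg _)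
      (by positivity)) (by positivity))
    set c : ℝ := (starCount (Eblock p) k r : ℝ)
    set M : ℕ := ⌊r * p⌋₊
    have hM1 : (M:ℝ) ≤ r * p := Nat.floor_le (by positivity)
    have hM2 : r * p < M + 1 := Nat.lt_floor_add_one _
    have hM3 : (M:ℝ) + 1 ≤ p := by exact_mod_cast hM
    have hkp : (k:ℝ) ≤ p := by exact_mod_cast (by omega : k ≤ p)
    have hk0 : (0:ℝ) ≤ k := by positivity
    push_cast at hb2
    have hmain : |(k:ℝ) * (M + 1) * (p - 1) - k * r * (p:ℝ) ^ 2| ≤ (p:ℝ) ^ 2 := by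
      rw [abs_le]
      have e : (k:ℝ) * (M + 1) * (p - 1) - k * r * p ^ 2 = k * p * (M + 1 - r * p) - k * (M + 1) := by ring
      have a1 : 0 ≤ (k:ℝ) * p * (M + 1 - r * p) := mul_nonneg (by positivity) (by linarith)
      have a2 : (k:ℝ) * p * (M + 1 - r * p) ≤ k * p * 1 := mul_le_mul_of_nonneg_left (by linarith) (by positivity)
      have a3 : (k:ℝ) * p ≤ p ^ 2 := by rw [sq]; gcongr
      have a4 : (k:ℝ) * (M + 1) ≤ p ^ 2 := by rw [sq]; gcongr
      have a5 : 0 ≤ (k:ℝ) * (M + 1) := by positivity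
      rw [e]; constructor <;> linarith
    have htot : |(c - k * r) * p ^ 2| ≤ (1 + 2 * Real.sqrt p * (2 + Real.log p) ^ 2) * p ^ 2 := by
      have : (c - k * r) * p ^ 2 = (c * p ^ 2 - k * (M + 1) * (p - 1)) + (k * (M + 1) * (p - 1) - k * r * p ^ 2) := by ring
      rw [this]
      refine (abs_add_le _ _).trans ?_
      calc _ ≤ _ := add_le_add hb2 hmain
        _ = _ := by ring
    rw [abs_mul, abs_of_pos (by positivity : (0:ℝ) < (p:ℝ)^2)] at htot
    exact le_of_mul_le_mul_right htot (by positivity)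
  · push Not at hM
    have : (p:ℝ) ≤ r * p := (Nat.le_floor_iff (by positivity)).1 hM
    have hr' : r = 1 := le_antisymm hr1 (by
      by_contra h; push Not at h; nlinarith)
    have hc : starCount (Eblock p) k r = k := by
      unfold starCount
      rw [Finset.filter_true_of_mem]
      · simp
      intro n hn
      refine ⟨by unfold Eblock; positivity, ?_⟩
      rw [hr', Eblock, invMod, div_le_one hp]
      exact_mod_cast (ZMod.val_lt _).le
    rw [hc, hr', mul_one, sub_self, abs_zero]
    positivity

theorem maxKD_bound {p : ℕ} [Fact p.Prime] (hp3 : 3 ≤ p) :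
    maxKD p ≤ 1 + 2 * Real.sqrt p * (2 + Real.log p) ^ 2 := by
  have hlog : 0 ≤ Real.log p := Real.log_natCast_nonneg p
  refine Real.sSup_le ?_ (by positivity)
  rintro x ⟨k, hk1, hk, rfl⟩
  have hk0 : (0:ℝ) < k := by exact_mod_cast hk1
  rw [mul_comm, ← le_div_iff₀ hk0]
  refine Real.sSup_le ?_ (by positivity)
  rintro d ⟨r, hr, hr1, rfl⟩
  rw [le_div_iff₀ hk0]
  refine le_of_eq_of_le ?_ (disc_bound hp3 k hk1 hk r hr hr1)
  rw [← abs_of_pos hk0, ← abs_mul, abs_of_pos hk0]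
  congr 1
  field_simp

end KS

namespace KS

lemma nthPrime_bounds (m : ℕ) (hm : 3 ≤ m) :
    ((nthPrime m : ℕ) : ℝ) ≤ 32 * m * Real.log m ∧ Real.log (nthPrime m) ≤ 8 * Real.log m := by
  have hpi : Nat.primeCounting (nthPrime m) = m := by
    have hp : (nthPrime m).Prime := Nat.prime_nth_prime _
    rw [Nat.primeCounting, Nat.primeCounting', Nat.count_succ, if_pos hp]
    have := Nat.primeCounting'_nth_eq (m - 1)
    rw [Nat.primeCounting'] at this
    unfold nthPrime
    omega
  have hpm : m + 1 ≤ nthPrime m := by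
    have := Nat.add_two_le_nth_prime (m - 1)
    unfold nthPrime; omega
  have h := Chebyshev.pi_ge (nthPrime m)
  rw [hpi] at h
  generalize nthPrime m = p at *
  have hp4 : (4:ℝ) ≤ p := by exact_mod_cast (by omega : 4 ≤ p)
  have hm3 : (3:ℝ) ≤ m := by exact_mod_cast hm
  have hlogp : 0 < Real.log p := Real.log_pos (by linarith)
  have hlogm : 0 < Real.log m := Real.log_pos (by linarith)
  rw [div_le_iff₀ hlogp] at h
  have h1 : Real.log (p + 1) ≤ m * Real.log p := by
    have : Real.log (p + 1) ≤ Real.log (p ^ 2) := Real.log_le_log (by linarith) (by nlinarith)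
    rw [Real.log_pow] at this
    push_cast at this
    nlinarith
  have hl2 := Real.log_two_gt_d9
  have h2 : (p:ℝ) ≤ 4 * m * Real.log p := by nlinarith
  have hs : Real.log p ≤ 2 * Real.sqrt p := by
    have := Real.log_le_sub_one_of_pos (x := Real.sqrt p) (Real.sqrt_pos.2 (by linarith))
    rw [Real.log_sqrt (by linarith)] at this
    linarith
  have hsp : 0 < Real.sqrt p := Real.sqrt_pos.2 (by linarith)
  have hsq : Real.sqrt p * Real.sqrt p = p := Real.mul_self_sqrt (by linarith)
  have h3 : Real.sqrt p ≤ 8 * m := by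
    by_contra hc
    push Not at hc
    nlinarith
  have h4 : (p:ℝ) ≤ 2 ^ 6 * m ^ 2 := by nlinarith
  have h5 : Real.log p ≤ 8 * Real.log m := by
    have := Real.log_le_log (by linarith) h4
    rw [Real.log_mul (by norm_num) (by positivity), Real.log_pow, Real.log_pow] at this
    have h2m : Real.log 2 ≤ Real.log m := Real.log_le_log (by norm_num) (by linarith)
    push_cast at this
    linarith
  refine ⟨?_, h5⟩
  nlinarith

lemma final_bound (m : ℕ) (hm : 3 ≤ m) :
    maxKD (nthPrime m) ≤ 2000 * (m : ℝ) ^ ((1 : ℝ) / 2) * Real.log m ^ ((5 : ℝ) / 2) := by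
  haveI : Fact (nthPrime m).Prime := ⟨Nat.prime_nth_prime _⟩
  have hpm : m + 1 ≤ nthPrime m := by
    have := Nat.add_two_le_nth_prime (m - 1)
    unfold nthPrime; omega
  obtain ⟨hA, hB⟩ := nthPrime_bounds m hm
  have h := maxKD_bound (p := nthPrime m) (by omega)
  have hm3 : (3:ℝ) ≤ m := by exact_mod_cast hm
  have hL : 1 ≤ Real.log m := by
    rw [Real.le_log_iff_exp_le (by linarith)]
    linarith [Real.exp_one_lt_d9]
  have hlp : 0 ≤ Real.log (nthPrime m) := Real.log_natCast_nonneg _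
  generalize nthPrime m = p at *
  refine h.trans ?_
  set L := Real.log m
  have e1 : (m : ℝ) ^ ((1 : ℝ) / 2) = Real.sqrt m := (Real.sqrt_eq_rpow _).symm
  have e2 : L ^ ((5 : ℝ) / 2) = L ^ 2 * Real.sqrt L := by
    rw [show (5:ℝ)/2 = 2 + 1/2 by norm_num, Real.rpow_add (by linarith), ← Real.sqrt_eq_rpow, Real.rpow_two]
  rw [e1, e2]
  have hs : Real.sqrt p ≤ 6 * Real.sqrt m * Real.sqrt L := by
    rw [Real.sqrt_le_left (by positivity), mul_pow, mul_pow, Real.sq_sqrt (by positivity), Real.sq_sqrt (by positivity)]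
    nlinarith
  have hq : (2 + Real.log p) ^ 2 ≤ (10 * L) ^ 2 := by
    apply pow_le_pow_left₀ (by positivity); linarith
  have hm1 : 1 ≤ Real.sqrt m := by rw [Real.one_le_sqrt]; linarith
  have hL1 : 1 ≤ Real.sqrt L := by rwa [Real.one_le_sqrt]
  have hone : 1 ≤ Real.sqrt m * (L ^ 2 * Real.sqrt L) :=
    one_le_mul_of_one_le_of_one_le hm1 (one_le_mul_of_one_le_of_one_le (one_le_pow₀ hL) hL1)
  calc 1 + 2 * Real.sqrt p * (2 + Real.log p) ^ 2
      ≤ Real.sqrt m * (L ^ 2 * Real.sqrt L) + 2 * (6 * Real.sqrt m * Real.sqrt L) * (10 * L) ^ 2 := by gcongr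
    _ = 1201 * (Real.sqrt m * (L ^ 2 * Real.sqrt L)) := by ring
    _ ≤ 2000 * Real.sqrt m * (L ^ 2 * Real.sqrt L) := by linarith

end KS

/-- `max_{1 ≤ k ≤ p_m − 1} k · D_k*(E_{p_m}) = O(m^{1/2} (ln m)^{5/2})`. -/
theorem maxKD_isBigO :
    ∃ C : ℝ, 0 < C ∧ ∃ m₀ : ℕ, ∀ m : ℕ, m₀ ≤ m →
      maxKD (nthPrime m) ≤ C * (m : ℝ) ^ ((1 : ℝ) / 2) * Real.log m ^ ((5 : ℝ) / 2) := by
  exact ⟨2000, by norm_num, 3, fun m hm => KS.final_bound m hm⟩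
end
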